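/- Assume the Riemann Hypothesis. Then for all x ≥ 10^13 and all δ ∈ (0, 10^{-13}], one has J_ψ(x,δ) ≤ 2.2258 · δ · (log(2.0001/δ))² · x². -/

import Mathlib

open ArithmeticFunction

/-- The Chebyshev psi function `ψ(x) = ∑_{n ≤ x} Λ(n)`. -/
noncomputable def chebyshevPsi (x : ℝ) : ℝ := ∑ n ∈ Finset.Iic ⌊x⌋₊, Λ n

namespace JpsiBound

open MeasureTheory Set Filter Topology

/-- The fractional part, cut off below `1`. -/
noncomputable def fractTail (t : ℝ) : ℂ := (Ioi (1 : ℝ)).indicator (fun t => ((Int.fract t : ℝ) : ℂ)) t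

lemma norm_fractTail_le (t : ℝ) : ‖fractTail t‖ ≤ 1 := by
  unfold fractTail
  by_cases h : t ∈ Ioi (1 : ℝ)
  · rw [indicator_of_mem h, Complex.norm_real, Real.norm_eq_abs, abs_of_nonneg (Int.fract_nonneg t)]
    exact (Int.fract_lt_one t).le
  · rw [indicator_of_notMem h]; simp

lemma measurable_fractTail : Measurable fractTail := by
  unfold fractTail
  exact (Complex.measurable_ofReal.comp measurable_fract).indicator measurableSet_Ioi

lemma differentiableAt_mellin_fractTail {s : ℂ} (hs : 0 < s.re) :
    DifferentiableAt ℂ (fun z => mellin fractTail (-z)) s := by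
  have : DifferentiableAt ℂ (mellin fractTail) (-s) := by
    refine mellin_differentiableAt_of_isBigO_rpow (a := 0) (b := -s.re - 1) ?_ ?_ ?_ ?_ ?_
    · apply LocallyIntegrable.locallyIntegrableOn
      have : LocallyIntegrable (fun _ : ℝ => (1 : ℝ)) volume := continuous_const.locallyIntegrable
      refine this.mono measurable_fractTail.aestronglyMeasurable (Eventually.of_forall fun t => ?_)
      simpa using norm_fractTail_le t
    · refine Asymptotics.IsBigO.of_bound 1 (Eventually.of_forall fun t => ?_)
      simpa using norm_fractTail_le t
    · simpa using hs
    · refine Asymptotics.IsBigO.of_bound 1 ?_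
      filter_upwards [mem_nhdsWithin_of_mem_nhds (Iio_mem_nhds (zero_lt_one (α := ℝ)))] with t ht
      have : fractTail t = 0 := indicator_of_notMem (by simpa using ht.le) _
      simp only [this, norm_zero]; positivity
    · simp
  exact this.comp (f := fun z : ℂ => -z) s differentiableAt_id.neg

lemma mellin_fractTail (s : ℂ) :
    mellin fractTail (-s) = ∫ t in Ioi (1 : ℝ), (t : ℂ) ^ (-s - 1) * ((Int.fract t : ℝ) : ℂ) := by
  unfold mellin fractTail
  have : ∀ t : ℝ, (t : ℂ) ^ (-s - 1) • (Ioi (1 : ℝ)).indicator (fun t => ((Int.fract t : ℝ) : ℂ)) t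
      = (Ioi (1 : ℝ)).indicator (fun t : ℝ => (t : ℂ) ^ (-s - 1) * ((Int.fract t : ℝ) : ℂ)) t := by
    intro t
    by_cases h : t ∈ Ioi (1 : ℝ) <;> simp [h]
  simp_rw [this]
  rw [setIntegral_indicator measurableSet_Ioi]
  congr 2
  ext t; simp

lemma norm_mellin_fractTail_le {s : ℂ} (hs : 0 < s.re) : ‖mellin fractTail (-s)‖ ≤ 1 / s.re := by
  rw [mellin_fractTail]
  have h1 : ∫ t in Ioi (1 : ℝ), t ^ (-s.re - 1) = 1 / s.re := by
    rw [integral_Ioi_rpow_of_lt (by linarith) one_pos]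
    simp
  rw [← h1]
  refine MeasureTheory.norm_integral_le_of_norm_le (integrableOn_Ioi_rpow_of_lt (by linarith) one_pos) ?_
  refine (ae_restrict_iff' measurableSet_Ioi).2 (Eventually.of_forall fun t ht => ?_)
  have ht0 : (0 : ℝ) < t := lt_trans one_pos ht
  rw [norm_mul, Complex.norm_cpow_eq_rpow_re_of_pos ht0, Complex.norm_real, Real.norm_eq_abs,
    abs_of_nonneg (Int.fract_nonneg t)]
  have := (Int.fract_lt_one t).le
  have h2 : 0 ≤ t ^ (-s.re - 1) := by positivity
  simpa using mul_le_mul_of_nonneg_left this h2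

lemma riemannZeta₁_eq_of_one_lt {s : ℂ} (hs : 1 < s.re) :
    riemannZeta₁ s = s - s * (s - 1) * mellin fractTail (-s) := by
  have hs1 : s ≠ 1 := by rintro rfl; simp at hs
  have hs10 : s - 1 ≠ 0 := sub_ne_zero.2 hs1
  have h := LSeries_eq_mul_integral_of_nonneg (fun _ => 1) (r := 1) zero_le_one (s := s) hs
    (by
      refine Asymptotics.IsBigO.of_bound 1 (Eventually.of_forall fun n => ?_)
      simp) (fun _ => zero_le_one)
  have h1 : LSeries (fun _ => ((1 : ℝ) : ℂ)) s = riemannZeta s := by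
    rw [← LSeries_one_eq_riemannZeta hs]; congr 1
  rw [h1, riemannZeta_eq_inv_sub_mul hs1] at h
  have h2 : ∫ t in Ioi (1 : ℝ), (∑ k ∈ Finset.Icc 1 ⌊t⌋₊, ((1 : ℝ) : ℂ)) * (t : ℂ) ^ (-(s + 1))
      = ∫ t in Ioi (1 : ℝ), ((t : ℂ) ^ (-s) - (t : ℂ) ^ (-s - 1) * ((Int.fract t : ℝ) : ℂ)) := by
    refine setIntegral_congr_fun measurableSet_Ioi fun t ht => ?_
    have ht0 : (0 : ℝ) < t := lt_trans one_pos ht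
    have h3 : (t : ℂ) ^ (-s) = (t : ℂ) ^ (-s - 1) * t := by
      rw [Complex.cpow_sub _ _ (by exact_mod_cast ht0.ne'), Complex.cpow_one, div_mul_cancel₀ _ (by exact_mod_cast ht0.ne')]
    have h4 : ((⌊t⌋₊ : ℕ) : ℂ) = (t : ℂ) - ((Int.fract t : ℝ) : ℂ) := by
      have : ((⌊t⌋₊ : ℕ) : ℝ) = t - Int.fract t := by
        rw [natCast_floor_eq_intCast_floor ht0.le, Int.self_sub_fract]
      rw [← Complex.ofReal_sub, ← this]; simp
    simp only [Complex.ofReal_one, Finset.sum_const, Nat.card_Icc, add_tsub_cancel_right, nsmul_eq_mul, mul_one]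
    rw [h3, h4, show -(s+1) = -s - 1 by ring]; ring
  have i1 : IntegrableOn (fun t : ℝ => (t : ℂ) ^ (-s)) (Ioi 1) :=
    integrableOn_Ioi_cpow_of_lt (by simpa using hs) one_pos
  have i2 : IntegrableOn (fun t : ℝ => (t : ℂ) ^ (-s - 1) * ((Int.fract t : ℝ) : ℂ)) (Ioi 1) := by
    have i3 : IntegrableOn (fun t : ℝ => (t : ℂ) ^ (-s - 1)) (Ioi 1) :=
      integrableOn_Ioi_cpow_of_lt (by simp; linarith) one_pos
    refine Integrable.mul_bdd (c := 1) i3 (Complex.measurable_ofReal.comp measurable_fract).aestronglyMeasurable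
      (Eventually.of_forall fun t => ?_)
    rw [Complex.norm_real, Real.norm_eq_abs, abs_of_nonneg (Int.fract_nonneg t)]
    exact (Int.fract_lt_one t).le
  rw [h2, integral_sub i1 i2, integral_Ioi_cpow_of_lt (by simpa using hs) one_pos, ← mellin_fractTail] at h
  simp only [Complex.ofReal_one, Complex.one_cpow] at h
  have h5 : -s + 1 ≠ 0 := by
    intro h; apply hs10; linear_combination -h
  field_simp at h
  have : (-s + 1) * riemannZeta₁ s = (-s+1) * (s - s * (s - 1) * mellin fractTail (-s)) := by
    rw [mul_comm, h]; ring
  exact mul_left_cancel₀ h5 this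

lemma riemannZeta₁_eq {s : ℂ} (hs : 0 < s.re) :
    riemannZeta₁ s = s - s * (s - 1) * mellin fractTail (-s) := by
  have ho : IsOpen {z : ℂ | 0 < z.re} := isOpen_lt continuous_const Complex.continuous_re
  have h1 : AnalyticOnNhd ℂ riemannZeta₁ {z : ℂ | 0 < z.re} :=
    differentiable_riemannZeta₁.differentiableOn.analyticOnNhd ho
  have h2 : AnalyticOnNhd ℂ (fun s => s - s * (s - 1) * mellin fractTail (-s)) {z : ℂ | 0 < z.re} := by
    refine DifferentiableOn.analyticOnNhd (fun z hz => ?_) ho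
    have := differentiableAt_mellin_fractTail hz
    exact (by fun_prop : DifferentiableAt ℂ (fun s => s - s * (s - 1) * mellin fractTail (-s)) z).differentiableWithinAt
  refine h1.eqOn_of_preconnected_of_eventuallyEq h2 (convex_halfSpace_re_gt 0).isPreconnected
    (z₀ := 2) (by simp) ?_ hs
  filter_upwards [(isOpen_lt continuous_const Complex.continuous_re).mem_nhds
    (show (2 : ℂ) ∈ {z : ℂ | 1 < z.re} by simp)] with z hz
  exact riemannZeta₁_eq_of_one_lt hz

lemma norm_riemannZeta₁_le {s : ℂ} (hs : 1 / 4 ≤ s.re) :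
    ‖riemannZeta₁ s‖ ≤ 5 * (1 + ‖s‖) ^ 2 := by
  have h0 : 0 < s.re := by linarith
  rw [riemannZeta₁_eq h0]
  have h1 := norm_mellin_fractTail_le h0
  have h2 : 1 / s.re ≤ 4 := by
    rw [div_le_iff₀ h0]; linarith
  have h3 : ‖s - 1‖ ≤ ‖s‖ + 1 := by simpa using norm_sub_le s 1
  have hn := norm_nonneg s
  calc _ ≤ ‖s‖ + ‖s‖ * ‖s - 1‖ * ‖mellin fractTail (-s)‖ := by
        refine (norm_sub_le _ _).trans ?_; simp
    _ ≤ ‖s‖ + ‖s‖ * (‖s‖ + 1) * 4 := by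
        gcongr; linarith
    _ ≤ _ := by nlinarith

/-- The entire function `w (w - 1) ζ(w)`. -/
noncomputable def xiCore (w : ℂ) : ℂ := w * riemannZeta₁ w

lemma differentiable_xiCore : Differentiable ℂ xiCore := by unfold xiCore; fun_prop

lemma xiCore_eq {w : ℂ} (hw : w ≠ 1) : xiCore w = w * (w - 1) * riemannZeta w := by
  have : w - 1 ≠ 0 := sub_ne_zero.2 hw
  rw [xiCore, riemannZeta_eq_inv_sub_mul hw]; field_simp

lemma norm_xiCore_le {s : ℂ} (hs : 1 / 4 ≤ s.re) : ‖xiCore s‖ ≤ 5 * (1 + ‖s‖) ^ 3 := by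
  have h := norm_riemannZeta₁_le hs
  have hn := norm_nonneg s
  rw [xiCore, norm_mul]
  calc _ ≤ (1 + ‖s‖) * (5 * (1 + ‖s‖) ^ 2) := by gcongr; linarith
    _ = _ := by ring

lemma xiCore_ne_zero (hRH : RiemannHypothesis) {w : ℂ} (hw : 1 / 2 < w.re) : xiCore w ≠ 0 := by
  by_cases h1 : w = 1
  · subst h1; simp [xiCore]
  have hw0 : w ≠ 0 := by rintro rfl; simp at hw; linarith
  rw [xiCore_eq h1]
  refine mul_ne_zero (mul_ne_zero hw0 (sub_ne_zero.2 h1)) fun h => ?_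
  have := hRH w h (by
    rintro ⟨n, hn⟩
    rw [hn] at hw
    simp at hw
    have : (0 : ℝ) ≤ n := n.cast_nonneg
    linarith) h1
  linarith

lemma xiCore_conj (w : ℂ) : xiCore (starRingEnd ℂ w) = starRingEnd ℂ (xiCore w) := by
  by_cases h1 : w = 1
  · subst h1; simp [xiCore]
  have : starRingEnd ℂ w ≠ 1 := fun h => h1 (by simpa using congrArg (starRingEnd ℂ) h)
  rw [xiCore_eq h1, xiCore_eq this, riemannZeta_conj]; simp

lemma conj_ofReal_add_mul_I (a t : ℝ) :
    starRingEnd ℂ ((a : ℂ) + t * Complex.I) = (a : ℂ) + ((-t : ℝ) : ℂ) * Complex.I := by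
  simp

lemma norm_add_natCast_sq (b τ : ℝ) (j : ℕ) :
    ‖((b : ℂ) + τ * Complex.I) + j‖ ^ 2 = (b + j) ^ 2 + τ ^ 2 := by
  rw [← Complex.normSq_eq_norm_sq, Complex.normSq_apply]; simp; ring

/-- Comparison function in the estimate for ratios of Gamma values. -/
noncomputable def gammaComp (τ : ℝ) (n : ℕ) : ℝ :=
  Real.log ((n + 2) ^ 2 + τ ^ 2) / 2 - Real.log (4 + τ ^ 2) / 2 - 5 / 4 * (1 - 1 / (n + 1))

lemma gammaComp_succ_le (τ : ℝ) (n : ℕ) :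
    gammaComp τ (n + 1) ≤
      gammaComp τ n + ((n + 1 : ℝ) + 1 / 4) / (((n + 1 : ℝ) + 1 / 2) ^ 2 + τ ^ 2) := by
  have hn : (0 : ℝ) ≤ n := n.cast_nonneg
  have hτ := sq_nonneg τ
  have h1 : Real.log ((n + 3) ^ 2 + τ ^ 2) - Real.log ((n + 2) ^ 2 + τ ^ 2)
      ≤ (2 * n + 5) / ((n + 2) ^ 2 + τ ^ 2) := by
    rw [← Real.log_div (by positivity) (by positivity)]
    refine (Real.log_le_sub_one_of_pos (by positivity)).trans (le_of_eq ?_)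
    field_simp; ring
  have h2 : ((n + 1 : ℝ) + 1 / 4) / ((n + 2) ^ 2 + τ ^ 2) ≤
      ((n + 1 : ℝ) + 1 / 4) / (((n + 1 : ℝ) + 1 / 2) ^ 2 + τ ^ 2) := by
    apply div_le_div_of_nonneg_left (by positivity) (by positivity); nlinarith
  have h3 : (1 : ℝ) / ((n + 2) ^ 2 + τ ^ 2) ≤ 1 / (n + 1) - 1 / (n + 2) := by
    rw [div_sub_div _ _ (by positivity) (by positivity), div_le_div_iff₀ (by positivity) (by positivity)]
    nlinarith
  have h4 : (2 * n + 5 : ℝ) / ((n + 2) ^ 2 + τ ^ 2) / 2 =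
      ((n + 1 : ℝ) + 1 / 4) / ((n + 2) ^ 2 + τ ^ 2) + 5 / 4 * (1 / ((n + 2) ^ 2 + τ ^ 2)) := by
    ring
  unfold gammaComp
  push_cast
  rw [show (n : ℝ) + 1 + 2 = n + 3 by ring, show (n : ℝ) + 1 + 1 = n + 2 by ring]
  linarith

lemma prod_norm_le (h τ : ℝ) (h0 : 0 ≤ h) (h1 : h ≤ 1 / 2) (n : ℕ) :
    ∏ j ∈ Finset.range (n + 1), ‖(((1 / 4 - h / 2 : ℝ) : ℂ) + τ * Complex.I) + j‖ ≤
      Real.exp (-h * gammaComp τ n) *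
        ∏ j ∈ Finset.range (n + 1), ‖(((1 / 4 + h / 2 : ℝ) : ℂ) + τ * Complex.I) + j‖ := by
  induction n with
  | zero =>
    simp only [zero_add, Finset.prod_range_one]
    have : gammaComp τ 0 = 0 := by unfold gammaComp; norm_num
    rw [this, mul_zero, Real.exp_zero, one_mul]
    rw [← pow_le_pow_iff_left₀ (norm_nonneg _) (norm_nonneg _) two_ne_zero]
    rw [norm_add_natCast_sq, norm_add_natCast_sq]
    push_cast; nlinarith
  | succ n ih =>
    rw [Finset.prod_range_succ, Finset.prod_range_succ _ (n + 1)]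
    set c : ℝ := ((n + 1 : ℝ) + 1 / 4) / (((n + 1 : ℝ) + 1 / 2) ^ 2 + τ ^ 2) with hc
    have hn : (0 : ℝ) ≤ n := n.cast_nonneg
    have hτ := sq_nonneg τ
    have hf : ‖(((1 / 4 - h / 2 : ℝ) : ℂ) + τ * Complex.I) + (n + 1 : ℕ)‖ ≤
        Real.exp (-h * c) * ‖(((1 / 4 + h / 2 : ℝ) : ℂ) + τ * Complex.I) + (n + 1 : ℕ)‖ := by
      rw [← pow_le_pow_iff_left₀ (norm_nonneg _) (by positivity) two_ne_zero]
      rw [mul_pow, norm_add_natCast_sq, norm_add_natCast_sq, ← Real.exp_nat_mul]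
      push_cast
      set D : ℝ := (1 / 4 + h / 2 + (n + 1)) ^ 2 + τ ^ 2 with hD
      have hD0 : 0 < D := by positivity
      have hcD : c * D ≤ (n + 1 : ℝ) + 1 / 4 := by
        rw [hc, div_mul_eq_mul_div, div_le_iff₀ (by positivity)]
        apply mul_le_mul_of_nonneg_left _ (by positivity)
        nlinarith
      have he : 1 - 2 * h * c ≤ Real.exp (2 * (-h * c)) := by
        have := Real.add_one_le_exp (2 * (-h * c)); linarith
      calc _ = D - 2 * h * ((n + 1 : ℝ) + 1 / 4) := by rw [hD]; ring
        _ ≤ D - 2 * h * (c * D) := by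
          have := mul_le_mul_of_nonneg_left hcD (by positivity : (0 : ℝ) ≤ 2 * h); linarith
        _ = (1 - 2 * h * c) * D := by ring
        _ ≤ _ := mul_le_mul_of_nonneg_right he hD0.le
    calc _ ≤ _ := mul_le_mul ih hf (norm_nonneg _) (by positivity)
      _ = Real.exp (-h * (gammaComp τ n + c)) *
          ((∏ j ∈ Finset.range (n + 1), ‖(((1 / 4 + h / 2 : ℝ) : ℂ) + τ * Complex.I) + j‖) *
            ‖(((1 / 4 + h / 2 : ℝ) : ℂ) + τ * Complex.I) + (n + 1 : ℕ)‖) := by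
        rw [mul_add (-h), Real.exp_add]; ring
      _ ≤ _ := by
        apply mul_le_mul_of_nonneg_right _ (by positivity)
        apply Real.exp_le_exp.2
        have := mul_le_mul_of_nonneg_left (gammaComp_succ_le τ n) h0
        rw [← hc] at this; linarith

lemma norm_GammaSeq_eq (b τ : ℝ) {n : ℕ} (hn : 0 < n) :
    ‖Complex.GammaSeq ((b : ℂ) + τ * Complex.I) n‖ =
      (n : ℝ) ^ b * n.factorial / ∏ j ∈ Finset.range (n + 1), ‖((b : ℂ) + τ * Complex.I) + j‖ := by
  rw [Complex.GammaSeq, norm_div, norm_mul, norm_prod, Complex.norm_natCast,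
    Complex.norm_natCast_cpow_of_pos hn]
  simp

lemma norm_Gamma_ratio_le (h τ : ℝ) (h0 : 0 ≤ h) (h1 : h < 1 / 2) :
    ‖Complex.Gamma (((1 / 4 + h / 2 : ℝ) : ℂ) + τ * Complex.I)‖ ≤
      Real.exp (h * (Real.log (4 + τ ^ 2) / 2 + 5 / 4)) *
        ‖Complex.Gamma (((1 / 4 - h / 2 : ℝ) : ℂ) + τ * Complex.I)‖ := by
  have t1 := (Complex.GammaSeq_tendsto_Gamma (((1 / 4 + h / 2 : ℝ) : ℂ) + τ * Complex.I)).norm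
  have t2 := ((Complex.GammaSeq_tendsto_Gamma (((1 / 4 - h / 2 : ℝ) : ℂ) + τ * Complex.I)).norm).const_mul
    (Real.exp (h * (Real.log (4 + τ ^ 2) / 2 + 5 / 4)))
  refine le_of_tendsto_of_tendsto t1 t2 ?_
  filter_upwards [eventually_gt_atTop 0] with n hn
  have hn' : (0 : ℝ) < n := by exact_mod_cast hn
  rw [norm_GammaSeq_eq _ τ hn, norm_GammaSeq_eq _ τ hn]
  have hp := prod_norm_le h τ h0 h1.le n
  set A := ∏ j ∈ Finset.range (n + 1), ‖(((1 / 4 - h / 2 : ℝ) : ℂ) + τ * Complex.I) + j‖ with hA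
  set A' := ∏ j ∈ Finset.range (n + 1), ‖(((1 / 4 + h / 2 : ℝ) : ℂ) + τ * Complex.I) + j‖ with hA'
  have pos : ∀ b : ℝ, 0 < b → 0 < ∏ j ∈ Finset.range (n + 1), ‖((b : ℂ) + τ * Complex.I) + j‖ := by
    intro b hb
    refine Finset.prod_pos fun j _ => norm_pos_iff.2 fun h => ?_
    have := congrArg Complex.re h
    simp at this
    have hj : (0 : ℝ) ≤ j := j.cast_nonneg
    linarith
  have hA0 : 0 < A := pos _ (by linarith)
  have hA'0 : 0 < A' := pos _ (by linarith)
  have hg : Real.log n - Real.log (4 + τ ^ 2) / 2 - 5 / 4 ≤ gammaComp τ n := by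
    unfold gammaComp
    have e1 : Real.log n ≤ Real.log ((n + 2) ^ 2 + τ ^ 2) / 2 := by
      have : Real.log (n ^ 2) ≤ Real.log ((n + 2) ^ 2 + τ ^ 2) := by
        apply Real.log_le_log (by positivity)
        nlinarith [sq_nonneg τ]
      rw [Real.log_pow] at this; push_cast at this; linarith
    have e2 : (0 : ℝ) ≤ 1 / (n + 1) := by positivity
    linarith
  rw [← mul_div_assoc, div_le_div_iff₀ hA'0 hA0]
  have e3 : (n : ℝ) ^ (1 / 4 + h / 2) = (n : ℝ) ^ (1 / 4 - h / 2) * Real.exp (h * Real.log n) := by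
    rw [Real.rpow_def_of_pos hn', Real.rpow_def_of_pos hn', ← Real.exp_add]; ring_nf
  have e4 : Real.exp (h * Real.log n) * Real.exp (-h * gammaComp τ n) ≤
      Real.exp (h * (Real.log (4 + τ ^ 2) / 2 + 5 / 4)) := by
    rw [← Real.exp_add]; apply Real.exp_le_exp.2
    have := mul_le_mul_of_nonneg_left hg h0
    linarith
  rw [e3]
  calc _ ≤ (n : ℝ) ^ (1 / 4 - h / 2) * Real.exp (h * Real.log n) * n.factorial *
        (Real.exp (-h * gammaComp τ n) * A') := by gcongr
    _ = (Real.exp (h * Real.log n) * Real.exp (-h * gammaComp τ n)) *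
        ((n : ℝ) ^ (1 / 4 - h / 2) * n.factorial * A') := by ring
    _ ≤ Real.exp (h * (Real.log (4 + τ ^ 2) / 2 + 5 / 4)) *
        ((n : ℝ) ^ (1 / 4 - h / 2) * n.factorial * A') := by gcongr
    _ = _ := by ring

lemma norm_Gammaℝ_eq (b t : ℝ) :
    ‖Complex.Gammaℝ ((b : ℂ) + t * Complex.I)‖ =
      Real.pi ^ (-b / 2) * ‖Complex.Gamma (((b / 2 : ℝ) : ℂ) + ((t / 2 : ℝ) : ℂ) * Complex.I)‖ := by
  rw [Complex.Gammaℝ_def, norm_mul, Complex.norm_cpow_eq_rpow_re_of_pos Real.pi_pos]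
  congr 2
  · simp
  · congr 1; push_cast; ring

lemma exp_five_quarters_le : Real.exp (5 / 4) ≤ 2 * Real.pi := by
  have h1 : Real.exp (5 / 4) ≤ Real.exp 1 ^ 2 / Real.exp (3 / 4) := by
    rw [le_div_iff₀ (Real.exp_pos _), ← Real.exp_add, ← Real.exp_nat_mul]; norm_num
  have h2 : 7 / 4 ≤ Real.exp (3 / 4) := by have := Real.add_one_le_exp (3 / 4 : ℝ); linarith
  have h3 := Real.exp_one_lt_d9
  have h4 := Real.pi_gt_three
  have h5 : Real.exp 1 ^ 2 ≤ 8 := by nlinarith [Real.exp_pos 1]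
  refine h1.trans ?_
  rw [div_le_iff₀ (by positivity)]
  nlinarith

lemma norm_xiCore_half_sub_le {h : ℝ} (t : ℝ) (h0 : 0 < h) (h1 : h < 1 / 2) :
    ‖xiCore (((1 / 2 - h : ℝ) : ℂ) + t * Complex.I)‖ ≤
      ‖(4 + t * Complex.I : ℂ)‖ ^ h * ‖xiCore (((1 / 2 + h : ℝ) : ℂ) + t * Complex.I)‖ := by
  set w : ℂ := ((1 / 2 - h : ℝ) : ℂ) + t * Complex.I with hw
  set s : ℂ := ((1 / 2 + h : ℝ) : ℂ) + t * Complex.I with hs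
  have hsw : starRingEnd ℂ s = 1 - w := by
    apply Complex.ext
    · simp [hs, hw]; ring
    · simp [hs, hw]
  have hwre : w.re = 1 / 2 - h := by simp [hw]
  have hsre : s.re = 1 / 2 + h := by simp [hs]
  have hw1 : w ≠ 1 := fun h => by rw [h] at hwre; simp at hwre; linarith
  have hw0 : w ≠ 0 := fun h => by rw [h] at hwre; simp at hwre; linarith
  have h1w1 : 1 - w ≠ 1 := by simpa using hw0
  have h1w0 : 1 - w ≠ 0 := sub_ne_zero.2 hw1.symm
  have hX : ‖xiCore s‖ = ‖xiCore (1 - w)‖ := by rw [← hsw, xiCore_conj, RCLike.norm_conj]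
  rw [hX, xiCore_eq hw1, xiCore_eq h1w1]
  have hG : ‖Complex.Gammaℝ (1 - w)‖ = ‖Complex.Gammaℝ s‖ := by
    rw [← hsw, hs]
    have : starRingEnd ℂ (((1 / 2 + h : ℝ) : ℂ) + t * Complex.I) =
        ((1 / 2 + h : ℝ) : ℂ) + ((-t : ℝ) : ℂ) * Complex.I := conj_ofReal_add_mul_I _ _
    rw [this, norm_Gammaℝ_eq, norm_Gammaℝ_eq]
    congr 1
    rw [← RCLike.norm_conj, ← Complex.Gamma_conj]
    rw [conj_ofReal_add_mul_I, neg_div, neg_neg]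
  have hz1 := riemannZeta_def_of_ne_zero hw0
  have hz2 := riemannZeta_def_of_ne_zero h1w0
  have hg1 : Complex.Gammaℝ w ≠ 0 := Complex.Gammaℝ_ne_zero_of_re_pos (by rw [hwre]; linarith)
  have hg2 : Complex.Gammaℝ (1 - w) ≠ 0 :=
    Complex.Gammaℝ_ne_zero_of_re_pos (by simp [hwre]; linarith)
  have hfe : riemannZeta w * Complex.Gammaℝ w = riemannZeta (1 - w) * Complex.Gammaℝ (1 - w) := by
    rw [hz1, hz2, div_mul_cancel₀ _ hg1, div_mul_cancel₀ _ hg2, completedRiemannZeta_one_sub]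
  have hN : ‖riemannZeta w‖ * ‖Complex.Gammaℝ w‖ = ‖riemannZeta (1 - w)‖ * ‖Complex.Gammaℝ s‖ := by
    rw [← hG, ← norm_mul, ← norm_mul, hfe]
  have hgw : 0 < ‖Complex.Gammaℝ w‖ := norm_pos_iff.2 hg1
  have hratio : ‖Complex.Gammaℝ s‖ ≤ ‖(4 + t * Complex.I : ℂ)‖ ^ h * ‖Complex.Gammaℝ w‖ := by
    rw [hs, hw, norm_Gammaℝ_eq, norm_Gammaℝ_eq]
    have hr := norm_Gamma_ratio_le h (t / 2) h0.le h1
    rw [show (1 / 2 + h) / 2 = 1 / 4 + h / 2 by ring, show (1 / 2 - h) / 2 = 1 / 4 - h / 2 by ring]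
    have hn : ‖(4 + t * Complex.I : ℂ)‖ = 2 * Real.sqrt (4 + (t / 2) ^ 2) := by
      rw [Complex.norm_eq_sqrt_sq_add_sq]
      rw [show (2 : ℝ) = Real.sqrt 4 by rw [show (4 : ℝ) = 2 ^ 2 by norm_num]; simp,
        ← Real.sqrt_mul (by norm_num)]
      congr 1; simp
      rw [show Real.sqrt 4 = 2 by rw [show (4 : ℝ) = 2 ^ 2 by norm_num]; simp]
      ring
    have hpos : 0 < 4 + (t / 2) ^ 2 := by positivity
    have hl : Real.exp (h * (Real.log (4 + (t / 2) ^ 2) / 2 + 5 / 4)) ≤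
        Real.pi ^ h * ‖(4 + t * Complex.I : ℂ)‖ ^ h := by
      rw [← Real.mul_rpow Real.pi_pos.le (norm_nonneg _), hn, mul_comm h, Real.exp_mul]
      apply Real.rpow_le_rpow (Real.exp_pos _).le _ h0.le
      rw [Real.exp_add, ← Real.log_sqrt hpos.le, Real.exp_log (Real.sqrt_pos.2 hpos)]
      have := mul_le_mul_of_nonneg_left exp_five_quarters_le (Real.sqrt_nonneg (4 + (t / 2) ^ 2))
      linarith
    have e : Real.pi ^ (-(1 / 2 + h) / 2) * Real.pi ^ h = Real.pi ^ (-(1 / 2 - h) / 2) := by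
      rw [← Real.rpow_add Real.pi_pos]; congr 1; ring
    calc _ ≤ Real.pi ^ (-(1 / 2 + h) / 2) * ((Real.pi ^ h * ‖(4 + t * Complex.I : ℂ)‖ ^ h) *
          ‖Complex.Gamma (((1 / 4 - h / 2 : ℝ) : ℂ) + ((t / 2 : ℝ) : ℂ) * Complex.I)‖) := by
          refine mul_le_mul_of_nonneg_left (hr.trans ?_) (by positivity)
          exact mul_le_mul_of_nonneg_right hl (norm_nonneg _)
      _ = (Real.pi ^ (-(1 / 2 + h) / 2) * Real.pi ^ h) * (‖(4 + t * Complex.I : ℂ)‖ ^ h *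
          ‖Complex.Gamma (((1 / 4 - h / 2 : ℝ) : ℂ) + ((t / 2 : ℝ) : ℂ) * Complex.I)‖) := by ring
      _ = _ := by rw [e]; ring
  have hz : ‖riemannZeta w‖ ≤ ‖(4 + t * Complex.I : ℂ)‖ ^ h * ‖riemannZeta (1 - w)‖ := by
    refine le_of_mul_le_mul_right ?_ hgw
    rw [hN]
    have := mul_le_mul_of_nonneg_left hratio (norm_nonneg (riemannZeta (1 - w)))
    linarith
  rw [norm_mul, norm_mul, norm_mul, norm_mul, show (1 - w - 1) = -w by ring, norm_neg,
    norm_sub_rev 1 w]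
  have := mul_le_mul_of_nonneg_left hz (by positivity : 0 ≤ ‖w‖ * ‖w - 1‖)
  linarith

/-- The Dirichlet series `∑ Λ(n) n^{-s}`. -/
noncomputable def mangoldtSeries (s : ℂ) : ℂ := LSeries (fun n => (Λ n : ℂ)) s

lemma vonMangoldt_mul_rpow_le (n : ℕ) (hn : 2 ≤ n) :
    Λ n * (n : ℝ) ^ (-(5 / 2) : ℝ) ≤ 1 / (n : ℝ) ^ 2 := by
  have hn0 : (0 : ℝ) < n := by positivity
  have h1 : Λ n ≤ Real.log n := vonMangoldt_le_log
  have h2 : Real.log n ≤ (n : ℝ) ^ (1 / 2 : ℝ) := by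
    have h3 : Real.log ((n : ℝ) ^ (1 / 2 : ℝ)) ≤ (n : ℝ) ^ (1 / 2 : ℝ) / Real.exp 1 := by
      have := Real.add_one_le_exp (Real.log ((n : ℝ) ^ (1 / 2 : ℝ)) - 1)
      rw [Real.exp_sub, Real.exp_log (by positivity)] at this
      linarith
    rw [Real.log_rpow hn0] at h3
    have h4 : (n : ℝ) ^ (1 / 2 : ℝ) / Real.exp 1 ≤ (n : ℝ) ^ (1 / 2 : ℝ) / 2 := by
      apply div_le_div_of_nonneg_left (by positivity) two_pos
      have := Real.add_one_le_exp 1; linarith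
    linarith
  calc _ ≤ (n : ℝ) ^ (1 / 2 : ℝ) * (n : ℝ) ^ (-(5 / 2) : ℝ) := by gcongr; exact h1.trans h2
    _ = _ := by
      rw [← Real.rpow_add hn0, show (1 / 2 : ℝ) + -(5 / 2) = -(2 : ℕ) by norm_num, Real.rpow_neg hn0.le,
        Real.rpow_natCast, one_div]

lemma norm_mangoldt_term_le {s : ℂ} (hs : 5 / 2 ≤ s.re) (n : ℕ) :
    ‖LSeries.term (fun n => (Λ n : ℂ)) s n‖ ≤ if n ≤ 1 then 0 else 1 / (n : ℝ) ^ 2 := by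
  rcases Nat.lt_or_ge 1 n with h | h
  · rw [if_neg (by omega), LSeries.norm_term_eq, if_neg (by omega), Complex.norm_real, Real.norm_eq_abs,
      abs_of_nonneg vonMangoldt_nonneg]
    refine le_trans ?_ (vonMangoldt_mul_rpow_le n h)
    have hn0 : (1 : ℝ) ≤ n := by exact_mod_cast h.le
    rw [div_eq_mul_inv, ← Real.rpow_neg (by linarith)]
    apply mul_le_mul_of_nonneg_left _ vonMangoldt_nonneg
    exact Real.rpow_le_rpow_of_exponent_le hn0 (by linarith)
  · rw [if_pos h]
    interval_cases n <;> simp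

lemma hasSum_inv_sq_tail :
    HasSum (fun n : ℕ => if n ≤ 1 then (0 : ℝ) else 1 / (n : ℝ) ^ 2) (Real.pi ^ 2 / 6 - 1) := by
  have h := (hasSum_zeta_two.sub (hasSum_ite_eq 1 (1 : ℝ)))
  refine h.congr_fun ?_ |> fun h => h
  intro n
  by_cases h1 : n ≤ 1
  · interval_cases n <;> simp
  · rw [if_neg h1, if_neg (by omega)]; simp

lemma pi_sq_sixth_le : Real.pi ^ 2 / 6 - 1 ≤ 0.645 := by
  have h1 := Real.pi_lt_d6
  have h0 := Real.pi_pos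
  nlinarith

lemma norm_mangoldtSeries_le {s : ℂ} (hs : 5 / 2 ≤ s.re) : ‖mangoldtSeries s‖ ≤ 0.645 := by
  refine le_trans ?_ pi_sq_sixth_le
  exact tsum_of_norm_bounded hasSum_inv_sq_tail (norm_mangoldt_term_le hs)

lemma norm_riemannZeta_ge {s : ℂ} (hs : 2 ≤ s.re) : 0.355 ≤ ‖riemannZeta s‖ := by
  have hs1 : 1 < s.re := by linarith
  have hsum := (LSeriesSummable_one_iff.2 hs1)
  have h1 : HasSum (LSeries.term 1 s) (riemannZeta s) := by
    rw [← LSeries_one_eq_riemannZeta hs1]; exact hsum.hasSum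
  have h2 := h1.sub (hasSum_ite_eq 1 (1 : ℂ))
  have h3 : ‖riemannZeta s - 1‖ ≤ 0.645 := by
    rw [← h2.tsum_eq]
    refine le_trans ?_ pi_sq_sixth_le
    refine tsum_of_norm_bounded hasSum_inv_sq_tail fun n => ?_
    rcases Nat.lt_or_ge 1 n with h | h
    · rw [if_neg (by omega), if_neg (by omega), sub_zero, LSeries.norm_term_eq, if_neg (by omega)]
      have hn0 : (1 : ℝ) ≤ n := by exact_mod_cast h.le
      simp only [Pi.one_apply, norm_one]
      apply one_div_le_one_div_of_le (by positivity)
      rw [← Real.rpow_natCast]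
      exact Real.rpow_le_rpow_of_exponent_le hn0 (by simpa using hs)
    · interval_cases n <;> simp [LSeries.term_def]
  have h4 := norm_sub_norm_le (1 : ℂ) (1 - riemannZeta s)
  rw [norm_sub_rev] at h3
  simp only [norm_one, sub_sub_cancel] at h4
  norm_num at h3 h4 ⊢
  linarith

/-- A nonvanishing holomorphic function on a disc is an exponential. -/
lemma exists_exp_eq {f : ℂ → ℂ} {c : ℂ} {r : ℝ} (hr : 0 < r)
    (hf : DifferentiableOn ℂ f (Metric.ball c r)) (h0 : ∀ z ∈ Metric.ball c r, f z ≠ 0) :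
    ∃ g : ℂ → ℂ, DifferentiableOn ℂ g (Metric.ball c r) ∧ g c = 0 ∧
      ∀ z ∈ Metric.ball c r, f z = f c * Complex.exp (g z) := by
  have hd : DifferentiableOn ℂ (fun z => deriv f z / f z) (Metric.ball c r) :=
    (hf.deriv Metric.isOpen_ball).div hf h0
  obtain ⟨g, hg0, hg⟩ := hd.isExactOn_ball.with_val_at c 0
  have hc : c ∈ Metric.ball c r := Metric.mem_ball_self hr
  refine ⟨g, fun z hz => (hg z hz).differentiableAt.differentiableWithinAt, hg0, fun z hz => ?_⟩
  have hconst : ∀ z ∈ Metric.ball c r, HasDerivAt (fun z => f z * Complex.exp (-g z)) 0 z := by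
    intro z hz
    have h1 : HasDerivAt f (deriv f z) z := (hf.differentiableAt (Metric.isOpen_ball.mem_nhds hz)).hasDerivAt
    have h2 := h1.mul (hg z hz).neg.cexp
    refine h2.congr_deriv ?_
    have := h0 z hz
    field_simp
    ring
  have h3 := (convex_ball c r).is_const_of_fderivWithin_eq_zero (𝕜 := ℂ) (f := fun z => f z * Complex.exp (-g z))
    (fun z hz => (hconst z hz).differentiableAt.differentiableWithinAt) (fun z hz => by
      rw [fderivWithin_of_isOpen Metric.isOpen_ball hz]
      have := (hconst z hz).hasFDerivAt.fderiv
      rw [this]; ext; simp) hz hc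
  simp only [hg0, neg_zero, Complex.exp_zero, mul_one] at h3
  rw [← h3, mul_assoc, ← Complex.exp_add]; simp

lemma norm_xiCore_ge {w : ℂ} (hw : 4 ≤ w.re) : 1 ≤ ‖xiCore w‖ := by
  have h1 : w ≠ 1 := by rintro rfl; norm_num at hw
  rw [xiCore_eq h1, norm_mul, norm_mul]
  have h2 : 4 ≤ ‖w‖ := hw.trans (Complex.re_le_norm w)
  have h3 : 3 ≤ ‖w - 1‖ := by
    refine le_trans ?_ (Complex.re_le_norm _); simp; linarith
  have h4 := norm_riemannZeta_ge (s := w) (by linarith)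
  calc (1 : ℝ) ≤ 4 * 3 * 0.355 := by norm_num
    _ ≤ _ := by gcongr

lemma exists_inv_xiCore_le (hRH : RiemannHypothesis) {h : ℝ} (h0 : 0 < h) (h1 : h < 1 / 2) :
    ∃ k : ℝ, ∀ w : ℂ, 1 / 2 + h ≤ w.re → w.re ≤ 7 / 2 + h →
      1 / ‖xiCore w‖ ≤ Real.exp (k * Real.log (13 + |w.im|)) := by
  refine ⟨7 / h * 5, fun w hw1 hw2 => ?_⟩
  set c : ℂ := 4 + w.im * Complex.I with hc
  have hcre : c.re = 4 := by simp [hc]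
  have hcim : c.im = w.im := by simp [hc]
  have hcn : ‖c‖ ≤ 4 + |w.im| := by
    refine (Complex.norm_le_abs_re_add_abs_im c).trans ?_
    rw [hcre, hcim]; norm_num
  have hre : ∀ z ∈ Metric.ball (0 : ℂ) (7 / 2), 1 / 2 < (c + z).re := by
    intro z hz
    have := (abs_le.1 (Complex.abs_re_le_norm z)).1
    have hz' : ‖z‖ < 7 / 2 := by simpa using hz
    rw [Complex.add_re, hcre]; linarith
  obtain ⟨g, hg, hg0, hge⟩ := exists_exp_eq (f := fun z => xiCore (c + z)) (c := 0) (r := 7 / 2) (by norm_num)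
    ((differentiable_xiCore.comp (differentiable_id.const_add c)).differentiableOn)
    (fun z hz => xiCore_ne_zero hRH (hre z hz))
  simp only [add_zero] at hge
  have hXc : 1 ≤ ‖xiCore c‖ := norm_xiCore_ge hcre.ge
  set T : ℝ := 13 + |w.im| with hT
  have hT13 : 13 ≤ T := by have := abs_nonneg w.im; linarith
  have hlT : 0 < Real.log T := Real.log_pos (by linarith)
  have hmaps : MapsTo g (Metric.ball 0 (7 / 2)) {z | z.re ≤ 5 * Real.log T} := by
    intro z hz
    have hz' : ‖z‖ < 7 / 2 := by simpa using hz
    have e := congrArg norm (hge z hz)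
    rw [norm_mul, Complex.norm_exp] at e
    have e2 := norm_xiCore_le (s := c + z) (by have := hre z hz; linarith)
    have e3 : 5 * (1 + ‖c + z‖) ^ 3 ≤ T ^ 5 := by
      have : 1 + ‖c + z‖ ≤ T := by
        have := norm_add_le c z; rw [hT]; linarith
      calc _ ≤ 5 * T ^ 3 := by gcongr
        _ ≤ T ^ 2 * T ^ 3 := by gcongr; nlinarith
        _ = _ := by ring
    have e4 : Real.exp (g z).re ≤ T ^ 5 := by
      refine le_trans ?_ (e2.trans e3)
      rw [e]; exact le_mul_of_one_le_left (Real.exp_pos _).le hXc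
    have := Real.log_le_log (Real.exp_pos _) e4
    rw [Real.log_exp, Real.log_pow] at this
    simpa using this
  set z : ℂ := w - c with hz
  have hzz : z = ((w.re - 4 : ℝ) : ℂ) := by
    apply Complex.ext
    · simp [hz, hcre]
    · simp [hz, hcim]
  have hzn : ‖z‖ ≤ 7 / 2 - h := by
    rw [hzz, Complex.norm_real, Real.norm_eq_abs, abs_le]; constructor <;> linarith
  have hzb : z ∈ Metric.ball (0 : ℂ) (7 / 2) := by simp; linarith
  have hb := Complex.borelCaratheodory_zero (by positivity) hg hmaps (by norm_num) hzb hg0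
  have hb2 : ‖g z‖ ≤ 7 / h * 5 * Real.log T := by
    refine hb.trans ?_
    rw [div_le_iff₀ (by linarith)]
    have : (7 / h * 5 * Real.log T) * h ≤ (7 / h * 5 * Real.log T) * (7 / 2 - ‖z‖) := by
      apply mul_le_mul_of_nonneg_left (by linarith) (by positivity)
    refine le_trans ?_ this
    have e : (7 / h * 5 * Real.log T) * h = 2 * (5 * Real.log T) * (7 / 2) := by field_simp
    rw [e]
    apply mul_le_mul_of_nonneg_left _ (by positivity)
    linarith
  have hw' : xiCore w = xiCore c * Complex.exp (g z) := by
    rw [← hge z hzb, hz]; congr 1; ring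
  rw [hw', norm_mul, Complex.norm_exp]
  have h5 : -(7 / h * 5 * Real.log T) ≤ (g z).re := by
    have := (abs_le.1 (Complex.abs_re_le_norm (g z))).1; linarith
  rw [div_le_iff₀ (by positivity)]
  calc (1 : ℝ) = Real.exp (7 / h * 5 * Real.log T) * (1 * Real.exp (-(7 / h * 5 * Real.log T))) := by
        rw [one_mul, ← Real.exp_add]; simp
    _ ≤ _ := by gcongr

lemma logDeriv_xiCore {w : ℂ} (hw : 1 < w.re) :
    logDeriv xiCore w = 1 / w + 1 / (w - 1) - mangoldtSeries w := by
  have h1 : w ≠ 1 := by rintro rfl; simp at hw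
  have h0 : w ≠ 0 := by rintro rfl; simp at hw; linarith
  have h2 : w - 1 ≠ 0 := sub_ne_zero.2 h1
  have hz : riemannZeta w ≠ 0 := riemannZeta_ne_zero_of_one_le_re hw.le
  have he : xiCore =ᶠ[𝓝 w] fun z => z * (z - 1) * riemannZeta z := by
    filter_upwards [isOpen_ne.mem_nhds h1] with z hz
    exact xiCore_eq hz
  have hd := differentiableAt_riemannZeta h1
  rw [logDeriv_apply, he.deriv_eq, he.eq_of_nhds, ← logDeriv_apply (fun z => z * (z - 1) * riemannZeta z),
    logDeriv_mul (f := fun z => z * (z - 1)) w (mul_ne_zero h0 h2) hz (by fun_prop) hd,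
    logDeriv_mul (f := fun z => z) (g := fun z => z - 1) w h0 h2 (by fun_prop) (by fun_prop)]
  have e := LSeries_vonMangoldt_eq_deriv_riemannZeta_div hw
  have e1 : logDeriv (fun z : ℂ => z) w = 1 / w := by simp [logDeriv_apply]
  have e2 : logDeriv (fun z : ℂ => z - 1) w = 1 / (w - 1) := by simp [logDeriv_apply]
  rw [e1, e2, mangoldtSeries, e, logDeriv_apply]
  ring

lemma hasDerivAt_log_norm_xiCore {w : ℂ} {r : ℝ} (hw : xiCore (w + r) ≠ 0) :
    HasDerivAt (fun r : ℝ => Real.log ‖xiCore (w + r)‖) (logDeriv xiCore (w + r)).re r := by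
  set X0 := xiCore (w + r) with hX0
  have h1 : HasDerivAt (fun r : ℝ => xiCore (w + r)) (deriv xiCore (w + r)) r := by
    have h := (differentiable_xiCore (w + r)).hasDerivAt
    have h2 : HasDerivAt (fun r : ℝ => w + (r : ℂ)) 1 r := by
      simpa using (hasDerivAt_id r).ofReal_comp.const_add w
    have h3 := HasDerivAt.comp r h h2
    rw [mul_one] at h3
    exact h3
  have h2 : HasDerivAt (fun r : ℝ => xiCore (w + r) / X0) (deriv xiCore (w + r) / X0) r := h1.div_const X0
  have h3 := h2.clog_real (by rw [← hX0, div_self hw]; exact Complex.one_mem_slitPlane)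
  rw [← hX0, div_self hw, div_one] at h3
  have h4 : HasDerivAt (fun r : ℝ => (Complex.log (xiCore (w + r) / X0)).re)
      (deriv xiCore (w + r) / X0).re r := by
    exact (Complex.reCLM.hasFDerivAt.comp_hasDerivAt r h3)
  have h5 := h4.add_const (Real.log ‖X0‖)
  rw [logDeriv_apply]
  refine h5.congr_of_eventuallyEq ?_
  have : ∀ᶠ r' : ℝ in 𝓝 r, xiCore (w + r') ≠ 0 := h1.continuousAt.eventually_ne hw
  filter_upwards [this] with r' hr'
  rw [Complex.log_re, norm_div, Real.log_div (norm_ne_zero_iff.2 hr') (norm_ne_zero_iff.2 hw)]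
  ring

lemma logDeriv_xiCore_re_ge {w : ℂ} (hw : 5 / 2 ≤ w.re) : -0.645 ≤ (logDeriv xiCore w).re := by
  rw [logDeriv_xiCore (by linarith)]
  have h1 : 0 ≤ (1 / w).re := by
    rw [one_div, Complex.inv_re]; exact div_nonneg (by linarith) (Complex.normSq_nonneg _)
  have h2 : 0 ≤ (1 / (w - 1)).re := by
    rw [one_div, Complex.inv_re]
    exact div_nonneg (by simp; linarith) (Complex.normSq_nonneg _)
  have h3 := (abs_le.1 ((Complex.abs_re_le_norm _).trans (norm_mangoldtSeries_le hw))).2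
  simp only [Complex.sub_re, Complex.add_re]
  linarith

lemma exp_le_seven : Real.exp 1.29 ≤ 7 := by
  have h1 := Real.exp_one_lt_d9
  have h2 := Real.add_one_le_exp (-0.29 : ℝ)
  have h3 : Real.exp 1.29 * Real.exp (-0.29) = Real.exp 1 := by
    rw [← Real.exp_add]; norm_num
  nlinarith [Real.exp_pos 1.29]

lemma norm_xiCore_sub_le_of_re_eq (hRH : RiemannHypothesis) {h : ℝ} (h0 : 0 < h) (h1 : h < 1 / 4)
    {s : ℂ} (hs : s.re = 3) :
    ‖xiCore (1 / 2 + s - h)‖ ≤ ‖4 + s‖ ^ h * ‖xiCore (1 / 2 + s + h)‖ := by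
  have hre : ∀ r ∈ Icc (-h) h, 5 / 2 ≤ (1 / 2 + s + (r : ℂ)).re := by
    intro r hr
    simp [hs]; linarith [hr.1]
  have hne : ∀ r ∈ Icc (-h) h, xiCore (1 / 2 + s + (r : ℂ)) ≠ 0 := fun r hr =>
    xiCore_ne_zero hRH (by linarith [hre r hr])
  have hd : ∀ r ∈ Icc (-h) h, HasDerivAt (fun r : ℝ => Real.log ‖xiCore (1 / 2 + s + r)‖)
      (logDeriv xiCore (1 / 2 + s + r)).re r := fun r hr => hasDerivAt_log_norm_xiCore (hne r hr)
  have key := (convex_Icc (-h) h).mul_sub_le_image_sub_of_le_deriv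
    (f := fun r : ℝ => Real.log ‖xiCore (1 / 2 + s + r)‖) (C := -0.645)
    (fun r hr => (hd r hr).continuousAt.continuousWithinAt)
    (fun r hr => (hd r (interior_subset hr)).differentiableAt.differentiableWithinAt)
    (fun r hr => by
      rw [(hd r (interior_subset hr)).deriv]
      exact logDeriv_xiCore_re_ge (hre r (interior_subset hr)))
    (-h) ⟨le_rfl, by linarith⟩ h ⟨by linarith, le_rfl⟩ (by linarith)
  have hn1 := hne h ⟨by linarith, le_rfl⟩
  have hn2 := hne (-h) ⟨le_rfl, by linarith⟩
  simp only [Complex.ofReal_neg, ← sub_eq_add_neg] at key hn2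
  have h7 : 7 ≤ ‖4 + s‖ := by
    refine le_trans ?_ (Complex.re_le_norm _); simp [hs]; norm_num
  have hl : 1.29 ≤ Real.log ‖4 + s‖ := by
    rw [Real.le_log_iff_exp_le (by linarith)]; exact exp_le_seven.trans h7
  have : Real.log ‖xiCore (1 / 2 + s - h)‖ ≤ Real.log (‖4 + s‖ ^ h * ‖xiCore (1 / 2 + s + h)‖) := by
    rw [Real.log_mul (by positivity) (norm_ne_zero_iff.2 hn1), Real.log_rpow (by linarith)]
    nlinarith
  exact (Real.log_le_log_iff (norm_pos_iff.2 hn2)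
    (mul_pos (by positivity) (norm_pos_iff.2 hn1))).1 this

lemma norm_xiCore_sub_le (hRH : RiemannHypothesis) {h : ℝ} (h0 : 0 < h) (h1 : h < 1 / 4)
    {s : ℂ} (hs0 : 0 ≤ s.re) (hs3 : s.re ≤ 3) :
    ‖xiCore (1 / 2 + s - h)‖ ≤ ‖4 + s‖ ^ h * ‖xiCore (1 / 2 + s + h)‖ := by
  set Q : ℂ → ℂ := fun s => xiCore (1 / 2 + s - h) / (xiCore (1 / 2 + s + h) * (4 + s) ^ (h : ℂ)) with hQ
  have hcl : closure (Complex.re ⁻¹' Ioo (0 : ℝ) 3) ⊆ {z | 0 ≤ z.re ∧ z.re ≤ 3} := by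
    apply closure_minimal
    · intro z hz; exact ⟨hz.1.le, hz.2.le⟩
    · exact (isClosed_le continuous_const Complex.continuous_re).inter
        (isClosed_le Complex.continuous_re continuous_const)
  have hne : ∀ z : ℂ, 0 ≤ z.re → xiCore (1 / 2 + z + h) ≠ 0 := fun z hz =>
    xiCore_ne_zero hRH (by simp; linarith)
  have hslit : ∀ z : ℂ, 0 ≤ z.re → (4 + z) ∈ Complex.slitPlane := fun z hz => by
    left; simp; linarith
  have h4ne : ∀ z : ℂ, 0 ≤ z.re → (4 + z) ≠ 0 := fun z hz => Complex.slitPlane_ne_zero (hslit z hz)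
  have hnormc : ∀ z : ℂ, 0 ≤ z.re → ‖(4 + z) ^ (h : ℂ)‖ = ‖4 + z‖ ^ h := fun z hz =>
    Complex.norm_cpow_real _ _
  have hQn : ∀ z : ℂ, 0 ≤ z.re →
      ‖Q z‖ = ‖xiCore (1 / 2 + z - h)‖ / (‖4 + z‖ ^ h * ‖xiCore (1 / 2 + z + h)‖) := fun z hz => by
    rw [hQ]; simp only [norm_div, norm_mul]; rw [hnormc z hz, mul_comm]
  have hdenpos : ∀ z : ℂ, 0 ≤ z.re → 0 < ‖4 + z‖ ^ h * ‖xiCore (1 / 2 + z + h)‖ := fun z hz =>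
    mul_pos (Real.rpow_pos_of_pos (norm_pos_iff.2 (h4ne z hz)) _) (norm_pos_iff.2 (hne z hz))
  have hX : Differentiable ℂ xiCore := differentiable_xiCore
  have hdiff : DiffContOnCl ℂ Q (Complex.re ⁻¹' Ioo 0 3) := by
    have hd : ∀ z : ℂ, 0 ≤ z.re → DifferentiableAt ℂ Q z := fun z hz => by
      refine DifferentiableAt.div (by fun_prop) (DifferentiableAt.mul (by fun_prop) ?_)
        (mul_ne_zero (hne z hz) ?_)
      · exact (differentiableAt_id.const_add 4).cpow_const (hslit z hz)
      · rw [← norm_ne_zero_iff, hnormc z hz]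
        exact (Real.rpow_pos_of_pos (norm_pos_iff.2 (h4ne z hz)) _).ne'
    exact ⟨fun z hz => (hd z hz.1.le).differentiableWithinAt,
      fun z hz => (hd z (hcl hz).1).continuousAt.continuousWithinAt⟩
  obtain ⟨k, hk⟩ := exists_inv_xiCore_le hRH h0 (by linarith)
  have hgrow : ∃ c < Real.pi / (3 - 0), ∃ B, Q =O[comap (abs ∘ Complex.im) atTop ⊓
      𝓟 (Complex.re ⁻¹' Ioo 0 3)] fun z => Real.exp (B * Real.exp (c * |z.im|)) := by
    refine ⟨1, by have := Real.pi_gt_three; linarith, (4 + |k|) * 3, ?_⟩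
    refine Asymptotics.IsBigO.of_bound 1 ?_
    rw [eventually_inf_principal]
    refine Eventually.of_forall fun z hz => ?_
    have hz0 : 0 ≤ z.re := hz.1.le
    have hz3 : z.re ≤ 3 := hz.2.le
    rw [hQn z hz0, one_mul, Real.norm_eq_abs, abs_of_pos (Real.exp_pos _), one_mul]
    set T := 13 + |z.im| with hT
    have hT13 : 13 ≤ T := by have := abs_nonneg z.im; linarith
    have e1 : 1 / ‖xiCore (1 / 2 + z + h)‖ ≤ Real.exp (k * Real.log T) := by
      have := hk (1 / 2 + z + h) (by simp; linarith) (by simp; linarith)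
      simpa using this
    have e2 : ‖xiCore (1 / 2 + z - h)‖ ≤ T ^ 4 := by
      refine (norm_xiCore_le (by simp; linarith)).trans ?_
      have : 1 + ‖1 / 2 + z - h‖ ≤ T := by
        have h3 := Complex.norm_le_abs_re_add_abs_im (1 / 2 + z - h)
        have h4 : |(1 / 2 + z - h : ℂ).re| ≤ 4 := by
          rw [abs_le]; constructor <;> simp <;> linarith
        have h5 : (1 / 2 + z - h : ℂ).im = z.im := by simp
        rw [h5] at h3; linarith
      calc _ ≤ T * T ^ 3 := by gcongr; linarith
        _ = _ := by ring
    have e3 : 1 ≤ ‖4 + z‖ ^ h := by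
      apply Real.one_le_rpow _ h0.le
      refine le_trans ?_ (Complex.re_le_norm _); simp; linarith
    have hTl0 : 0 ≤ Real.log T := Real.log_nonneg (by linarith)
    have hTe : Real.log T ≤ Real.exp |z.im| * 3 := by
      have a2 := Real.add_one_le_exp |z.im|
      have : Real.log T ≤ |z.im| + 3 := by
        rw [Real.log_le_iff_le_exp (by linarith), Real.exp_add]
        have : 13 ≤ Real.exp 3 := by
          have := Real.exp_one_gt_d9
          have h6 : Real.exp 3 = Real.exp 1 ^ 3 := by rw [← Real.exp_nat_mul]; norm_num
          rw [h6]
          calc (13 : ℝ) ≤ 2.7 ^ 3 := by norm_num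
            _ ≤ _ := by gcongr; linarith
        have := Real.add_one_le_exp |z.im|
        nlinarith [abs_nonneg z.im]
      have := abs_nonneg z.im
      nlinarith
    calc _ ≤ T ^ 4 / (1 * ‖xiCore (1 / 2 + z + h)‖) := by
          have := norm_pos_iff.2 (hne z hz0)
          gcongr
      _ = T ^ 4 * (1 / ‖xiCore (1 / 2 + z + h)‖) := by ring
      _ ≤ Real.exp (4 * Real.log T) * Real.exp (k * Real.log T) := by
          gcongr
          rw [show (4 : ℝ) = (4 : ℕ) by norm_num, Real.exp_nat_mul, Real.exp_log (by linarith)]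
      _ = Real.exp ((4 + k) * Real.log T) := by rw [← Real.exp_add]; ring_nf
      _ ≤ _ := by
          apply Real.exp_le_exp.2
          calc (4 + k) * Real.log T ≤ (4 + |k|) * (Real.exp |z.im| * 3) := by
                gcongr; exact le_abs_self k
            _ = _ := by ring
  have hb0 : ∀ z : ℂ, z.re = 0 → ‖Q z‖ ≤ 1 := fun z hz => by
    rw [hQn z hz.ge, div_le_one (hdenpos z hz.ge)]
    have := norm_xiCore_half_sub_le z.im h0 (by linarith)
    have hzI : z = z.im * Complex.I := by apply Complex.ext <;> simp [hz]
    have a1 : 1 / 2 + z - h = ((1 / 2 - h : ℝ) : ℂ) + z.im * Complex.I := by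
      nth_rw 1 [hzI]; push_cast; ring
    have a2 : 1 / 2 + z + h = ((1 / 2 + h : ℝ) : ℂ) + z.im * Complex.I := by
      nth_rw 1 [hzI]; push_cast; ring
    rw [a1, a2]
    nth_rw 2 [hzI]
    exact this
  have hb3 : ∀ z : ℂ, z.re = 3 → ‖Q z‖ ≤ 1 := fun z hz => by
    have hz0 : 0 ≤ z.re := by rw [hz]; norm_num
    rw [hQn z hz0, div_le_one (hdenpos z hz0)]
    exact norm_xiCore_sub_le_of_re_eq hRH h0 h1 hz
  have := PhragmenLindelof.vertical_strip hdiff hgrow hb0 hb3 hs0 hs3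
  rwa [hQn s hs0, div_le_one (hdenpos s hs0)] at this

lemma logDeriv_xiCore_re_add_log_nonneg (hRH : RiemannHypothesis) {s : ℂ} (hs : 0 < s.re) :
    0 ≤ (logDeriv xiCore (1 / 2 + s)).re + Real.log ‖4 + s‖ / 2 := by
  have hnorm : 4 ≤ ‖4 + s‖ := by refine le_trans ?_ (Complex.re_le_norm _); simp; linarith
  rcases le_or_gt s.re 3 with h3 | h3
  · have hd : HasDerivAt (fun r : ℝ => Real.log ‖xiCore (1 / 2 + s + r)‖)
        (logDeriv xiCore (1 / 2 + s)).re 0 := by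
      have := hasDerivAt_log_norm_xiCore (w := 1 / 2 + s) (r := 0)
        (by simpa using xiCore_ne_zero hRH (w := 1 / 2 + s) (by simpa using hs))
      simpa using this
    have hd2 : HasDerivAt (fun r : ℝ => Real.log ‖xiCore (1 / 2 + s + r)‖ + Real.log ‖4 + s‖ * r -
        Real.log ‖xiCore (1 / 2 + s + ((-r : ℝ) : ℂ))‖)
        ((logDeriv xiCore (1 / 2 + s)).re + Real.log ‖4 + s‖ + (logDeriv xiCore (1 / 2 + s)).re) 0 := by
      have hneg : HasDerivAt (fun r : ℝ => -r) (-1) 0 := (hasDerivAt_id (0 : ℝ)).neg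
      have hd' : HasDerivAt (fun r : ℝ => Real.log ‖xiCore (1 / 2 + s + r)‖)
        (logDeriv xiCore (1 / 2 + s)).re (-0) := by simpa using hd
      have h1 := HasDerivAt.comp (0 : ℝ) hd' hneg
      have h2 := (hd.add ((hasDerivAt_id (0 : ℝ)).const_mul (Real.log ‖4 + s‖))).sub h1
      refine h2.congr_deriv ?_
      ring
    have hnn : ∀ᶠ r : ℝ in 𝓝[>] 0, 0 ≤ slope (fun r : ℝ => Real.log ‖xiCore (1 / 2 + s + r)‖ +
        Real.log ‖4 + s‖ * r - Real.log ‖xiCore (1 / 2 + s + ((-r : ℝ) : ℂ))‖) 0 r := by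
      filter_upwards [Ioo_mem_nhdsGT (show (0 : ℝ) < min (1 / 4) s.re by positivity)] with r hr
      have hr0 : 0 < r := hr.1
      have hr1 : r < 1 / 4 := hr.2.trans_le (min_le_left _ _)
      have hr2 : r < s.re := hr.2.trans_le (min_le_right _ _)
      have hx := norm_xiCore_sub_le hRH hr0 hr1 hs.le h3
      have hn1 : 0 < ‖xiCore (1 / 2 + s - r)‖ := norm_pos_iff.2 (xiCore_ne_zero hRH (by simp; linarith))
      have hn2 : 0 < ‖xiCore (1 / 2 + s + r)‖ := norm_pos_iff.2 (xiCore_ne_zero hRH (by simp; linarith))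
      have hl := Real.log_le_log hn1 hx
      rw [Real.log_mul (by positivity) hn2.ne', Real.log_rpow (by linarith)] at hl
      rw [slope_def_field]
      simp only [Complex.ofReal_neg, ← sub_eq_add_neg, Complex.ofReal_zero, neg_zero, sub_zero]
      apply div_nonneg _ hr0.le
      simp only [mul_zero, add_zero, sub_self, sub_zero]
      linarith
    have hlim := hd2.hasDerivWithinAt (s := Ioi 0)
    rw [hasDerivWithinAt_iff_tendsto_slope' (by simp)] at hlim
    have := ge_of_tendsto hlim hnn
    linarith
  · have h1 := logDeriv_xiCore_re_ge (w := 1 / 2 + s) (by simp; linarith)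
    have h7 : 7 ≤ ‖4 + s‖ := by
      refine le_trans ?_ (Complex.re_le_norm _); simp; linarith
    have hl : 1.29 ≤ Real.log ‖4 + s‖ := by
      rw [Real.le_log_iff_exp_le (by linarith)]; exact exp_le_seven.trans h7
    linarith

/-- The logarithmic derivative of `ξ (1/2 + s)`, with a logarithm in place of the Gamma contribution. It has
nonnegative real part for `Re s > 0` under the Riemann hypothesis. -/
noncomputable def hpFun (s : ℂ) : ℂ := logDeriv xiCore (1 / 2 + s) + Complex.log (4 + s) / 2

lemma hpFun_re_nonneg (hRH : RiemannHypothesis) {s : ℂ} (hs : 0 < s.re) : 0 ≤ (hpFun s).re := by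
  have := logDeriv_xiCore_re_add_log_nonneg hRH hs
  rw [hpFun, Complex.add_re, show (Complex.log (4 + s) / 2).re = Real.log ‖4 + s‖ / 2 by
    rw [← Complex.log_re]; simp]
  exact this

lemma differentiableAt_hpFun (hRH : RiemannHypothesis) {s : ℂ} (hs : 0 < s.re) :
    DifferentiableAt ℂ hpFun s := by
  unfold hpFun
  have hX : xiCore (1 / 2 + s) ≠ 0 := xiCore_ne_zero hRH (by simpa using hs)
  have h1 : DifferentiableAt ℂ (logDeriv xiCore) (1 / 2 + s) := by
    unfold logDeriv
    exact (differentiable_xiCore.analyticAt _).deriv.differentiableAt.div (differentiable_xiCore _) hX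
  have h2 : DifferentiableAt ℂ (fun s : ℂ => Complex.log (4 + s)) s :=
    (differentiableAt_id.const_add 4).clog (by left; simp; linarith)
  exact (h1.comp (f := fun s : ℂ => 1 / 2 + s) s (differentiableAt_id.const_add _)).add (h2.div_const 2)

lemma hpFun_conj {s : ℂ} (hs : 0 < s.re) : hpFun (starRingEnd ℂ s) = starRingEnd ℂ (hpFun s) := by
  have hd : ∀ w, deriv xiCore (starRingEnd ℂ w) = starRingEnd ℂ (deriv xiCore w) := by
    intro w
    have : xiCore = starRingEnd ℂ ∘ xiCore ∘ starRingEnd ℂ := by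
      ext w; simp [xiCore_conj]
    conv_lhs => rw [this]
    simp [deriv_conj_conj]
  unfold hpFun
  have e1 : 1 / 2 + starRingEnd ℂ s = starRingEnd ℂ (1 / 2 + s) := by
    apply Complex.ext <;> simp
  have e2 : 4 + starRingEnd ℂ s = starRingEnd ℂ (4 + s) := by
    apply Complex.ext <;> simp
  rw [e1, e2, Complex.log_conj, logDeriv_apply, hd, xiCore_conj, logDeriv_apply]
  · apply Complex.ext
    · simp [← map_div₀, Complex.div_re]
    · simp [← map_div₀, Complex.div_im, neg_div]
  · have h4 : 0 < (4 + s).re := by simp; linarith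
    intro h
    rw [Complex.arg_eq_pi_iff] at h
    linarith [h.1]

lemma hpFun_eq {s : ℂ} (hs : 1 / 2 < s.re) :
    hpFun s = 1 / (s + 1 / 2) + 1 / (s - 1 / 2) - mangoldtSeries (1 / 2 + s) +
      Complex.log (4 + s) / 2 := by
  rw [hpFun, logDeriv_xiCore (by simp; linarith)]
  ring_nf

/-- A function dominated by `(1 + ‖z‖) ^ (-3/2)` on a vertical line is integrable there. -/
lemma integrable_vertical {Φ : ℂ → ℂ} {h b C : ℝ} (hb : h ≤ b)
    (hd : ∀ z : ℂ, h ≤ z.re → DifferentiableAt ℂ Φ z)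
    (hC : ∀ z : ℂ, z.re = b → ‖Φ z‖ ≤ C * (1 + ‖z‖) ^ (-(3 / 2) : ℝ)) :
    Integrable (fun t : ℝ => Φ (b + t * Complex.I)) := by
  have hi : Integrable (fun t : ℝ => C * (1 + ‖t‖) ^ (-(3 / 2) : ℝ)) :=
    (integrable_one_add_norm (by norm_num)).const_mul C
  have hC0 : 0 ≤ C := by
    have := (norm_nonneg _).trans (hC (b : ℂ) (by simp))
    have h2 : (0 : ℝ) < (1 + ‖(b : ℂ)‖) ^ (-(3 / 2) : ℝ) := by positivity
    nlinarith
  refine hi.mono' ?_ (Eventually.of_forall fun t => ?_)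
  · apply Continuous.aestronglyMeasurable
    rw [continuous_iff_continuousAt]
    intro t
    have : ContinuousAt Φ (b + t * Complex.I) := (hd _ (by simp; linarith)).continuousAt
    exact ContinuousAt.comp (f := fun t : ℝ => (b : ℂ) + t * Complex.I) this (by fun_prop)
  · refine (hC _ (by simp)).trans ?_
    gcongr C * ?_
    apply Real.rpow_le_rpow_of_nonpos (by positivity) _ (by norm_num)
    gcongr
    have := Complex.abs_im_le_norm (b + t * Complex.I)
    simpa using this

lemma integral_vertical_eq {Φ : ℂ → ℂ} {h b C : ℝ} (hb : h ≤ b)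
    (hd : ∀ z : ℂ, h ≤ z.re → DifferentiableAt ℂ Φ z)
    (hC : ∀ z : ℂ, h ≤ z.re → z.re ≤ b → ‖Φ z‖ ≤ C * (1 + ‖z‖) ^ (-(3 / 2) : ℝ)) :
    ∫ t : ℝ, Φ (h + t * Complex.I) = ∫ t : ℝ, Φ (b + t * Complex.I) := by
  have hC0 : 0 ≤ C := by
    have := (norm_nonneg _).trans (hC (b : ℂ) (by simp [hb]) (by simp))
    have h2 : (0 : ℝ) < (1 + ‖(b : ℂ)‖) ^ (-(3 / 2) : ℝ) := by positivity
    nlinarith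
  have i1 := integrable_vertical le_rfl hd (fun z hz => hC z hz.ge (hz.le.trans hb))
  have i2 := integrable_vertical hb hd (fun z hz => hC z (hb.trans hz.ge) hz.le)
  have l1 := intervalIntegral_tendsto_integral i1 tendsto_neg_atTop_atBot tendsto_id
  have l2 := intervalIntegral_tendsto_integral i2 tendsto_neg_atTop_atBot tendsto_id
  have hbd : ∀ T : ℝ, ∀ u : ℝ, |u| = T → ‖∫ x in h..b, Φ (x + u * Complex.I)‖ ≤
      C * (1 + T) ^ (-(3 / 2) : ℝ) * |b - h| := by
    intro T u hu
    apply intervalIntegral.norm_integral_le_of_norm_le_const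
    intro x hx
    rw [uIoc_of_le hb] at hx
    refine (hC _ (by simpa using hx.1.le) (by simpa using hx.2)).trans ?_
    gcongr C * ?_
    have : 0 ≤ T := hu ▸ abs_nonneg u
    apply Real.rpow_le_rpow_of_nonpos (by positivity) _ (by norm_num)
    gcongr
    have := Complex.abs_im_le_norm (x + u * Complex.I)
    simpa [hu] using this
  have key : ∀ T : ℝ, 0 ≤ T → ‖(∫ t in (-T)..T, Φ (b + t * Complex.I)) -
      ∫ t in (-T)..T, Φ (h + t * Complex.I)‖ ≤ 2 * (C * (1 + T) ^ (-(3 / 2) : ℝ) * |b - h|) := by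
    intro T hT
    have := Complex.integral_boundary_rect_eq_zero_of_differentiableOn Φ
      (h + (-T : ℝ) * Complex.I) (b + T * Complex.I) (fun z hz => by
        apply (hd z _).differentiableWithinAt
        have h1 := hz.1
        simp only [mem_preimage] at h1
        simp [uIcc_of_le hb] at h1
        linarith [h1.1])
    simp only [Complex.add_re, Complex.add_im, Complex.ofReal_re, Complex.ofReal_im,
      Complex.mul_re, Complex.mul_im, Complex.I_re, Complex.I_im, mul_zero, mul_one, zero_add,
      add_zero, sub_zero, smul_eq_mul] at this
    have e : Complex.I * ((∫ t in (-T)..T, Φ (b + t * Complex.I)) -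
      ∫ t in (-T)..T, Φ (h + t * Complex.I)) = (∫ x in h..b, Φ (x + T * Complex.I)) -
        ∫ x in h..b, Φ (x + (-T : ℝ) * Complex.I) := by
      linear_combination this
    have e2 := congrArg norm e
    rw [norm_mul, Complex.norm_I, one_mul] at e2
    rw [e2]
    refine (norm_sub_le _ _).trans ?_
    have q1 := hbd T T (abs_of_nonneg hT)
    have q2 := hbd T (-T) (by rw [abs_neg, abs_of_nonneg hT])
    linarith
  have hlim : Tendsto (fun T : ℝ => 2 * (C * (1 + T) ^ (-(3 / 2) : ℝ) * |b - h|)) atTop (𝓝 0) := by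
    have h0 : Tendsto (fun T : ℝ => (1 + T) ^ (-(3 / 2) : ℝ)) atTop (𝓝 0) :=
      (tendsto_rpow_neg_atTop (by norm_num)).comp (tendsto_atTop_add_const_left _ _ tendsto_id)
    simpa using ((h0.const_mul C).mul_const |b - h|).const_mul 2
  have hz : Tendsto (fun T : ℝ => (∫ t in (-T)..T, Φ (b + t * Complex.I)) -
      ∫ t in (-T)..T, Φ (h + t * Complex.I)) atTop (𝓝 0) :=
    squeeze_zero_norm' ((eventually_ge_atTop 0).mono key) hlim
  have := tendsto_nhds_unique hz (l2.sub l1)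
  exact (sub_eq_zero.1 this.symm).symm

lemma integral_vertical_eq_zero {Φ : ℂ → ℂ} {h C : ℝ} (hh : 0 < h)
    (hd : ∀ z : ℂ, h ≤ z.re → DifferentiableAt ℂ Φ z)
    (hC : ∀ z : ℂ, h ≤ z.re → ‖Φ z‖ ≤ C * (1 + ‖z‖) ^ (-(3 / 2) : ℝ)) :
    ∫ t : ℝ, Φ (h + t * Complex.I) = 0 := by
  have hC0 : 0 ≤ C := by
    have := (norm_nonneg _).trans (hC (h : ℂ) (by simp))
    have h2 : (0 : ℝ) < (1 + ‖(h : ℂ)‖) ^ (-(3 / 2) : ℝ) := by positivity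
    nlinarith
  set J := ∫ t : ℝ, C * (1 + ‖t‖) ^ (-(5 / 4) : ℝ)
  have hi : Integrable (fun t : ℝ => C * (1 + ‖t‖) ^ (-(5 / 4) : ℝ)) :=
    (integrable_one_add_norm (by norm_num)).const_mul C
  have key : ∀ b : ℝ, h ≤ b → ‖∫ t : ℝ, Φ (h + t * Complex.I)‖ ≤ (1 + b) ^ (-(1 / 4) : ℝ) * J := by
    intro b hb
    have hb0 : 0 < b := hh.trans_le hb
    rw [integral_vertical_eq hb hd (fun z hz _ => hC z hz), ← integral_const_mul]
    apply norm_integral_le_of_norm_le (hi.const_mul _)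
    refine Eventually.of_forall fun t => ?_
    refine (hC _ (by simpa using hb)).trans ?_
    rw [show (-(3 / 2) : ℝ) = -(1 / 4) + -(5 / 4) by norm_num, Real.rpow_add (by positivity)]
    have h1 := Complex.abs_im_le_norm (b + t * Complex.I)
    have h2 := Complex.re_le_norm (b + t * Complex.I)
    simp at h1 h2
    have a1 : (1 + ‖b + t * Complex.I‖) ^ (-(1 / 4) : ℝ) ≤ (1 + b) ^ (-(1 / 4) : ℝ) :=
      Real.rpow_le_rpow_of_nonpos (by positivity) (by linarith) (by norm_num)
    have a2 : (1 + ‖b + t * Complex.I‖) ^ (-(5 / 4) : ℝ) ≤ (1 + ‖t‖) ^ (-(5 / 4) : ℝ) :=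
      Real.rpow_le_rpow_of_nonpos (by positivity) (by simpa using h1) (by norm_num)
    calc _ ≤ C * ((1 + b) ^ (-(1 / 4) : ℝ) * (1 + ‖t‖) ^ (-(5 / 4) : ℝ)) := by gcongr
      _ = _ := by ring
  have hlim : Tendsto (fun T : ℝ => (1 + T) ^ (-(1 / 4) : ℝ) * J) atTop (𝓝 0) := by
    have h0 : Tendsto (fun T : ℝ => (1 + T) ^ (-(1 / 4) : ℝ)) atTop (𝓝 0) :=
      (tendsto_rpow_neg_atTop (by norm_num)).comp (tendsto_atTop_add_const_left _ _ tendsto_id)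
    simpa using h0.mul_const J
  have := ge_of_tendsto hlim ((eventually_ge_atTop h).mono key)
  exact norm_le_zero_iff.1 this

lemma norm_hpFun_le_of_two_le {s : ℂ} (hs : 2 ≤ s.re) : ‖hpFun s‖ ≤ 6 * (1 + ‖s‖) ^ (1 / 2 : ℝ) := by
  rw [hpFun_eq (by linarith)]
  have h1 : ‖1 / (s + 1 / 2)‖ ≤ 1 / 2 := by
    rw [norm_div, norm_one]
    have : 2 ≤ ‖s + 1 / 2‖ := by refine le_trans ?_ (Complex.re_le_norm _); simp; linarith
    gcongr
  have h2 : ‖1 / (s - 1 / 2)‖ ≤ 1 := by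
    rw [norm_div, norm_one, div_le_one]
    all_goals
      have : 1 ≤ ‖s - 1 / 2‖ := by refine le_trans ?_ (Complex.re_le_norm _); simp; linarith
      linarith
  have h3 : ‖mangoldtSeries (1 / 2 + s)‖ ≤ 0.645 := norm_mangoldtSeries_le (by simp; linarith)
  have h4 : ‖Complex.log (4 + s) / 2‖ ≤ 2 * (1 + ‖s‖) ^ (1 / 2 : ℝ) + 1.6 := by
    rw [norm_div, Complex.norm_ofNat]
    have h5 : 0 < ‖4 + s‖ := lt_of_lt_of_le (by simp; linarith) (Complex.re_le_norm _)
    have a1 := Complex.norm_le_abs_re_add_abs_im (Complex.log (4 + s))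
    rw [Complex.log_re, Complex.log_im] at a1
    have a2 := Complex.abs_arg_le_pi (4 + s)
    have a3 : |Real.log ‖4 + s‖| ≤ 4 * (1 + ‖s‖) ^ (1 / 2 : ℝ) := by
      have h6 : 1 ≤ ‖4 + s‖ := by refine le_trans ?_ (Complex.re_le_norm _); simp; linarith
      rw [abs_of_nonneg (Real.log_nonneg h6)]
      have := Real.log_le_rpow_div h5.le (show (0 : ℝ) < 1 / 2 by norm_num)
      have h7 : ‖4 + s‖ ≤ 4 * (1 + ‖s‖) := by
        have := norm_add_le (4 : ℂ) s
        rw [Complex.norm_ofNat] at this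
        linarith [norm_nonneg s]
      have h8 : ‖4 + s‖ ^ (1 / 2 : ℝ) ≤ 2 * (1 + ‖s‖) ^ (1 / 2 : ℝ) := by
        calc _ ≤ (4 * (1 + ‖s‖)) ^ (1 / 2 : ℝ) := by gcongr
          _ = _ := by
            rw [Real.mul_rpow (by norm_num) (by positivity), show (4 : ℝ) = 2 ^ (2 : ℝ) by norm_num,
              ← Real.rpow_mul (by norm_num)]
            norm_num
      linarith
    have := Real.pi_lt_d2
    linarith
  have h5 : 1 ≤ (1 + ‖s‖) ^ (1 / 2 : ℝ) := Real.one_le_rpow (by linarith [norm_nonneg s]) (by norm_num)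
  have n1 := norm_add_le (1 / (s + 1 / 2) + 1 / (s - 1 / 2) - mangoldtSeries (1 / 2 + s)) (Complex.log (4 + s) / 2)
  have n2 := norm_sub_le (1 / (s + 1 / 2) + 1 / (s - 1 / 2)) (mangoldtSeries (1 / 2 + s))
  have n3 := norm_add_le (1 / (s + 1 / 2)) (1 / (s - 1 / 2))
  linarith

/-- Polynomial growth of `hpFun` in closed half planes, via Borel-Caratheodory. -/
lemma norm_hpFun_le (hRH : RiemannHypothesis) {h : ℝ} (hh : 0 < h) :
    ∃ C : ℝ, 0 ≤ C ∧ ∀ z : ℂ, h ≤ z.re → ‖hpFun z‖ ≤ C * (1 + ‖z‖) ^ (1 / 2 : ℝ) := by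
  refine ⟨8 / h + 72 / h + 6, by positivity, fun z hz => ?_⟩
  have hz1 : 1 ≤ (1 + ‖z‖) ^ (1 / 2 : ℝ) := Real.one_le_rpow (by linarith [norm_nonneg z]) (by norm_num)
  rcases le_or_gt 2 z.re with h2 | h2
  · refine (norm_hpFun_le_of_two_le h2).trans ?_
    gcongr
    have : 0 ≤ 8 / h + 72 / h := by positivity
    linarith
  set c : ℂ := 2 + z.im * Complex.I with hc
  have hd : DifferentiableOn ℂ (fun w => -hpFun (c + w)) (Metric.ball 0 2) := by
    intro w hw
    rw [mem_ball_zero_iff] at hw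
    have := (abs_le.1 (Complex.abs_re_le_norm w)).1
    have h0 : 0 < (c + w).re := by simp [hc]; linarith
    exact ((differentiableAt_hpFun hRH h0).comp (f := fun w => c + w) w
      (differentiableAt_id.const_add c)).neg.differentiableWithinAt
  have hm : MapsTo (fun w => -hpFun (c + w)) (Metric.ball 0 2) {z | z.re ≤ 1} := by
    intro w hw
    rw [mem_ball_zero_iff] at hw
    have := (abs_le.1 (Complex.abs_re_le_norm w)).1
    have h0 : 0 < (c + w).re := by simp [hc]; linarith
    have := hpFun_re_nonneg hRH h0
    simp only [mem_ofPred_eq, Complex.neg_re]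
    linarith
  have hzc : z - c = ((z.re - 2 : ℝ) : ℂ) := by apply Complex.ext <;> simp [hc]
  have hn : ‖z - c‖ = 2 - z.re := by
    rw [hzc, Complex.norm_real, Real.norm_eq_abs, abs_of_neg (by linarith)]; ring
  have hmem : z - c ∈ Metric.ball (0 : ℂ) 2 := by rw [mem_ball_zero_iff, hn]; linarith
  have := Complex.borelCaratheodory one_pos hd hm two_pos hmem
  simp only [add_sub_cancel, norm_neg, add_zero] at this
  rw [hn] at this
  have hcn : ‖hpFun c‖ ≤ 18 * (1 + ‖z‖) ^ (1 / 2 : ℝ) := by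
    refine (norm_hpFun_le_of_two_le (by simp [hc])).trans ?_
    have h7 : 1 + ‖c‖ ≤ 4 * (1 + ‖z‖) := by
      have a1 := norm_add_le (2 : ℂ) (z.im * Complex.I)
      have a2 := Complex.abs_im_le_norm z
      simp at a1
      rw [← hc] at a1
      linarith [norm_nonneg z]
    have h8 : (1 + ‖c‖) ^ (1 / 2 : ℝ) ≤ 2 * (1 + ‖z‖) ^ (1 / 2 : ℝ) := by
      calc _ ≤ (4 * (1 + ‖z‖)) ^ (1 / 2 : ℝ) := by gcongr
        _ = _ := by
          rw [Real.mul_rpow (by norm_num) (by positivity), show (4 : ℝ) = 2 ^ (2 : ℝ) by norm_num,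
            ← Real.rpow_mul (by norm_num)]
          norm_num
    linarith
  have hd2 : 2 - (2 - z.re) = z.re := by ring
  rw [hd2] at this
  have t1 : 2 * 1 * (2 - z.re) / z.re ≤ 8 / h := by
    rw [div_le_div_iff₀ (by linarith) hh]; nlinarith
  have t2 : ‖hpFun c‖ * (2 + (2 - z.re)) / z.re ≤ ‖hpFun c‖ * 4 / h := by
    rw [div_le_div_iff₀ (by linarith) hh]
    have := norm_nonneg (hpFun c)
    have : (2 + (2 - z.re)) * h ≤ 4 * z.re := by nlinarith
    calc _ = ‖hpFun c‖ * ((2 + (2 - z.re)) * h) := by ring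
      _ ≤ ‖hpFun c‖ * (4 * z.re) := by gcongr
      _ = _ := by ring
  have t3 : ‖hpFun c‖ * 4 / h ≤ 72 / h * (1 + ‖z‖) ^ (1 / 2 : ℝ) := by
    calc _ ≤ (18 * (1 + ‖z‖) ^ (1 / 2 : ℝ)) * 4 / h := by gcongr
      _ = _ := by ring
  have t4 : 8 / h ≤ 8 / h * (1 + ‖z‖) ^ (1 / 2 : ℝ) := le_mul_of_one_le_right (by positivity) hz1
  nlinarith

lemma mangoldtSeries_ofReal_re_nonneg (b : ℝ) : 0 ≤ (mangoldtSeries b).re := by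
  by_cases hs : LSeriesSummable (fun n => (Λ n : ℂ)) b
  · rw [mangoldtSeries, LSeries, Complex.re_tsum hs]
    apply tsum_nonneg
    intro n
    rcases eq_or_ne n 0 with rfl | hn
    · simp
    · rw [LSeries.term_of_ne_zero hn, ← Complex.ofReal_natCast, ← Complex.ofReal_cpow (by positivity),
        ← Complex.ofReal_div, Complex.ofReal_re]
      have := vonMangoldt_nonneg (n := n)
      positivity
  · rw [mangoldtSeries, LSeries, tsum_eq_zero_of_not_summable hs]; simp

lemma hpFun_ofReal_re_le {b : ℝ} (hb : 1 / 2 < b) :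
    (hpFun b).re ≤ Real.log (4 + b) / 2 + 1 / (b + 1 / 2) + 1 / (b - 1 / 2) := by
  have h1 := mangoldtSeries_ofReal_re_nonneg (1 / 2 + b)
  rw [hpFun_eq (by simpa using hb)]
  have e : (1 / (b + 1 / 2 : ℂ) + 1 / (b - 1 / 2) + Complex.log (4 + b) / 2) =
      ((Real.log (4 + b) / 2 + 1 / (b + 1 / 2) + 1 / (b - 1 / 2) : ℝ) : ℂ) := by
    push_cast
    rw [Complex.ofReal_log (by linarith)]
    push_cast
    ring
  have e2 : (1 / (b + 1 / 2 : ℂ) + 1 / (b - 1 / 2) - mangoldtSeries (1 / 2 + b) + Complex.log (4 + b) / 2) =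
    ((Real.log (4 + b) / 2 + 1 / (b + 1 / 2) + 1 / (b - 1 / 2) : ℝ) : ℂ) -
      mangoldtSeries ((1 / 2 + b : ℝ) : ℂ) := by rw [← e]; push_cast; ring
  rw [e2, Complex.sub_re, Complex.ofReal_re]
  linarith

lemma hpFun_re_le {s : ℂ} (hs : 2 ≤ s.re) :
    (hpFun s).re ≤ Real.log ‖4 + s‖ / 2 + 1.712 := by
  rw [hpFun_eq (by linarith)]
  have h1 : ‖1 / (s + 1 / 2)‖ ≤ 2 / 5 := by
    rw [norm_div, norm_one, show (2 / 5 : ℝ) = 1 / (5 / 2) by norm_num]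
    have : 5 / 2 ≤ ‖s + 1 / 2‖ := by refine le_trans ?_ (Complex.re_le_norm _); simp; linarith
    gcongr
  have h2 : ‖1 / (s - 1 / 2)‖ ≤ 2 / 3 := by
    rw [norm_div, norm_one, show (2 / 3 : ℝ) = 1 / (3 / 2) by norm_num]
    have : 3 / 2 ≤ ‖s - 1 / 2‖ := by refine le_trans ?_ (Complex.re_le_norm _); simp; linarith
    gcongr
  have h3 : ‖mangoldtSeries (1 / 2 + s)‖ ≤ 0.645 := norm_mangoldtSeries_le (by simp; linarith)
  have h4 : (Complex.log (4 + s) / 2).re = Real.log ‖4 + s‖ / 2 := by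
    rw [← Complex.log_re]; simp
  rw [Complex.add_re, h4, Complex.sub_re, Complex.add_re]
  have a1 := (Complex.re_le_norm (1 / (s + 1 / 2))).trans h1
  have a2 := (Complex.re_le_norm (1 / (s - 1 / 2))).trans h2
  have a3 := neg_le_of_abs_le ((Complex.abs_re_le_norm (mangoldtSeries (1 / 2 + s))).trans h3)
  linarith

lemma integrable_poisson_kernel {a : ℝ} (ha : 0 < a) (τ : ℝ) :
    Integrable (fun t : ℝ => a / (a ^ 2 + (t - τ) ^ 2)) ∧
      ∫ t : ℝ, a / (a ^ 2 + (t - τ) ^ 2) = Real.pi := by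
  have e : (fun t : ℝ => a / (a ^ 2 + (t - τ) ^ 2)) =
      fun t : ℝ => a⁻¹ * (1 + ((t - τ) / a) ^ 2)⁻¹ := by
    ext t; field_simp
  have h1 := (integrable_inv_one_add_sq.comp_div ha.ne').comp_sub_right τ
  refine ⟨by rw [e]; exact h1.const_mul _, ?_⟩
  rw [e, integral_const_mul,
    integral_sub_right_eq_self (μ := volume) (fun t : ℝ => (1 + (t / a) ^ 2)⁻¹) τ,
    Measure.integral_comp_div (fun t : ℝ => (1 + t ^ 2)⁻¹) a, integral_univ_inv_one_add_sq,
    abs_of_pos ha]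
  simp [ne_of_gt ha]

/-- A continuous function on a closed half plane that decays at infinity is globally dominated. -/
lemma exists_decay_bound {Φ : ℂ → ℂ} {h C R : ℝ}
    (hd : ContinuousOn Φ {z | h ≤ z.re})
    (hC : ∀ z : ℂ, h ≤ z.re → R ≤ ‖z‖ → ‖Φ z‖ ≤ C * (1 + ‖z‖) ^ (-(3 / 2) : ℝ)) :
    ∃ C', ∀ z : ℂ, h ≤ z.re → ‖Φ z‖ ≤ C' * (1 + ‖z‖) ^ (-(3 / 2) : ℝ) := by
  have hK : IsCompact (Metric.closedBall (0 : ℂ) R ∩ {z : ℂ | h ≤ z.re}) :=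
    (isCompact_closedBall _ _).inter_right (isClosed_le continuous_const Complex.continuous_re)
  have hcont : ContinuousOn (fun z : ℂ => ‖Φ z‖ * (1 + ‖z‖) ^ (3 / 2 : ℝ))
      (Metric.closedBall (0 : ℂ) R ∩ {z : ℂ | h ≤ z.re}) := by
    refine (hd.mono inter_subset_right).norm.mul (Continuous.continuousOn ?_)
    exact (continuous_const.add continuous_norm).rpow_const (fun _ => Or.inr (by norm_num))
  obtain ⟨D, hD⟩ := hK.bddAbove_image hcont
  refine ⟨max C D, fun z hz => ?_⟩
  rcases le_or_gt R ‖z‖ with hR | hR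
  · exact (hC z hz hR).trans (by gcongr; exact le_max_left _ _)
  · have := hD (mem_image_of_mem _ ⟨by simpa using hR.le, hz⟩)
    calc ‖Φ z‖ = ‖Φ z‖ * (1 + ‖z‖) ^ (3 / 2 : ℝ) * (1 + ‖z‖) ^ (-(3 / 2) : ℝ) := by
          rw [mul_assoc, ← Real.rpow_add (by positivity)]; simp
      _ ≤ _ := by gcongr; exact le_trans this (le_max_right _ _)

/-- Poisson formula for `hpFun` on the half plane `Re z ≥ h`. -/
lemma poisson_hpFun (hRH : RiemannHypothesis) {h a : ℝ} (hh : 0 < h) (ha : 0 < a) (τ : ℝ) :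
    Integrable (fun t : ℝ => (hpFun (h + t * Complex.I)).re * (a / (a ^ 2 + (t - τ) ^ 2))) ∧
      ∫ t : ℝ, (hpFun (h + t * Complex.I)).re * (a / (a ^ 2 + (t - τ) ^ 2)) =
        Real.pi * (hpFun ((h + a : ℝ) + τ * Complex.I)).re := by
  set s₁ : ℂ := (h + a : ℝ) + τ * Complex.I with hs1
  set s₂ : ℂ := (h - a : ℝ) + τ * Complex.I with hs2
  set Φ : ℂ → ℂ := fun z => dslope hpFun s₁ z * (a / (z - s₂))
  have hs1re : s₁.re = h + a := by simp [hs1]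
  have hs2re : s₂.re = h - a := by simp [hs2]
  have hdl : ∀ z : ℂ, 0 < z.re → DifferentiableAt ℂ (dslope hpFun s₁) z := fun z hz => by
    have hO : IsOpen {z : ℂ | 0 < z.re} := isOpen_lt continuous_const Complex.continuous_re
    have h1 : DifferentiableOn ℂ hpFun {z : ℂ | 0 < z.re} := fun w hw =>
      (differentiableAt_hpFun hRH hw).differentiableWithinAt
    have h2 := (Complex.differentiableOn_dslope (hO.mem_nhds
      (show 0 < s₁.re by rw [hs1re]; linarith))).2 h1
    exact h2.differentiableAt (hO.mem_nhds hz)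
  have hdΦ : ∀ z : ℂ, h ≤ z.re → DifferentiableAt ℂ Φ z := fun z hz => by
    refine (hdl z (by linarith)).mul ((differentiableAt_const _).div
      (differentiableAt_id.sub_const _) ?_)
    intro h0
    have := congrArg Complex.re h0
    simp [hs2re] at this
    linarith
  obtain ⟨C, hC0, hC⟩ := norm_hpFun_le hRH hh
  have hdecay : ∀ z : ℂ, h ≤ z.re → 1 + 2 * (‖s₁‖ + ‖s₂‖) ≤ ‖z‖ →
      ‖Φ z‖ ≤ ((C + ‖hpFun s₁‖) * 16 * a) * (1 + ‖z‖) ^ (-(3 / 2) : ℝ) := by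
    intro z hz hzn
    have n1 := norm_nonneg s₁
    have n2 := norm_nonneg s₂
    have m1 : (1 + ‖z‖) / 4 ≤ ‖z - s₁‖ := by
      have := norm_sub_norm_le z s₁
      linarith
    have m2 : (1 + ‖z‖) / 4 ≤ ‖z - s₂‖ := by
      have := norm_sub_norm_le z s₂
      linarith
    have hne : z ≠ s₁ := by rintro rfl; linarith
    have hz1 : 1 ≤ (1 + ‖z‖) ^ (1 / 2 : ℝ) := Real.one_le_rpow (by linarith) (by norm_num)
    have hnum : ‖hpFun z - hpFun s₁‖ ≤ (C + ‖hpFun s₁‖) * (1 + ‖z‖) ^ (1 / 2 : ℝ) := by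
      have := norm_sub_le (hpFun z) (hpFun s₁)
      have := hC z hz
      have := norm_nonneg (hpFun s₁)
      nlinarith
    have hpos : 0 < 1 + ‖z‖ := by positivity
    simp only [Φ]
    rw [dslope_of_ne _ hne, slope_def_field, norm_mul, norm_div, norm_div, Complex.norm_real,
      Real.norm_eq_abs, abs_of_pos ha]
    calc _ ≤ (C + ‖hpFun s₁‖) * (1 + ‖z‖) ^ (1 / 2 : ℝ) / ((1 + ‖z‖) / 4) * (a / ((1 + ‖z‖) / 4)) := by
          gcongr
      _ = ((C + ‖hpFun s₁‖) * 16 * a) * ((1 + ‖z‖) ^ (1 / 2 : ℝ) / (1 + ‖z‖) ^ (2 : ℝ)) := by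
          rw [Real.rpow_two]; field_simp; ring
      _ = _ := by rw [← Real.rpow_sub hpos]; norm_num
  obtain ⟨C', hC'⟩ := exists_decay_bound (fun z hz => (hdΦ z hz).continuousAt.continuousWithinAt) hdecay
  have hint := integrable_vertical le_rfl hdΦ (fun z hz => hC' z hz.ge)
  have hzero := integral_vertical_eq_zero hh hdΦ hC'
  obtain ⟨hk1, hk2⟩ := integrable_poisson_kernel ha τ
  have hΦ : ∀ t : ℝ, hpFun (h + t * Complex.I) * ((a / (a ^ 2 + (t - τ) ^ 2) : ℝ) : ℂ) =
      -Φ (h + t * Complex.I) + hpFun s₁ * ((a / (a ^ 2 + (t - τ) ^ 2) : ℝ) : ℂ) := by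
    intro t
    have hne : (h + t * Complex.I : ℂ) ≠ s₁ := by
      intro h0
      have := congrArg Complex.re h0
      simp [hs1re] at this
      linarith
    have e1 : (h + t * Complex.I : ℂ) - s₁ = -a + (t - τ) * Complex.I := by
      rw [hs1]; push_cast; ring
    have e2 : (h + t * Complex.I : ℂ) - s₂ = a + (t - τ) * Complex.I := by
      rw [hs2]; push_cast; ring
    have e3 : (-a + (t - τ) * Complex.I : ℂ) * (a + (t - τ) * Complex.I) =
        -((a ^ 2 + (t - τ) ^ 2 : ℝ) : ℂ) := by
      push_cast
      linear_combination ((t : ℂ) - τ) ^ 2 * Complex.I_sq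
    have e4 : ((a ^ 2 + (t - τ) ^ 2 : ℝ) : ℂ) ≠ 0 := by
      exact_mod_cast (show a ^ 2 + (t - τ) ^ 2 ≠ 0 by positivity)
    have e5 : (-a + (t - τ) * Complex.I : ℂ) ≠ 0 := by
      intro h0; rw [h0, zero_mul] at e3; exact e4 (by linear_combination e3)
    have e6 : (a + (t - τ) * Complex.I : ℂ) ≠ 0 := by
      intro h0; rw [h0, mul_zero] at e3; exact e4 (by linear_combination e3)
    simp only [Φ]
    rw [dslope_of_ne _ hne, slope_def_field, e1, e2, div_mul_div_comm, e3, Complex.ofReal_div]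
    field_simp
    ring
  have hk1c : Integrable (fun t : ℝ => hpFun s₁ * ((a / (a ^ 2 + (t - τ) ^ 2) : ℝ) : ℂ)) :=
    hk1.ofReal.const_mul _
  have hi2 : Integrable (fun t : ℝ => hpFun (h + t * Complex.I) *
      ((a / (a ^ 2 + (t - τ) ^ 2) : ℝ) : ℂ)) := by
    simp_rw [hΦ]
    exact hint.neg.add hk1c
  have hv : ∫ t : ℝ, hpFun (h + t * Complex.I) * ((a / (a ^ 2 + (t - τ) ^ 2) : ℝ) : ℂ) =
      hpFun s₁ * (Real.pi : ℂ) := by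
    simp_rw [hΦ]
    rw [integral_add (f := fun t : ℝ => -Φ (h + t * Complex.I)) hint.neg hk1c, integral_neg, hzero, neg_zero, zero_add,
      integral_const_mul, integral_complex_ofReal, hk2]
  have hre : ∀ t : ℝ, (hpFun (h + t * Complex.I)).re * (a / (a ^ 2 + (t - τ) ^ 2)) =
      (hpFun (h + t * Complex.I) * ((a / (a ^ 2 + (t - τ) ^ 2) : ℝ) : ℂ)).re := fun t => by
    rw [Complex.re_mul_ofReal]
  simp_rw [hre]
  refine ⟨hi2.re, ?_⟩
  have := integral_re hi2
  simp only [RCLike.re_to_complex] at this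
  rw [this, hv, Complex.re_mul_ofReal, mul_comm]

/-- The weight `y` on `(0, x]`, continued by `x ^ 4 / y ^ 3` beyond `x`. -/
noncomputable def schurWeight (x y : ℝ) : ℝ := if y ≤ x then y else x ^ 4 * y ^ (-3 : ℝ)

lemma schurWeight_nonneg {x y : ℝ} (hx : 0 < x) (hy : 0 < y) : 0 ≤ schurWeight x y := by
  unfold schurWeight
  split_ifs <;> positivity

lemma measurable_schurWeight (x : ℝ) : Measurable (schurWeight x) := by
  unfold schurWeight
  exact Measurable.ite measurableSet_Iic measurable_id ((measurable_id.pow_const _).const_mul _)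

lemma integrableOn_schurWeight_and_integral {x : ℝ} (hx : 0 < x) (τ : ℝ) :
    IntegrableOn (fun y : ℝ => (schurWeight x y : ℂ) * (y : ℂ) ^ (τ * Complex.I)) (Ioi 0) ∧
    ∫ y in Ioi (0 : ℝ), (schurWeight x y : ℂ) * (y : ℂ) ^ (τ * Complex.I) =
      (x : ℂ) ^ (2 + τ * Complex.I) * (4 / (4 + τ ^ 2) : ℝ) := by
  have hx0 : (x : ℂ) ≠ 0 := by exact_mod_cast hx.ne'
  have e1 : EqOn (fun y : ℝ => (schurWeight x y : ℂ) * (y : ℂ) ^ (τ * Complex.I))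
      (fun y : ℝ => (y : ℂ) ^ (1 + τ * Complex.I)) (Ioc 0 x) := by
    intro y hy
    have hy0 : (y : ℂ) ≠ 0 := by exact_mod_cast hy.1.ne'
    simp only [schurWeight, if_pos hy.2]
    rw [Complex.cpow_add _ _ hy0, Complex.cpow_one]
  have e2 : EqOn (fun y : ℝ => (schurWeight x y : ℂ) * (y : ℂ) ^ (τ * Complex.I))
      (fun y : ℝ => (x : ℂ) ^ 4 * (y : ℂ) ^ (-3 + τ * Complex.I)) (Ioi x) := by
    intro y hy
    have hyx : x < y := hy
    have hy0 : (y : ℂ) ≠ 0 := by exact_mod_cast (hx.trans hyx).ne'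
    simp only [schurWeight, if_neg (not_le.2 hyx)]
    rw [Complex.cpow_add _ _ hy0]
    push_cast
    rw [Complex.ofReal_cpow (hx.trans hyx).le]
    push_cast
    ring
  have i1 : IntegrableOn (fun y : ℝ => (y : ℂ) ^ (1 + τ * Complex.I)) (Ioc 0 x) := by
    rw [← intervalIntegrable_iff_integrableOn_Ioc_of_le hx.le]
    exact intervalIntegral.intervalIntegrable_cpow' (by simp)
  have i2 : IntegrableOn (fun y : ℝ => (x : ℂ) ^ 4 * (y : ℂ) ^ (-3 + τ * Complex.I)) (Ioi x) :=
    (integrableOn_Ioi_cpow_of_lt (by simp) hx).const_mul _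
  have j1 := i1.congr_fun e1.symm measurableSet_Ioc
  have j2 := i2.congr_fun e2.symm measurableSet_Ioi
  have hU : Ioc 0 x ∪ Ioi x = Ioi 0 := Ioc_union_Ioi_eq_Ioi hx.le
  have hne1 : (2 + τ * Complex.I : ℂ) ≠ 0 := fun h => by
    have := congrArg Complex.re h; simp at this
  have hne2 : (-2 + τ * Complex.I : ℂ) ≠ 0 := fun h => by
    have := congrArg Complex.re h; simp at this
  have hne3 : (4 + τ ^ 2 : ℂ) ≠ 0 := by exact_mod_cast (show (4 + τ ^ 2 : ℝ) ≠ 0 by positivity)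
  refine ⟨hU ▸ j1.union j2, ?_⟩
  rw [← hU, setIntegral_union (by simp) measurableSet_Ioi j1 j2,
    setIntegral_congr_fun measurableSet_Ioc e1, setIntegral_congr_fun measurableSet_Ioi e2,
    ← intervalIntegral.integral_of_le hx.le, integral_cpow (by left; simp), integral_const_mul,
    integral_Ioi_cpow_of_lt (by simp) hx]
  have a1 : (1 + τ * Complex.I + 1 : ℂ) = 2 + τ * Complex.I := by ring
  have a2 : (-3 + τ * Complex.I + 1 : ℂ) = -2 + τ * Complex.I := by ring
  have a3 : (x : ℂ) ^ 4 * (x : ℂ) ^ (-2 + τ * Complex.I) = (x : ℂ) ^ (2 + τ * Complex.I) := by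
    rw [← Complex.cpow_natCast, ← Complex.cpow_add _ _ hx0]; congr 1; push_cast; ring
  rw [a1, a2, Complex.ofReal_zero, Complex.zero_cpow hne1, sub_zero, neg_div, mul_neg, mul_div_assoc', a3]
  push_cast
  field_simp
  linear_combination (-4 * (x : ℂ) ^ (2 + τ * Complex.I) * τ ^ 2) * Complex.I_sq

/-- A Schur type mean square bound. -/
lemma integral_schurWeight_le {x : ℝ} (hx : 0 < x) {q : ℝ → ℂ} (hq : Integrable q) :
    IntegrableOn (fun y : ℝ => schurWeight x y * ‖∫ t : ℝ, q t * (y : ℂ) ^ (t * Complex.I)‖ ^ 2) (Ioi 0) ∧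
    ∫ y in Ioi (0 : ℝ), schurWeight x y * ‖∫ t : ℝ, q t * (y : ℂ) ^ (t * Complex.I)‖ ^ 2 ≤
      x ^ 2 * ∫ z : ℝ × ℝ, ‖q z.1‖ * ‖q z.2‖ * (4 / (4 + (z.1 - z.2) ^ 2)) := by
  set F : ℝ → ℝ × ℝ → ℂ := fun y z => (q z.1 * starRingEnd ℂ (q z.2)) *
    ((schurWeight x y : ℂ) * (y : ℂ) ^ (((z.1 - z.2 : ℝ) : ℂ) * Complex.I)) with hF
  have hqq : Integrable (fun z : ℝ × ℝ => q z.1 * starRingEnd ℂ (q z.2)) :=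
    hq.mul_prod (Complex.conjCLE.toContinuousLinearMap.integrable_comp hq)
  have hcp : ∀ {y : ℝ}, 0 < y → ∀ u : ℝ, ‖(y : ℂ) ^ ((u : ℂ) * Complex.I)‖ = 1 := fun {y} hy u => by
    rw [Complex.norm_cpow_eq_rpow_re_of_pos hy]; simp
  have hW : IntegrableOn (schurWeight x) (Ioi 0) := by
    have : IntegrableOn (fun y : ℝ => ‖(schurWeight x y : ℂ) * (y : ℂ) ^ ((0 : ℝ) * Complex.I)‖) (Ioi 0) :=
      (integrableOn_schurWeight_and_integral hx 0).1.norm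
    refine IntegrableOn.congr_fun this (fun y hy => ?_) measurableSet_Ioi
    simp [abs_of_nonneg (schurWeight_nonneg hx hy)]
  have hint : Integrable (Function.uncurry F) ((volume.restrict (Ioi 0)).prod volume) := by
    have hdom := Integrable.mul_prod hW hqq.norm
    refine hdom.mono' ?_ ?_
    · simp only [hF, Function.uncurry_def]
      apply AEStronglyMeasurable.mul
      · exact (hqq.aestronglyMeasurable).comp_snd
      · apply Measurable.aestronglyMeasurable
        apply Measurable.mul
        · exact Complex.measurable_ofReal.comp ((measurable_schurWeight x).comp measurable_fst)
        · fun_prop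
    · have h1 : ∀ᵐ y ∂(volume.restrict (Ioi (0 : ℝ))), y ∈ Ioi (0 : ℝ) := ae_restrict_mem measurableSet_Ioi
      have h2 := Measure.ae_prod_mem_iff_ae_ae_mem
        (μ := volume.restrict (Ioi (0 : ℝ))) (ν := (volume : Measure (ℝ × ℝ)))
        (s := Prod.fst ⁻¹' Ioi (0 : ℝ)) (measurable_fst measurableSet_Ioi)
      have h3 : ∀ᵐ w ∂((volume.restrict (Ioi (0 : ℝ))).prod (volume : Measure (ℝ × ℝ))), w.1 ∈ Ioi (0 : ℝ) :=
        h2.2 (h1.mono fun y hy => Eventually.of_forall fun _ => hy)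
      filter_upwards [h3] with w hw
      simp only [hF, Function.uncurry_def]
      rw [norm_mul, norm_mul (schurWeight x w.1 : ℂ), hcp hw, Complex.norm_real, Real.norm_eq_abs,
        abs_of_nonneg (schurWeight_nonneg hx hw)]
      simp [mul_comm]
  have hin : ∀ y ∈ Ioi (0 : ℝ), ∫ z, F y z =
      ((schurWeight x y * ‖∫ t : ℝ, q t * (y : ℂ) ^ (t * Complex.I)‖ ^ 2 : ℝ) : ℂ) := by
    intro y hy
    have hy' : (0 : ℝ) < y := hy
    have hy0 : (y : ℂ) ≠ 0 := by exact_mod_cast hy'.ne'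
    have e : ∀ z : ℝ × ℝ, F y z = (schurWeight x y : ℂ) * ((q z.1 * (y : ℂ) ^ (z.1 * Complex.I)) *
        starRingEnd ℂ (q z.2 * (y : ℂ) ^ (z.2 * Complex.I))) := by
      intro z
      have hc : starRingEnd ℂ ((y : ℂ) ^ ((z.2 : ℂ) * Complex.I)) = (y : ℂ) ^ (-((z.2 : ℂ) * Complex.I)) := by
        rw [show -((z.2 : ℂ) * Complex.I) = starRingEnd ℂ ((z.2 : ℂ) * Complex.I) by simp,
          Complex.cpow_conj, Complex.conj_ofReal]
        rw [Complex.arg_ofReal_of_nonneg hy'.le]; exact Real.pi_ne_zero.symm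
      have : (y : ℂ) ^ (((z.1 - z.2 : ℝ) : ℂ) * Complex.I) =
          (y : ℂ) ^ (z.1 * Complex.I) * (y : ℂ) ^ (-((z.2 : ℂ) * Complex.I)) := by
        rw [← Complex.cpow_add _ _ hy0]; congr 1; push_cast; ring
      simp only [hF]
      rw [map_mul, hc, this]
      ring
    simp_rw [e]
    rw [integral_const_mul, Measure.volume_eq_prod,
      integral_prod_mul (fun t : ℝ => q t * (y : ℂ) ^ (t * Complex.I))
        (fun t : ℝ => starRingEnd ℂ (q t * (y : ℂ) ^ (t * Complex.I))), integral_conj,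
      Complex.mul_conj, Complex.normSq_eq_norm_sq]
    push_cast
    ring
  have hI := hint.integral_prod_left
  have hI2 : IntegrableOn (fun y => ((schurWeight x y * ‖∫ t : ℝ, q t * (y : ℂ) ^ (t * Complex.I)‖ ^ 2 : ℝ) : ℂ)) (Ioi 0) :=
    IntegrableOn.congr_fun (f := fun y => ∫ z, F y z) hI hin measurableSet_Ioi
  have hI3 : IntegrableOn (fun y => ((schurWeight x y * ‖∫ t : ℝ, q t * (y : ℂ) ^ (t * Complex.I)‖ ^ 2 : ℝ) : ℂ).re) (Ioi 0) := hI2.re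
  simp only [Complex.ofReal_re] at hI3
  refine ⟨hI3, ?_⟩
  have hsw := integral_integral_swap hint
  rw [setIntegral_congr_fun measurableSet_Ioi hin, integral_complex_ofReal] at hsw
  have hz : ∀ z : ℝ × ℝ, ‖∫ y in Ioi (0 : ℝ), F y z‖ =
      x ^ 2 * (‖q z.1‖ * ‖q z.2‖ * (4 / (4 + (z.1 - z.2) ^ 2))) := by
    intro z
    simp only [hF]
    rw [integral_const_mul, (integrableOn_schurWeight_and_integral hx _).2, norm_mul, norm_mul, norm_mul,
      Complex.norm_cpow_eq_rpow_re_of_pos hx, Complex.norm_real, Real.norm_eq_abs,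
      abs_of_nonneg (by positivity)]
    simp
    ring
  have hle := norm_integral_le_integral_norm (μ := volume) (fun z : ℝ × ℝ => ∫ y in Ioi (0 : ℝ), F y z)
  rw [← hsw, Complex.norm_real] at hle
  simp_rw [hz] at hle
  rw [integral_const_mul] at hle
  exact (le_abs_self _).trans hle

/-- Symmetrisation of the double integral in `integral_schurWeight_le`. -/
lemma integral_prod_kernel_le {m : ℝ → ℂ} {p B : ℝ → ℝ} (hm : Continuous m) (hp : Continuous p)
    (hp0 : ∀ t, 0 ≤ p t)
    (hk : ∀ t, Integrable (fun u : ℝ => p u * (4 / (4 + (u - t) ^ 2))))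
    (hB : ∀ t, ∫ u : ℝ, p u * (4 / (4 + (u - t) ^ 2)) = B t)
    (hmB : Integrable (fun t => ‖m t‖ ^ 2 * p t * B t)) :
    ∫ z : ℝ × ℝ, ‖m z.1 * p z.1‖ * ‖m z.2 * p z.2‖ * (4 / (4 + (z.1 - z.2) ^ 2)) ≤
      ∫ t, ‖m t‖ ^ 2 * p t * B t := by
  set F : ℝ × ℝ → ℝ := fun z => ‖m z.1‖ ^ 2 * p z.1 * (p z.2 * (4 / (4 + (z.2 - z.1) ^ 2))) with hF
  have hFc : Continuous F := by
    apply Continuous.mul (by fun_prop)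
    apply Continuous.mul (by fun_prop)
    apply Continuous.div (by fun_prop) (by fun_prop)
    intro z; positivity
  have hF0 : ∀ z, 0 ≤ F z := fun z => by
    have := hp0 z.1
    have := hp0 z.2
    simp only [hF]; positivity
  have hinner : ∀ t, ∫ u, F (t, u) = ‖m t‖ ^ 2 * p t * B t := fun t => by
    simp only [hF]
    rw [integral_const_mul, hB]
  have hFi : Integrable F (volume.prod volume) := by
    rw [integrable_prod_iff hFc.aestronglyMeasurable]
    refine ⟨Eventually.of_forall fun t => by simpa only [hF] using (hk t).const_mul (‖m t‖ ^ 2 * p t), ?_⟩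
    simp_rw [Real.norm_of_nonneg (hF0 _), hinner]
    exact hmB
  have hFv : ∫ z, F z = ∫ t, ‖m t‖ ^ 2 * p t * B t := by
    rw [Measure.volume_eq_prod, integral_prod _ hFi]
    simp_rw [hinner]
  have hFs : Integrable (fun z : ℝ × ℝ => F z.swap) := hFi.swap
  have hFsv : ∫ z : ℝ × ℝ, F z.swap = ∫ z, F z := integral_prod_swap F
  have hle : ∀ z : ℝ × ℝ, ‖m z.1 * p z.1‖ * ‖m z.2 * p z.2‖ * (4 / (4 + (z.1 - z.2) ^ 2)) ≤
      (1 / 2) * (F z + F z.swap) := by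
    intro z
    have e1 : (z.2 - z.1) ^ 2 = (z.1 - z.2) ^ 2 := by ring
    simp only [hF, Prod.fst_swap, Prod.snd_swap, norm_mul, Complex.norm_real, Real.norm_eq_abs,
      abs_of_nonneg (hp0 _), e1]
    have hk0 : 0 ≤ p z.1 * p z.2 * (4 / (4 + (z.1 - z.2) ^ 2)) := by
      have := hp0 z.1
      have := hp0 z.2
      positivity
    nlinarith [mul_nonneg hk0 (sq_nonneg (‖m z.1‖ - ‖m z.2‖))]
  have hi2 : Integrable (fun z : ℝ × ℝ => (1 / 2) * (F z + F z.swap)) := (Integrable.add hFi hFs).const_mul _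
  refine (integral_mono_of_nonneg (Eventually.of_forall fun z => ?_) hi2
    (Eventually.of_forall hle)).trans ?_
  · simp only [Pi.zero_apply]; positivity
  · rw [integral_const_mul, Measure.volume_eq_prod, integral_add hFi hFs, ← Measure.volume_eq_prod, hFsv, hFv]
    linarith

/-- Piecewise linear approximation of the indicator function of `(-∞, 1]`. -/
noncomputable def smoothStep (ε x : ℝ) : ℝ := (max (1 + ε - x) 0 - max (1 - x) 0) / ε

lemma smoothStep_of_le_one {ε x : ℝ} (hε : 0 < ε) (hx : x ≤ 1) : smoothStep ε x = 1 := by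
  rw [smoothStep, max_eq_left (by linarith), max_eq_left (by linarith)]
  field_simp; ring

lemma smoothStep_of_ge {ε x : ℝ} (hε : 0 < ε) (hx : 1 + ε ≤ x) : smoothStep ε x = 0 := by
  rw [smoothStep, max_eq_right (by linarith), max_eq_right (by linarith)]
  simp

lemma smoothStep_of_mem {ε x : ℝ} (h1 : 1 ≤ x) (h2 : x ≤ 1 + ε) : smoothStep ε x = (1 + ε - x) / ε := by
  rw [smoothStep, max_eq_left (by linarith), max_eq_right (by linarith), sub_zero]

lemma smoothStep_nonneg {ε x : ℝ} (hε : 0 < ε) : 0 ≤ smoothStep ε x := by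
  rw [smoothStep]
  have : max (1 - x) 0 ≤ max (1 + ε - x) 0 := by gcongr; linarith
  apply div_nonneg _ hε.le
  linarith

lemma smoothStep_le_one {ε x : ℝ} (hε : 0 < ε) : smoothStep ε x ≤ 1 := by
  rcases le_total x 1 with h | h
  · exact (smoothStep_of_le_one hε h).le
  rcases le_total x (1 + ε) with h2 | h2
  · rw [smoothStep_of_mem h h2, div_le_one hε]; linarith
  · rw [smoothStep_of_ge hε h2]; norm_num

lemma smoothStep_antitone {ε x y : ℝ} (hε : 0 < ε) (hxy : x ≤ y) : smoothStep ε y ≤ smoothStep ε x := by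
  rcases le_total x 1 with h | h
  · rw [smoothStep_of_le_one hε h]; exact smoothStep_le_one hε
  rcases le_total y (1 + ε) with h2 | h2
  · rw [smoothStep_of_mem h (hxy.trans h2), smoothStep_of_mem (h.trans hxy) h2]
    gcongr
  · rw [smoothStep_of_ge hε h2]; exact smoothStep_nonneg hε

lemma continuous_smoothStep (ε : ℝ) : Continuous (smoothStep ε) := by
  unfold smoothStep; fun_prop

/-- Smoothed indicator function of `(1, 1 + δ]` times `√x`. -/
noncomputable def windowFun (δ ε x : ℝ) : ℝ :=
  x ^ (1 / 2 : ℝ) * (smoothStep ε (x / (1 + δ)) - smoothStep ε x)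

lemma continuous_windowFun (δ ε : ℝ) : Continuous (windowFun δ ε) := by
  unfold windowFun
  refine (Real.continuous_rpow_const (by norm_num)).mul ?_
  exact ((continuous_smoothStep ε).comp (continuous_id.div_const _)).sub (continuous_smoothStep ε)

lemma windowFun_of_le_one {δ ε x : ℝ} (hδ : 0 < δ) (hε : 0 < ε) (hx : x ≤ 1) :
    windowFun δ ε x = 0 := by
  have : x / (1 + δ) ≤ 1 := by rw [div_le_one (by linarith)]; linarith
  rw [windowFun, smoothStep_of_le_one hε hx, smoothStep_of_le_one hε this]; ring

lemma windowFun_of_ge {δ ε x : ℝ} (hδ : 0 < δ) (hε : 0 < ε) (hx : (1 + ε) * (1 + δ) ≤ x) :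
    windowFun δ ε x = 0 := by
  have : 1 + ε ≤ x / (1 + δ) := by rwa [le_div_iff₀ (by linarith)]
  rw [windowFun, smoothStep_of_ge hε (x := x) (by nlinarith), smoothStep_of_ge hε this]; ring

lemma windowFun_nonneg {δ ε x : ℝ} (hδ : 0 < δ) (hε : 0 < ε) (hx : 0 ≤ x) : 0 ≤ windowFun δ ε x := by
  have : x / (1 + δ) ≤ x := div_le_self hx (by linarith)
  have := smoothStep_antitone hε this
  rw [windowFun]
  have h2 : 0 ≤ x ^ (1 / 2 : ℝ) := by positivity
  exact mul_nonneg h2 (by linarith)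

lemma windowFun_le {δ ε x : ℝ} (hε : 0 < ε) (hx : 0 ≤ x) :
    windowFun δ ε x ≤ x ^ (1 / 2 : ℝ) := by
  rw [windowFun]
  apply mul_le_of_le_one_right (by positivity)
  linarith [smoothStep_nonneg hε (x := x), smoothStep_le_one hε (x := x / (1 + δ))]

lemma abs_windowFun_le {δ ε x : ℝ} (hδ : 0 < δ) (hε : 0 < ε) (hx : 0 ≤ x) :
    |windowFun δ ε x| ≤ ((1 + ε) * (1 + δ)) ^ (1 / 2 : ℝ) := by
  rw [abs_of_nonneg (windowFun_nonneg hδ hε hx)]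
  rcases le_total x ((1 + ε) * (1 + δ)) with h | h
  · exact (windowFun_le hε hx).trans (by gcongr)
  · rw [windowFun_of_ge hδ hε h]; positivity

lemma tendsto_windowFun {δ x : ℝ} (hδ : 0 < δ) :
    Tendsto (fun n : ℕ => windowFun δ (1 / ((n : ℝ) + 1)) x) atTop
      (𝓝 (if 1 < x ∧ x ≤ 1 + δ then x ^ (1 / 2 : ℝ) else 0)) := by
  have hst : ∀ u : ℝ, Tendsto (fun n : ℕ => smoothStep (1 / ((n : ℝ) + 1)) u) atTop
      (𝓝 (if u ≤ 1 then 1 else 0)) := by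
    intro u
    split_ifs with hu
    · exact tendsto_const_nhds.congr fun n => (smoothStep_of_le_one (by positivity) hu).symm
    · push Not at hu
      refine tendsto_const_nhds.congr' ?_
      have := tendsto_one_div_add_atTop_nhds_zero_nat (𝕜 := ℝ)
      filter_upwards [this.eventually_lt_const (show (0 : ℝ) < u - 1 by linarith)] with n hn
      rw [smoothStep_of_ge (by positivity)]
      linarith
  have h := ((hst (x / (1 + δ))).sub (hst x)).const_mul (x ^ (1 / 2 : ℝ))
  have hd : (0 : ℝ) < 1 + δ := by linarith
  suffices e : (if 1 < x ∧ x ≤ 1 + δ then x ^ (1 / 2 : ℝ) else 0) =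
      x ^ (1 / 2 : ℝ) * ((if x / (1 + δ) ≤ 1 then 1 else 0) - if x ≤ 1 then 1 else 0) by
    rw [e]; exact h
  by_cases h1 : 1 < x
  · have h1' : ¬ x ≤ 1 := not_le.2 h1
    by_cases h2 : x ≤ 1 + δ
    · simp [h1, h2, h1', div_le_one hd]
    · simp [h2, h1', div_le_one hd]
  · have h1' : x ≤ 1 := not_lt.1 h1
    have h2 : x ≤ 1 + δ := by linarith
    simp [h1, h2, h1', div_le_one hd]

/-- Mellin transform of `windowFun`. -/
noncomputable def windowMellin (δ ε : ℝ) (s : ℂ) : ℂ := mellin (fun x => (windowFun δ ε x : ℂ)) s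

lemma windowMellin_convergent {δ ε : ℝ} (hδ : 0 < δ) (hε : 0 < ε) (s : ℂ) :
    MellinConvergent (fun x => (windowFun δ ε x : ℂ)) s ∧
      DifferentiableAt ℂ (windowMellin δ ε) s := by
  have hloc : LocallyIntegrableOn (fun x => (windowFun δ ε x : ℂ)) (Ioi 0) :=
    ((Complex.continuous_ofReal.comp (continuous_windowFun δ ε)).locallyIntegrable).locallyIntegrableOn _
  have htop : (fun x => (windowFun δ ε x : ℂ)) =O[atTop] fun x : ℝ => x ^ (-(s.re + 1)) := by
    have : (fun x => (windowFun δ ε x : ℂ)) =ᶠ[atTop] fun _ => 0 := by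
      filter_upwards [eventually_ge_atTop ((1 + ε) * (1 + δ))] with x hx
      rw [windowFun_of_ge hδ hε hx]; simp
    exact this.trans_isBigO (Asymptotics.isBigO_zero _ _)
  have hbot : (fun x => (windowFun δ ε x : ℂ)) =O[𝓝[>] 0] fun x : ℝ => x ^ (-(s.re - 1)) := by
    have : (fun x => (windowFun δ ε x : ℂ)) =ᶠ[𝓝[>] 0] fun _ => 0 := by
      filter_upwards [Ioo_mem_nhdsGT (show (0 : ℝ) < 1 by norm_num)] with x hx
      rw [windowFun_of_le_one hδ hε hx.2.le]; simp
    exact this.trans_isBigO (Asymptotics.isBigO_zero _ _)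
  exact ⟨mellinConvergent_of_isBigO_rpow hloc htop (by linarith) hbot (by linarith),
    mellin_differentiableAt_of_isBigO_rpow hloc htop (by linarith) hbot (by linarith)⟩

lemma integral_cpow_mul_max {q : ℝ} (hq : 1 ≤ q) {w : ℂ} (h0 : w ≠ 0) (h1 : w + 1 ≠ 0) :
    IntegrableOn (fun t : ℝ => (t : ℂ) ^ (w - 1) * (max (q - t) 0 : ℝ)) (Ioi 1) ∧
    ∫ t in Ioi (1 : ℝ), (t : ℂ) ^ (w - 1) * (max (q - t) 0 : ℝ) =
      q * ((q : ℂ) ^ w - 1) / w - ((q : ℂ) ^ (w + 1) - 1) / (w + 1) := by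
  have e1 : EqOn (fun t : ℝ => (t : ℂ) ^ (w - 1) * (max (q - t) 0 : ℝ))
      (fun t : ℝ => q * (t : ℂ) ^ (w - 1) - (t : ℂ) ^ w) (Ioc 1 q) := by
    intro t ht
    have ht0 : (t : ℂ) ≠ 0 := by exact_mod_cast (by linarith [ht.1] : t ≠ 0)
    simp only
    rw [max_eq_left (by linarith [ht.2])]
    have : (t : ℂ) ^ w = (t : ℂ) ^ (w - 1) * t := by
      nth_rw 3 [← Complex.cpow_one (t : ℂ)]
      rw [← Complex.cpow_add _ _ ht0]; ring_nf
    rw [this]; push_cast; ring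
  have e2 : EqOn (fun t : ℝ => (t : ℂ) ^ (w - 1) * (max (q - t) 0 : ℝ)) (fun _ => 0) (Ioi q) := by
    intro t ht
    have : q < t := ht
    simp only
    rw [max_eq_right (by linarith)]; simp
  have hz : (0 : ℝ) ∉ uIcc 1 q := by
    rw [uIcc_of_le hq]; simp
  have i1 : IntervalIntegrable (fun t : ℝ => (q : ℂ) * (t : ℂ) ^ (w - 1)) volume 1 q :=
    (intervalIntegral.intervalIntegrable_cpow (Or.inr hz)).const_mul _
  have i2 : IntervalIntegrable (fun t : ℝ => (t : ℂ) ^ w) volume 1 q :=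
    (intervalIntegral.intervalIntegrable_cpow (Or.inr hz))
  have i3 := (intervalIntegrable_iff_integrableOn_Ioc_of_le hq).1 (i1.sub i2)
  have j1 : IntegrableOn (fun t : ℝ => (t : ℂ) ^ (w - 1) * (max (q - t) 0 : ℝ)) (Ioc 1 q) :=
    IntegrableOn.congr_fun i3 e1.symm measurableSet_Ioc
  have j2 : IntegrableOn (fun t : ℝ => (t : ℂ) ^ (w - 1) * (max (q - t) 0 : ℝ)) (Ioi q) :=
    IntegrableOn.congr_fun integrableOn_zero e2.symm measurableSet_Ioi
  have hU : Ioc 1 q ∪ Ioi q = Ioi 1 := Ioc_union_Ioi_eq_Ioi hq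
  refine ⟨hU ▸ j1.union j2, ?_⟩
  rw [← hU, setIntegral_union (by simp) measurableSet_Ioi j1 j2,
    setIntegral_congr_fun measurableSet_Ioc e1, setIntegral_congr_fun measurableSet_Ioi e2,
    ← intervalIntegral.integral_of_le hq, intervalIntegral.integral_sub i1 i2,
    intervalIntegral.integral_const_mul, integral_cpow (Or.inr ⟨?_, hz⟩),
    integral_cpow (Or.inr ⟨?_, hz⟩)]
  · simp; ring
  · intro h; apply h1; rw [h]; ring
  · intro h; apply h0; linear_combination h

/-- Closed form of the Mellin transform. -/
lemma windowMellin_eq {δ ε : ℝ} (hδ : 0 < δ) (hε : 0 < ε) {s : ℂ} (h0 : s + 1 / 2 ≠ 0)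
    (h1 : s + 3 / 2 ≠ 0) : windowMellin δ ε s =
      (((1 + δ : ℝ) : ℂ) ^ (s + 1 / 2) - 1) / (s + 1 / 2) *
        ((((1 + ε : ℝ) : ℂ) ^ (s + 3 / 2) - 1) / (ε * (s + 3 / 2))) := by
  set w : ℂ := s + 1 / 2 with hw
  have hw1 : s + 3 / 2 = w + 1 := by rw [hw]; ring
  rw [hw1] at h1 ⊢
  have hd : (0 : ℝ) < 1 + δ := by linarith
  have he : (0 : ℝ) < 1 + ε := by linarith
  have hdc : (1 + δ : ℂ) ≠ 0 := by exact_mod_cast hd.ne'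
  have hec : (ε : ℂ) ≠ 0 := by exact_mod_cast hε.ne'
  obtain ⟨a1, b1⟩ := integral_cpow_mul_max (q := (1 + ε) * (1 + δ)) (by nlinarith) h0 h1
  obtain ⟨a2, b2⟩ := integral_cpow_mul_max (q := 1 + δ) (by linarith) h0 h1
  obtain ⟨a3, b3⟩ := integral_cpow_mul_max (q := 1 + ε) (by linarith) h0 h1
  obtain ⟨a4, b4⟩ := integral_cpow_mul_max (q := 1) le_rfl h0 h1
  rw [windowMellin, mellin, ← Ioc_union_Ioi_eq_Ioi (zero_le_one' ℝ), setIntegral_union (by simp) measurableSet_Ioi]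
  rotate_left
  · exact (windowMellin_convergent hδ hε s).1.mono_set Ioc_subset_Ioi_self
  · exact (windowMellin_convergent hδ hε s).1.mono_set (Ioi_subset_Ioi zero_le_one)
  have z1 : ∫ t in Ioc (0 : ℝ) 1, (t : ℂ) ^ (s - 1) • (windowFun δ ε t : ℂ) = 0 := by
    apply setIntegral_eq_zero_of_forall_eq_zero
    intro t ht
    rw [windowFun_of_le_one hδ hε ht.2]; simp
  have e2 : EqOn (fun t : ℝ => (t : ℂ) ^ (s - 1) • (windowFun δ ε t : ℂ)) (fun t : ℝ =>
      (1 / (ε * (1 + δ)) : ℂ) * (((t : ℂ) ^ (w - 1) * (max ((1 + ε) * (1 + δ) - t) 0 : ℝ)) -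
        ((t : ℂ) ^ (w - 1) * (max (1 + δ - t) 0 : ℝ))) - (1 / ε : ℂ) *
          (((t : ℂ) ^ (w - 1) * (max (1 + ε - t) 0 : ℝ)) - ((t : ℂ) ^ (w - 1) * (max (1 - t) 0 : ℝ)))) (Ioi 1) := by
    intro t ht
    have ht' : (0 : ℝ) < t := lt_trans one_pos ht
    have ht0 : (t : ℂ) ≠ 0 := by exact_mod_cast ht'.ne'
    have m1 : max (1 + ε - t / (1 + δ)) 0 = max ((1 + ε) * (1 + δ) - t) 0 / (1 + δ) := by
      rw [← max_div_div_right hd.le, zero_div, sub_div, mul_div_cancel_right₀ _ hd.ne']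
    have m2 : max (1 - t / (1 + δ)) 0 = max (1 + δ - t) 0 / (1 + δ) := by
      rw [← max_div_div_right hd.le, zero_div, sub_div, div_self hd.ne']
    have c1 : (t : ℂ) ^ (w - 1) = (t : ℂ) ^ (s - 1) * ((t ^ (1 / 2 : ℝ) : ℝ) : ℂ) := by
      rw [Complex.ofReal_cpow ht'.le, ← Complex.cpow_add _ _ ht0]
      congr 1; rw [hw]; push_cast; ring
    simp only [windowFun, smoothStep, m1, m2, smul_eq_mul]
    rw [c1]
    push_cast
    field_simp
  have a12 : IntegrableOn (fun t : ℝ => (1 / (ε * (1 + δ)) : ℂ) * (((t : ℂ) ^ (w - 1) *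
      (max ((1 + ε) * (1 + δ) - t) 0 : ℝ)) - ((t : ℂ) ^ (w - 1) * (max (1 + δ - t) 0 : ℝ)))) (Ioi 1) :=
    (a1.sub a2).const_mul _
  have a34 : IntegrableOn (fun t : ℝ => (1 / ε : ℂ) * (((t : ℂ) ^ (w - 1) *
      (max (1 + ε - t) 0 : ℝ)) - ((t : ℂ) ^ (w - 1) * (max (1 - t) 0 : ℝ)))) (Ioi 1) :=
    (a3.sub a4).const_mul _
  rw [z1, zero_add, setIntegral_congr_fun measurableSet_Ioi e2, integral_sub a12 a34, integral_const_mul,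
    integral_const_mul, integral_sub a1 a2, integral_sub a3 a4, b1, b2, b3, b4]
  have p1 : (((1 + ε) * (1 + δ) : ℝ) : ℂ) ^ w = ((1 + ε : ℝ) : ℂ) ^ w * ((1 + δ : ℝ) : ℂ) ^ w := by
    rw [Complex.ofReal_mul, Complex.mul_cpow_ofReal_nonneg he.le hd.le]
  have p2 : ∀ u : ℝ, 0 < u → (u : ℂ) ^ (w + 1) = (u : ℂ) ^ w * u := fun u hu => by
    rw [Complex.cpow_add _ _ (by exact_mod_cast hu.ne'), Complex.cpow_one]
  rw [p2 _ (by positivity), p2 _ hd, p2 _ he, p2 _ one_pos, p1]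
  push_cast
  rw [Complex.one_cpow]
  generalize (1 + δ : ℂ) ^ w = D
  generalize (1 + ε : ℂ) ^ w = E
  field_simp
  ring

lemma norm_windowMellin_le {δ ε : ℝ} (hδ : 0 < δ) (hε : 0 < ε) (A : ℝ) : ∃ C : ℝ, 0 ≤ C ∧
    ∀ s : ℂ, s + 1 / 2 ≠ 0 → s + 3 / 2 ≠ 0 → s.re ≤ A →
      ‖windowMellin δ ε s‖ ≤ C / (‖s + 1 / 2‖ * ‖s + 3 / 2‖) := by
  refine ⟨((1 + δ) ^ |A + 1 / 2| + 1) * (((1 + ε) ^ |A + 3 / 2| + 1) / ε), by positivity,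
    fun s h0 h1 hA => ?_⟩
  have hpow : ∀ q : ℝ, 1 ≤ q → ∀ w : ℂ, ∀ B : ℝ, w.re ≤ B → ‖(q : ℂ) ^ w - 1‖ ≤ q ^ |B| + 1 := by
    intro q hq w B hB
    refine (norm_sub_le _ _).trans ?_
    rw [Complex.norm_cpow_eq_rpow_re_of_pos (by linarith), norm_one]
    gcongr
    exact hB.trans (le_abs_self _)
  rw [windowMellin_eq hδ hε h0 h1]
  have b1 := hpow (1 + δ) (by linarith) (s + 1 / 2) (A + 1 / 2) (by simp; linarith)
  have b2 := hpow (1 + ε) (by linarith) (s + 3 / 2) (A + 3 / 2) (by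
    simp only [Complex.add_re, Complex.div_ofNat_re, Complex.re_ofNat]; linarith)
  have p0 : 0 < ‖s + 1 / 2‖ := norm_pos_iff.2 h0
  have p1 : 0 < ‖s + 3 / 2‖ := norm_pos_iff.2 h1
  rw [norm_mul, norm_div, norm_div, norm_mul, Complex.norm_real, Real.norm_eq_abs, abs_of_pos hε]
  calc _ ≤ ((1 + δ) ^ |A + 1 / 2| + 1) / ‖s + 1 / 2‖ * (((1 + ε) ^ |A + 3 / 2| + 1) / (ε * ‖s + 3 / 2‖)) := by
        gcongr
    _ = _ := by field_simp

lemma norm_windowMellin_le_of_re_nonneg {δ ε : ℝ} (hδ : 0 < δ) (hε : 0 < ε) (A : ℝ) : ∃ C : ℝ, 0 ≤ C ∧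
    ∀ s : ℂ, 0 ≤ s.re → s.re ≤ A → ‖windowMellin δ ε s‖ ≤ C * (1 + ‖s‖) ^ (-2 : ℝ) := by
  obtain ⟨C, hC0, hC⟩ := norm_windowMellin_le hδ hε A
  refine ⟨9 * C, by positivity, fun s hs hA => ?_⟩
  have hb : ∀ c : ℝ, 1 / 2 ≤ c → (1 + ‖s‖) / 3 ≤ ‖s + c‖ := by
    intro c hc
    have h1 : c ≤ ‖s + c‖ := by
      refine le_trans ?_ (Complex.re_le_norm _); simp; linarith
    have h2 : ‖s‖ ≤ ‖s + c‖ := by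
      rw [Complex.norm_def, Complex.norm_def]
      apply Real.sqrt_le_sqrt
      simp only [Complex.normSq_apply, Complex.add_re, Complex.ofReal_re, Complex.add_im,
        Complex.ofReal_im, add_zero]
      nlinarith
    linarith
  have b1 := hb (1 / 2) le_rfl
  have b2 := hb (3 / 2) (by norm_num)
  push_cast at b1 b2
  have hp : 0 < (1 + ‖s‖) / 3 := by positivity
  refine (hC s (norm_pos_iff.1 (hp.trans_le b1)) (norm_pos_iff.1 (hp.trans_le b2)) hA).trans ?_
  calc _ ≤ C / ((1 + ‖s‖) / 3 * ((1 + ‖s‖) / 3)) := by gcongr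
    _ = _ := by
      rw [Real.rpow_neg (by positivity), Real.rpow_two]; field_simp; ring

lemma windowMellin_half {δ ε : ℝ} (hδ : 0 < δ) (hε : 0 < ε) :
    windowMellin δ ε (1 / 2) = (δ * (1 + ε / 2) : ℝ) := by
  rw [windowMellin_eq hδ hε (by norm_num) (by norm_num)]
  have e1 : (1 / 2 + 1 / 2 : ℂ) = 1 := by norm_num
  have e2 : (1 / 2 + 3 / 2 : ℂ) = (2 : ℕ) := by norm_num
  have hec : (ε : ℂ) ≠ 0 := by exact_mod_cast hε.ne'
  rw [e1, e2, Complex.cpow_one, Complex.cpow_natCast]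
  push_cast
  field_simp
  ring

lemma integrable_windowMellin {δ ε : ℝ} (hδ : 0 < δ) (hε : 0 < ε) {σ : ℝ} (hσ : 0 ≤ σ) :
    Integrable (fun t : ℝ => windowMellin δ ε (σ + t * Complex.I)) := by
  obtain ⟨C, hC0, hC⟩ := norm_windowMellin_le_of_re_nonneg hδ hε σ
  refine integrable_vertical (C := C) le_rfl (fun z _ => (windowMellin_convergent hδ hε z).2)
    (fun z hz => (hC z (by linarith) hz.le).trans ?_)
  gcongr C * ?_
  exact Real.rpow_le_rpow_of_exponent_le (by linarith [norm_nonneg z]) (by norm_num)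

/-- Mellin inversion for `windowFun`. -/
lemma integral_windowMellin_mul_cpow {δ ε : ℝ} (hδ : 0 < δ) (hε : 0 < ε) {x σ : ℝ} (hx : 0 < x)
    (hσ : 0 ≤ σ) :
    ∫ t : ℝ, windowMellin δ ε (σ + t * Complex.I) * (x : ℂ) ^ (-(σ + t * Complex.I)) =
      2 * Real.pi * windowFun δ ε x := by
  have h := mellinInv_mellin_eq σ (fun x => (windowFun δ ε x : ℂ)) hx
    (windowMellin_convergent hδ hε σ).1 (integrable_windowMellin hδ hε hσ)
    (Complex.continuous_ofReal.comp (continuous_windowFun δ ε)).continuousAt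
  rw [mellinInv] at h
  have h2 := congrArg (fun z : ℂ => (2 * Real.pi : ℂ) * z) h
  rw [← h2]
  have hpi : (Real.pi : ℂ) ≠ 0 := by exact_mod_cast Real.pi_ne_zero
  rw [Complex.real_smul]
  push_cast
  rw [← mul_assoc, show (2 * Real.pi : ℂ) * (1 / (2 * Real.pi)) = 1 by field_simp, one_mul]
  congr 1
  ext t
  rw [smul_eq_mul, mul_comm, windowMellin]

lemma norm_vertical_cpow {x : ℝ} (hx : 0 < x) (σ t : ℝ) :
    ‖(x : ℂ) ^ (-(σ + t * Complex.I))‖ = x ^ (-σ) := by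
  rw [Complex.norm_cpow_eq_rpow_re_of_pos hx]; simp

lemma integrable_windowMellin_mul_cpow {δ ε : ℝ} (hδ : 0 < δ) (hε : 0 < ε) {x σ : ℝ} (hx : 0 < x)
    (hσ : 0 ≤ σ) :
    Integrable (fun t : ℝ => windowMellin δ ε (σ + t * Complex.I) * (x : ℂ) ^ (-(σ + t * Complex.I))) := by
  refine ((integrable_windowMellin hδ hε hσ).norm.mul_const (x ^ (-σ))).mono'
    ((integrable_windowMellin hδ hε hσ).aestronglyMeasurable.mul
      (Measurable.aestronglyMeasurable (by fun_prop))) (Eventually.of_forall fun t => ?_)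
  rw [norm_mul, norm_vertical_cpow hx]

/-- The part of the explicit formula coming from prime powers. -/
lemma integral_mangoldtSeries_mul {δ ε : ℝ} (hδ : 0 < δ) (hε : 0 < ε) {y σ : ℝ} (hy : 0 < y)
    (hσ : 2 ≤ σ) :
    Integrable (fun t : ℝ => mangoldtSeries (1 / 2 + (σ + t * Complex.I)) *
      (windowMellin δ ε (σ + t * Complex.I) * (y : ℂ) ^ (σ + t * Complex.I))) ∧
    ∫ t : ℝ, mangoldtSeries (1 / 2 + (σ + t * Complex.I)) *
      (windowMellin δ ε (σ + t * Complex.I) * (y : ℂ) ^ (σ + t * Complex.I)) =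
      2 * Real.pi * (∑' n : ℕ, Λ n * (n : ℝ) ^ (-(1 / 2) : ℝ) * windowFun δ ε (n / y) : ℝ) := by
  set c : ℕ → ℝ := fun n => Λ n * (n : ℝ) ^ (-(1 / 2) : ℝ) with hc
  have hc0 : ∀ n, 0 ≤ c n := fun n => by
    have := vonMangoldt_nonneg (n := n)
    simp only [hc]; positivity
  set F : ℕ → ℝ → ℂ := fun n t => (c n : ℂ) * (windowMellin δ ε (σ + t * Complex.I) *
    ((n / y : ℝ) : ℂ) ^ (-(σ + t * Complex.I))) with hF
  have hterm : ∀ (n : ℕ) (t : ℝ), LSeries.term (fun n => (Λ n : ℂ)) (1 / 2 + (σ + t * Complex.I)) n *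
      (windowMellin δ ε (σ + t * Complex.I) * (y : ℂ) ^ (σ + t * Complex.I)) = F n t := by
    intro n t
    rcases eq_or_ne n 0 with rfl | hn
    · simp [hF, hc]
    have hn0 : (n : ℂ) ≠ 0 := by exact_mod_cast hn
    have hy0 : (y : ℂ) ≠ 0 := by exact_mod_cast hy.ne'
    rw [LSeries.term_of_ne_zero hn]
    simp only [hF, hc]
    have e1 : ((n / y : ℝ) : ℂ) ^ (-(σ + t * Complex.I)) =
        (y : ℂ) ^ (σ + t * Complex.I) / (n : ℂ) ^ (σ + t * Complex.I) := by
      rw [div_eq_mul_inv (n : ℝ), Complex.ofReal_mul, Complex.mul_cpow_ofReal_nonneg (by positivity) (by positivity),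
        Complex.ofReal_natCast, Complex.ofReal_inv, Complex.cpow_neg, Complex.inv_cpow, Complex.cpow_neg, inv_inv]
      · ring
      · rw [Complex.arg_ofReal_of_nonneg hy.le]; exact Real.pi_ne_zero.symm
    rw [e1, Complex.cpow_add _ _ hn0]
    push_cast
    rw [Complex.ofReal_cpow (by positivity)]
    push_cast
    rw [Complex.cpow_neg]
    have := Complex.cpow_ne_zero_iff_of_exponent_ne_zero (x := (n : ℂ)) (y := 1 / 2) (by norm_num) |>.2 hn0
    have h2 : (n : ℂ) ^ (σ + t * Complex.I) ≠ 0 := by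
      rw [Complex.cpow_def_of_ne_zero hn0]; exact Complex.exp_ne_zero _
    field_simp
  have hFn : ∀ (n : ℕ) (t : ℝ), ‖F n t‖ = ‖LSeries.term (fun n => (Λ n : ℂ)) (1 / 2 + σ : ℝ) n‖ * y ^ σ *
      ‖windowMellin δ ε (σ + t * Complex.I)‖ := by
    intro n t
    rw [← hterm, norm_mul, norm_mul, LSeries.norm_term_eq, LSeries.norm_term_eq,
      Complex.norm_cpow_eq_rpow_re_of_pos hy]
    simp
    ring_nf
  have hFi : ∀ n, Integrable (F n) := by
    intro n
    rcases eq_or_ne n 0 with rfl | hn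
    · have : F 0 = fun _ => 0 := by ext t; simp [hF, hc]
      rw [this]; exact integrable_zero _ _ _
    · exact (integrable_windowMellin_mul_cpow hδ hε (by positivity) (by linarith)).const_mul _
  have hsum : Summable (fun n => ‖LSeries.term (fun n => (Λ n : ℂ)) (1 / 2 + σ : ℝ) n‖) :=
    (LSeriesSummable_vonMangoldt (s := ((1 / 2 + σ : ℝ) : ℂ)) (by
      rw [Complex.ofReal_re]; linarith)).norm
  have hS : Summable (fun n => ∫ t, ‖F n t‖) := by
    simp_rw [hFn, integral_const_mul]
    exact (hsum.mul_right _).mul_right _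
  have hts : ∀ t : ℝ, ∑' n, F n t = mangoldtSeries (1 / 2 + (σ + t * Complex.I)) *
      (windowMellin δ ε (σ + t * Complex.I) * (y : ℂ) ^ (σ + t * Complex.I)) := by
    intro t
    simp_rw [← hterm]
    rw [tsum_mul_right, mangoldtSeries, LSeries]
  have hFs : ∀ t : ℝ, Summable (fun n => F n t) := fun t => by
    refine Summable.of_norm ?_
    simp_rw [hFn]
    exact (hsum.mul_right _).mul_right _
  have hmain := hasSum_integral_of_summable_integral_norm hFi hS
  simp_rw [hts] at hmain
  refine ⟨?_, ?_⟩
  · refine (((integrable_windowMellin hδ hε (by linarith : 0 ≤ σ)).norm.const_mul (y ^ σ)).const_mul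
      0.645).mono' ?_ (Eventually.of_forall fun t => ?_)
    · refine aestronglyMeasurable_of_tendsto_ae atTop
        (f := fun (N : ℕ) t => ∑ n ∈ Finset.range N, F n t) (fun N => ?_)
        (Eventually.of_forall fun t => ?_)
      · exact (integrable_finsetSum (Finset.range N) fun n _ => hFi n).aestronglyMeasurable
      · rw [← hts]; exact (hFs t).hasSum.tendsto_sum_nat
    · rw [norm_mul, norm_mul, Complex.norm_cpow_eq_rpow_re_of_pos hy]
      have := norm_mangoldtSeries_le (s := 1 / 2 + (σ + t * Complex.I)) (by simp; linarith)
      simp only [Complex.add_re, Complex.ofReal_re, Complex.mul_re, Complex.I_re, mul_zero,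
        Complex.ofReal_im, Complex.I_im, mul_one, sub_self, add_zero]
      rw [mul_comm ‖windowMellin _ _ _‖]
      gcongr
  · have hval : ∀ n : ℕ, ∫ t : ℝ, F n t =
        ((2 * Real.pi * (c n * windowFun δ ε (n / y)) : ℝ) : ℂ) := by
      intro n
      rcases eq_or_ne n 0 with rfl | hn
      · simp [hF, hc]
      · simp only [hF]
        rw [integral_const_mul, integral_windowMellin_mul_cpow hδ hε (by positivity) (by linarith)]
        push_cast; ring
    simp_rw [hval] at hmain
    rw [← hmain.tsum_eq, ← Complex.ofReal_tsum, tsum_mul_left,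
      Complex.ofReal_mul, Complex.ofReal_mul, Complex.ofReal_ofNat]

lemma integrable_windowMellin_cpow {δ ε : ℝ} (hδ : 0 < δ) (hε : 0 < ε) {y σ : ℝ} (hy : 0 < y)
    (hσ : 0 ≤ σ) : Integrable (fun t : ℝ =>
      windowMellin δ ε (σ + t * Complex.I) * (y : ℂ) ^ (σ + t * Complex.I)) := by
  refine ((integrable_windowMellin hδ hε hσ).norm.mul_const (y ^ σ)).mono'
    ((integrable_windowMellin hδ hε hσ).aestronglyMeasurable.mul
      (Measurable.aestronglyMeasurable (by fun_prop))) (Eventually.of_forall fun t => ?_)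
  rw [norm_mul, Complex.norm_cpow_eq_rpow_re_of_pos hy]
  simp

/-- The part of the explicit formula coming from a simple pole. -/
lemma integral_inv_add_mul {δ ε : ℝ} (hδ : 0 < δ) (hε : 0 < ε) {y σ μ : ℝ} (hy : 0 < y)
    (hσ : 2 ≤ σ) (hμ : -1 ≤ μ) :
    ∫ t : ℝ, 1 / (σ + t * Complex.I + μ) *
      (windowMellin δ ε (σ + t * Complex.I) * (y : ℂ) ^ (σ + t * Complex.I)) =
      2 * Real.pi * (∫ v in Ioi (1 : ℝ), windowFun δ ε (v / y) * v ^ (-μ - 1) : ℝ) := by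
  set F : ℝ → ℝ → ℂ := fun v t => ((v ^ (-μ - 1) : ℝ) : ℂ) *
    (windowMellin δ ε (σ + t * Complex.I) * ((v / y : ℝ) : ℂ) ^ (-(σ + t * Complex.I))) with hF
  have hm := integrable_windowMellin hδ hε (by linarith : 0 ≤ σ)
  have hint : Integrable (Function.uncurry F) ((volume.restrict (Ioi (1 : ℝ))).prod volume) := by
    have h1 : Integrable (fun v : ℝ => y ^ σ * v ^ (-μ - 1 - σ)) (volume.restrict (Ioi 1)) :=
      (integrableOn_Ioi_rpow_of_lt (by linarith) one_pos).const_mul _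
    refine (h1.mul_prod hm.norm).mono' ?_ ?_
    · refine AEStronglyMeasurable.mul (Measurable.aestronglyMeasurable (by fun_prop)) ?_
      exact hm.aestronglyMeasurable.comp_snd.mul (Measurable.aestronglyMeasurable (by fun_prop))
    · have : ∀ᵐ v ∂(volume.restrict (Ioi (1 : ℝ))), 1 < v := ae_restrict_mem measurableSet_Ioi
      have h2 : ∀ᵐ z ∂((volume.restrict (Ioi (1 : ℝ))).prod (volume : Measure ℝ)), 1 < z.1 :=
        Measure.quasiMeasurePreserving_fst.ae this
      filter_upwards [h2] with z hz
      have hz0 : 0 < z.1 := by linarith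
      simp only [Function.uncurry, hF]
      rw [norm_mul, norm_mul, norm_vertical_cpow (by positivity), Complex.norm_real,
        Real.norm_of_nonneg (by positivity), Real.div_rpow hz0.le hy.le, Real.rpow_neg hy.le,
        Real.rpow_sub hz0 (-μ - 1) σ, Real.rpow_neg hz0.le σ]
      apply le_of_eq
      field_simp
  have hsw := integral_integral_swap hint
  have hL : ∀ v ∈ Ioi (1 : ℝ), ∫ t, F v t =
      ((2 * Real.pi * (windowFun δ ε (v / y) * v ^ (-μ - 1)) : ℝ) : ℂ) := by
    intro v hv
    have hv0 : (0 : ℝ) < v := lt_trans one_pos hv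
    simp only [hF]
    rw [integral_const_mul, integral_windowMellin_mul_cpow hδ hε (by positivity) (by linarith)]
    push_cast; ring
  rw [setIntegral_congr_fun measurableSet_Ioi hL, integral_complex_ofReal, integral_const_mul,
    Complex.ofReal_mul, Complex.ofReal_mul, Complex.ofReal_ofNat] at hsw
  rw [hsw]
  refine integral_congr_ae (Eventually.of_forall fun t => ?_)
  have hre : (-(σ + t * Complex.I + μ + 1) : ℂ).re < -1 := by simp; linarith
  have h3 : ∀ v ∈ Ioi (1 : ℝ), F v t = windowMellin δ ε (σ + t * Complex.I) *
      (y : ℂ) ^ (σ + t * Complex.I) * (v : ℂ) ^ (-(σ + t * Complex.I + μ + 1)) := by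
    intro v hv
    have hv0 : (0 : ℝ) < v := lt_trans one_pos hv
    have hvc : (v : ℂ) ≠ 0 := by exact_mod_cast hv0.ne'
    have hyc : (y : ℂ) ≠ 0 := by exact_mod_cast hy.ne'
    simp only [hF]
    rw [div_eq_mul_inv v, Complex.ofReal_mul, Complex.mul_cpow_ofReal_nonneg (by positivity)
      (by positivity), Complex.ofReal_inv, Complex.inv_cpow, Complex.cpow_neg (y : ℂ), inv_inv,
      Complex.ofReal_cpow hv0.le,
      show (-(σ + t * Complex.I + μ + 1) : ℂ) = (-μ - 1 : ℝ) + -(σ + t * Complex.I) by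
        push_cast; ring, Complex.cpow_add _ _ hvc]
    · ring
    · rw [Complex.arg_ofReal_of_nonneg hy.le]; exact Real.pi_ne_zero.symm
  have hne : (σ + t * Complex.I + μ : ℂ) ≠ 0 := by
    intro h; have := congrArg Complex.re h; simp at this; linarith
  show _ = ∫ v in Ioi (1 : ℝ), F v t
  rw [setIntegral_congr_fun measurableSet_Ioi h3, integral_const_mul,
    integral_Ioi_cpow_of_lt hre one_pos, Complex.ofReal_one, Complex.one_cpow,
    show (-(σ + t * Complex.I + μ + 1) : ℂ) + 1 = -(σ + t * Complex.I + μ) by ring]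
  field_simp

lemma setIntegral_windowFun_eq {δ ε : ℝ} (hδ : 0 < δ) (hε : 0 < ε) {y μ : ℝ} (hy : 1 ≤ y) :
    ∫ v in Ioi (1 : ℝ), windowFun δ ε (v / y) * v ^ μ =
      ∫ v in Ioc y (y * ((1 + ε) * (1 + δ))), windowFun δ ε (v / y) * v ^ μ := by
  have hy0 : 0 < y := by linarith
  refine setIntegral_eq_of_subset_of_forall_sdiff_eq_zero measurableSet_Ioi
    (fun v hv => lt_of_le_of_lt hy hv.1) (fun v hv => ?_)
  have : v ≤ y ∨ y * ((1 + ε) * (1 + δ)) < v := by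
    by_contra h; push Not at h; exact hv.2 h
  rcases this with h | h
  · rw [windowFun_of_le_one hδ hε ((div_le_one hy0).2 h), zero_mul]
  · rw [windowFun_of_ge hδ hε (by rw [le_div_iff₀ hy0]; linarith), zero_mul]

lemma abs_setIntegral_windowFun_le {δ ε : ℝ} (hδ : 0 < δ) (hε : 0 < ε) {y μ : ℝ} (hy : 1 ≤ y)
    (hμ : 0 ≤ μ) :
    |∫ v in Ioi (1 : ℝ), windowFun δ ε (v / y) * v ^ (-μ - 1)| ≤
      y ^ (-μ) * (((1 + ε) * (1 + δ)) ^ (1 / 2 : ℝ) * ((1 + ε) * (1 + δ) - 1)) := by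
  have hy0 : 0 < y := by linarith
  set Q := (1 + ε) * (1 + δ) with hQ
  have hQ1 : 1 ≤ Q := by nlinarith
  rw [setIntegral_windowFun_eq hδ hε hy, ← Real.norm_eq_abs]
  refine (norm_setIntegral_le_of_norm_le_const (C := Q ^ (1 / 2 : ℝ) * y ^ (-μ - 1)) (by simp) ?_).trans ?_
  · intro v hv
    have hv0 : 0 < v := lt_trans hy0 hv.1
    rw [norm_mul, Real.norm_eq_abs, Real.norm_of_nonneg (by positivity)]
    refine mul_le_mul (abs_windowFun_le hδ hε (by positivity)) ?_ (by positivity) (by positivity)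
    exact Real.rpow_le_rpow_of_nonpos hy0 hv.1.le (by linarith)
  · rw [← hQ, Real.volume_real_Ioc_of_le (by nlinarith), Real.rpow_sub_one hy0.ne']
    apply le_of_eq
    field_simp

lemma setIntegral_windowFun_half {δ ε : ℝ} (hδ : 0 < δ) (hε : 0 < ε) {y : ℝ} (hy : 1 ≤ y) :
    ∫ v in Ioi (1 : ℝ), windowFun δ ε (v / y) * v ^ (-(-1 / 2 : ℝ) - 1) =
      y ^ (1 / 2 : ℝ) * (δ * (1 + ε / 2)) := by
  have hy0 : 0 < y := by linarith
  have h1 : ∫ v in Ioi (1 : ℝ), windowFun δ ε (v / y) * v ^ (-(-1 / 2 : ℝ) - 1) =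
      ∫ v in Ioi (0 : ℝ), windowFun δ ε (v / y) * v ^ (-(-1 / 2 : ℝ) - 1) := by
    symm
    refine setIntegral_eq_of_subset_of_forall_sdiff_eq_zero measurableSet_Ioi
      (Ioi_subset_Ioi zero_le_one) (fun v hv => ?_)
    have : v ≤ 1 := by simpa using hv.2
    rw [windowFun_of_le_one hδ hε ((div_le_one hy0).2 (this.trans hy)), zero_mul]
  have h2 := integral_comp_mul_left_Ioi (fun v => windowFun δ ε (v / y) * v ^ (-(-1 / 2 : ℝ) - 1)) 0 hy0
  rw [mul_zero] at h2
  have h3 : ∫ v in Ioi (0 : ℝ), windowFun δ ε (v / y) * v ^ (-(-1 / 2 : ℝ) - 1) =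
      y * ∫ v in Ioi (0 : ℝ), windowFun δ ε (y * v / y) * (y * v) ^ (-(-1 / 2 : ℝ) - 1) := by
    rw [h2, smul_eq_mul]; field_simp
  have h4 : ∀ v ∈ Ioi (0 : ℝ), windowFun δ ε (y * v / y) * (y * v) ^ (-(-1 / 2 : ℝ) - 1) =
      y ^ (-1 / 2 : ℝ) * (windowFun δ ε v * v ^ (-1 / 2 : ℝ)) := by
    intro v hv
    have hv0 : (0 : ℝ) < v := hv
    rw [mul_div_cancel_left₀ _ hy0.ne', Real.mul_rpow hy0.le hv0.le]
    norm_num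
    ring
  have h5 : ∫ v in Ioi (0 : ℝ), windowFun δ ε v * v ^ (-1 / 2 : ℝ) = δ * (1 + ε / 2) := by
    have := windowMellin_half (δ := δ) (ε := ε) hδ hε
    rw [windowMellin, mellin] at this
    have h6 : ∀ v ∈ Ioi (0 : ℝ), (v : ℂ) ^ ((1 / 2 : ℂ) - 1) • (windowFun δ ε v : ℂ) =
        ((windowFun δ ε v * v ^ (-1 / 2 : ℝ) : ℝ) : ℂ) := by
      intro v hv
      rw [Complex.ofReal_mul, Complex.ofReal_cpow (le_of_lt hv), smul_eq_mul, mul_comm]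
      norm_num
    rw [setIntegral_congr_fun measurableSet_Ioi h6, integral_complex_ofReal] at this
    exact_mod_cast this
  rw [h1, h3, setIntegral_congr_fun measurableSet_Ioi h4, integral_const_mul, h5, ← mul_assoc]
  congr 1
  rw [← Real.rpow_one_add' hy0.le (by norm_num)]
  norm_num

lemma add_ne_zero_of_re {s : ℂ} (hs : 0 < s.re) {u : ℝ} (hu : 0 ≤ u) : (u : ℂ) + s ≠ 0 := by
  intro h; have := congrArg Complex.re h; simp at this; linarith

/-- `s / (u (u + s))` is `O(u^{-3/2})` on the right half plane. -/
lemma norm_frullani_le {s : ℂ} (hs : 0 < s.re) {u : ℝ} (hu : 0 < u) :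
    ‖s / (u * (u + s))‖ ≤ ‖s‖ ^ (1 / 2 : ℝ) * u ^ (-(3 / 2) : ℝ) := by
  have hs0 : 0 < ‖s‖ := norm_pos_iff.2 (fun h => by simp [h] at hs)
  have h1 : (‖s‖ * u) ≤ ‖(u : ℂ) + s‖ ^ 2 := by
    have e1 : ‖(u : ℂ) + s‖ ^ 2 = u ^ 2 + 2 * u * s.re + ‖s‖ ^ 2 := by
      rw [Complex.sq_norm, Complex.sq_norm, Complex.normSq_apply, Complex.normSq_apply]
      simp; ring
    rw [e1]
    nlinarith [sq_nonneg (‖s‖ - u), mul_pos hu hs]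
  have h2 : ‖s‖ ^ (1 / 2 : ℝ) * u ^ (1 / 2 : ℝ) ≤ ‖(u : ℂ) + s‖ := by
    rw [← Real.mul_rpow hs0.le hu.le, ← Real.sqrt_eq_rpow]
    exact Real.sqrt_le_iff.2 ⟨norm_nonneg _, h1⟩
  have h3 : 0 < ‖(u : ℂ) + s‖ := norm_pos_iff.2 (add_ne_zero_of_re hs hu.le)
  rw [norm_div, norm_mul, Complex.norm_real, Real.norm_of_nonneg hu.le, div_le_iff₀ (by positivity)]
  have e2 : ‖s‖ = ‖s‖ ^ (1 / 2 : ℝ) * ‖s‖ ^ (1 / 2 : ℝ) := by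
    rw [← Real.rpow_add hs0]; norm_num
  have e3 : u ^ (-(3 / 2) : ℝ) * u = u ^ (-(1 / 2) : ℝ) := by
    rw [← Real.rpow_add_one hu.ne']; norm_num
  have e4 : u ^ (-(1 / 2) : ℝ) * u ^ (1 / 2 : ℝ) = 1 := by
    rw [← Real.rpow_add hu]; norm_num
  calc ‖s‖ = ‖s‖ ^ (1 / 2 : ℝ) * ‖s‖ ^ (1 / 2 : ℝ) := e2
    _ = ‖s‖ ^ (1 / 2 : ℝ) * u ^ (-(1 / 2) : ℝ) * (‖s‖ ^ (1 / 2 : ℝ) * u ^ (1 / 2 : ℝ)) := by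
      linear_combination (-(‖s‖ ^ (1 / 2 : ℝ) * ‖s‖ ^ (1 / 2 : ℝ))) * e4
    _ ≤ ‖s‖ ^ (1 / 2 : ℝ) * u ^ (-(1 / 2) : ℝ) * ‖(u : ℂ) + s‖ := by gcongr
    _ = _ := by rw [← e3]; ring

lemma integral_frullani {s : ℂ} (hs : 0 < s.re) :
    ∫ u in Ioi (4 : ℝ), s / (u * (u + s)) = Complex.log (4 + s) - Complex.log 4 := by
  have hderiv : ∀ u ∈ Ici (4 : ℝ), HasDerivAt (fun u : ℝ => -Complex.log (1 + s / u))
      (s / (u * (u + s))) u := by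
    intro u hu
    have hu0 : (0 : ℝ) < u := lt_of_lt_of_le (by norm_num) hu
    have huc : (u : ℂ) ≠ 0 := by exact_mod_cast hu0.ne'
    have hne := add_ne_zero_of_re hs hu0.le
    have h1 : HasDerivAt (fun u : ℝ => 1 + s / (u : ℂ)) (-s / (u : ℂ) ^ 2) u := by
      have := ((hasDerivAt_inv huc).const_mul s).comp_ofReal
      simpa [div_eq_mul_inv] using this.const_add 1
    have hslit : 1 + s / (u : ℂ) ∈ Complex.slitPlane := by
      left
      rw [Complex.add_re, Complex.div_ofReal_re, Complex.one_re]
      positivity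
    have h2 := (h1.clog_real hslit).neg
    refine h2.congr_deriv ?_
    have : 1 + s / (u : ℂ) = (u + s) / u := by field_simp
    rw [this]
    field_simp
  have hlim : Tendsto (fun u : ℝ => -Complex.log (1 + s / u)) atTop (𝓝 0) := by
    have h1 : Tendsto (fun u : ℝ => s / (u : ℂ)) atTop (𝓝 0) := by
      have := (tendsto_inv_atTop_zero (𝕜 := ℝ)).ofReal.const_mul s
      simpa [div_eq_mul_inv] using this
    have h2 := (h1.const_add 1).clog (by simp)
    simpa using h2.neg
  have hint : IntegrableOn (fun u : ℝ => s / (u * (u + s))) (Ioi 4) := by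
    have h1 : IntegrableOn (fun u : ℝ => ‖s‖ ^ (1 / 2 : ℝ) * u ^ (-(3 / 2) : ℝ)) (Ioi 4) :=
      (integrableOn_Ioi_rpow_of_lt (by norm_num) (by norm_num)).const_mul _
    refine h1.mono' (Measurable.aestronglyMeasurable (by fun_prop)) ?_
    filter_upwards [ae_restrict_mem measurableSet_Ioi] with u hu
    exact norm_frullani_le hs (lt_trans (by norm_num) hu)
  rw [integral_Ioi_of_hasDerivAt_of_tendsto' hderiv hint hlim]
  have h4 : (4 : ℂ) + s = (4 : ℝ) * (1 + s / 4) := by push_cast; ring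
  have h5 : 1 + s / 4 ≠ 0 := by
    intro h; have := congrArg Complex.re h
    rw [Complex.add_re, show (4 : ℂ) = ((4 : ℝ) : ℂ) by norm_num, Complex.div_ofReal_re] at this
    simp at this; linarith
  rw [h4, Complex.log_ofReal_mul (by norm_num) h5]
  simp

lemma integrable_one_add_norm_vertical {σ : ℝ} (r : ℝ) (hr : 1 < r) :
    Integrable (fun t : ℝ => (1 + ‖(σ + t * Complex.I : ℂ)‖) ^ (-r)) := by
  have h : Integrable (fun t : ℝ => (1 + ‖t‖) ^ (-r)) :=
    integrable_one_add_norm (by simpa using hr)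
  refine h.mono' (Measurable.aestronglyMeasurable (by fun_prop)) (Eventually.of_forall fun t => ?_)
  rw [Real.norm_of_nonneg (by positivity)]
  refine Real.rpow_le_rpow_of_nonpos (by positivity) ?_ (by linarith)
  have := Complex.abs_im_le_norm (σ + t * Complex.I)
  simp at this
  simpa using this

/-- The part of the explicit formula coming from the Gamma factor is small. -/
lemma norm_integral_log_mul_le {δ ε : ℝ} (hδ : 0 < δ) (hε : 0 < ε) {y σ : ℝ} (hy : 3 / 2 ≤ y)
    (hσ : 2 ≤ σ) :
    Integrable (fun t : ℝ => Complex.log (4 + (σ + t * Complex.I)) *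
      (windowMellin δ ε (σ + t * Complex.I) * (y : ℂ) ^ (σ + t * Complex.I))) ∧
    ‖∫ t : ℝ, Complex.log (4 + (σ + t * Complex.I)) *
      (windowMellin δ ε (σ + t * Complex.I) * (y : ℂ) ^ (σ + t * Complex.I))‖ ≤
      2 * Real.pi * (16 / 27 *
        (((1 + ε) * (1 + δ)) ^ (1 / 2 : ℝ) * ((1 + ε) * (1 + δ) - 1))) := by
  have hy0 : 0 < y := by linarith
  set Q := (1 + ε) * (1 + δ) with hQ
  have hQ1 : 0 ≤ Q - 1 := by nlinarith
  have hQ0 : 0 < Q := by linarith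
  set G : ℝ → ℂ := fun t => windowMellin δ ε (σ + t * Complex.I) * (y : ℂ) ^ (σ + t * Complex.I)
    with hG
  have hGi : Integrable G := integrable_windowMellin_cpow hδ hε hy0 (by linarith)
  have hre : ∀ t : ℝ, (σ + t * Complex.I : ℂ).re = σ := fun t => by simp
  have hre0 : ∀ t : ℝ, 0 < (σ + t * Complex.I : ℂ).re := fun t => by rw [hre]; linarith
  obtain ⟨C, hC0, hC⟩ := norm_windowMellin_le_of_re_nonneg hδ hε σ
  set F : ℝ → ℝ → ℂ := fun u t => (σ + t * Complex.I) / (u * (u + (σ + t * Complex.I))) * G t with hF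
  have hint : Integrable (Function.uncurry F) ((volume.restrict (Ioi (4 : ℝ))).prod volume) := by
    have h1 : Integrable (fun u : ℝ => u ^ (-(3 / 2) : ℝ)) (volume.restrict (Ioi 4)) :=
      (integrableOn_Ioi_rpow_of_lt (by norm_num) (by norm_num))
    have h2 := ((integrable_one_add_norm_vertical (σ := σ) (3 / 2) (by norm_num)).const_mul C).mul_const (y ^ σ)
    refine (h1.mul_prod h2).mono' ?_ ?_
    · refine AEStronglyMeasurable.mul (Measurable.aestronglyMeasurable (by fun_prop)) ?_
      exact hGi.aestronglyMeasurable.comp_snd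
    · have : ∀ᵐ v ∂(volume.restrict (Ioi (4 : ℝ))), 4 < v := ae_restrict_mem measurableSet_Ioi
      have h2 : ∀ᵐ z ∂((volume.restrict (Ioi (4 : ℝ))).prod (volume : Measure ℝ)), 4 < z.1 :=
        Measure.quasiMeasurePreserving_fst.ae this
      filter_upwards [h2] with z hz
      have hz0 : 0 < z.1 := by linarith
      simp only [Function.uncurry, hF, hG]
      rw [norm_mul, norm_mul, Complex.norm_cpow_eq_rpow_re_of_pos hy0, hre]
      have b1 := norm_frullani_le (hre0 z.2) hz0
      have b2 := hC (σ + z.2 * Complex.I) (hre0 _).le (hre _).le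
      set s : ℂ := σ + z.2 * Complex.I
      have hs1 : 0 < 1 + ‖s‖ := by positivity
      have b3 : ‖s‖ ^ (1 / 2 : ℝ) ≤ (1 + ‖s‖) ^ (1 / 2 : ℝ) :=
        Real.rpow_le_rpow (norm_nonneg _) (by linarith) (by norm_num)
      have e1 : (1 + ‖s‖) ^ (1 / 2 : ℝ) * (1 + ‖s‖) ^ (-2 : ℝ) = (1 + ‖s‖) ^ (-(3 / 2) : ℝ) := by
        rw [← Real.rpow_add hs1]; norm_num
      calc _ ≤ ‖s‖ ^ (1 / 2 : ℝ) * z.1 ^ (-(3 / 2) : ℝ) * (C * (1 + ‖s‖) ^ (-2 : ℝ) * y ^ σ) := by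
            gcongr
        _ ≤ (1 + ‖s‖) ^ (1 / 2 : ℝ) * z.1 ^ (-(3 / 2) : ℝ) * (C * (1 + ‖s‖) ^ (-2 : ℝ) * y ^ σ) := by
            gcongr
        _ = z.1 ^ (-(3 / 2) : ℝ) * (C * ((1 + ‖s‖) ^ (1 / 2 : ℝ) * (1 + ‖s‖) ^ (-2 : ℝ)) * y ^ σ) := by
            ring
        _ = _ := by rw [e1]
  have hGval : ∫ t, G t = 0 := by
    have h1 := integral_windowMellin_mul_cpow hδ hε (x := 1 / y) (σ := σ) (by positivity) (by linarith)
    rw [windowFun_of_le_one hδ hε (by rw [div_le_one hy0]; linarith)] at h1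
    rw [Complex.ofReal_zero, mul_zero] at h1
    rw [← h1]
    refine integral_congr_ae (Eventually.of_forall fun t => ?_)
    simp only [hG]
    rw [one_div, Complex.ofReal_inv, Complex.inv_cpow, Complex.cpow_neg, inv_inv]
    rw [Complex.arg_ofReal_of_nonneg hy0.le]; exact Real.pi_ne_zero.symm
  have hinner : ∀ t : ℝ, ∫ u in Ioi (4 : ℝ), F u t =
      Complex.log (4 + (σ + t * Complex.I)) * G t - Complex.log 4 * G t := by
    intro t
    simp only [hF]
    rw [integral_mul_const, integral_frullani (hre0 t)]
    ring
  have hDi : Integrable (fun t : ℝ => Complex.log (4 + (σ + t * Complex.I)) * G t - Complex.log 4 * G t) := by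
    have := hint.swap.integral_prod_left
    refine this.congr (Eventually.of_forall fun t => ?_)
    exact hinner t
  have hLi : Integrable (fun t : ℝ => Complex.log (4 + (σ + t * Complex.I)) * G t) := by
    refine (hDi.add (hGi.const_mul (Complex.log 4))).congr (Eventually.of_forall fun t => ?_)
    simp
  refine ⟨hLi, ?_⟩
  have hval : ∫ t : ℝ, Complex.log (4 + (σ + t * Complex.I)) * G t = ∫ t, ∫ u in Ioi (4 : ℝ), F u t := by
    simp_rw [hinner]
    rw [integral_sub hLi (hGi.const_mul _), integral_const_mul, hGval]
    simp
  have hsw := integral_integral_swap hint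
  change ‖∫ t : ℝ, Complex.log (4 + (σ + t * Complex.I)) * G t‖ ≤ _
  rw [hval, ← hsw]
  have hb : ∀ u ∈ Ioi (4 : ℝ), ‖∫ t, F u t‖ ≤
      2 * Real.pi * (Q ^ (1 / 2 : ℝ) * (Q - 1)) * Real.exp (-Real.log y * u) := by
    intro u hu
    have hu4 : (4 : ℝ) < u := hu
    have hu0 : (0 : ℝ) < u := by linarith
    have huc : (u : ℂ) ≠ 0 := by exact_mod_cast hu0.ne'
    have e : ∀ t, F u t = (1 / u : ℂ) * G t - 1 / (σ + t * Complex.I + u) * G t := by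
      intro t
      simp only [hF]
      have := add_ne_zero_of_re (hre0 t) hu0.le
      have h2 : (σ + t * Complex.I + u : ℂ) ≠ 0 := by rwa [add_comm]
      rw [← sub_mul]
      congr 1
      field_simp
      ring
    have hKi : Integrable (fun t : ℝ => 1 / (σ + t * Complex.I + u : ℂ) * G t) := by
      refine (hGi.norm).mono' (hGi.aestronglyMeasurable.const_mul 1 |>.mul
        (Measurable.aestronglyMeasurable (f := fun t : ℝ => 1 / (σ + t * Complex.I + u : ℂ)) (by fun_prop)) |>.congr
        (Eventually.of_forall fun t => by simp; ring)) (Eventually.of_forall fun t => ?_)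
      rw [norm_mul]
      refine mul_le_of_le_one_left (norm_nonneg _) ?_
      rw [norm_div, norm_one]
      have : σ + u ≤ ‖(σ + t * Complex.I + u : ℂ)‖ := by
        refine le_trans (le_of_eq ?_) (Complex.re_le_norm _)
        simp
      rw [div_le_one (by linarith)]
      linarith
    simp_rw [e]
    rw [integral_sub (hGi.const_mul _) hKi, integral_const_mul, hGval, mul_zero, zero_sub, norm_neg,
      integral_inv_add_mul hδ hε hy0 hσ (by linarith), norm_mul, Complex.norm_real, norm_mul,
      Complex.norm_real, Real.norm_of_nonneg Real.pi_pos.le, Complex.norm_ofNat, Real.norm_eq_abs]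
    have := abs_setIntegral_windowFun_le hδ hε (y := y) (μ := u) (by linarith) hu0.le
    rw [Real.rpow_def_of_pos hy0, ← hQ, mul_neg, ← neg_mul] at this
    calc _ ≤ 2 * Real.pi * _ := mul_le_mul_of_nonneg_left this (by positivity)
      _ = _ := by ring
  have hlog : 1 / 3 ≤ Real.log y := by
    have h1 := Real.one_sub_inv_le_log_of_pos hy0
    have h2 : y⁻¹ ≤ 2 / 3 := by rw [inv_le_comm₀ hy0 (by norm_num)]; norm_num; linarith
    linarith
  refine (norm_integral_le_of_norm_le ((integrableOn_exp_mul_Ioi (by linarith : -Real.log y < 0) 4).const_mul _)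
    ((ae_restrict_iff' measurableSet_Ioi).2 (Eventually.of_forall hb))).trans ?_
  rw [integral_const_mul, integral_exp_mul_Ioi (by linarith)]
  have h5 : Real.exp (-Real.log y * 4) = (y ^ 4)⁻¹ := by
    rw [show -Real.log y * 4 = -(Real.log (y ^ 4)) by rw [Real.log_pow]; push_cast; ring,
      Real.exp_neg, Real.exp_log (by positivity)]
  have h6 : (y ^ 4)⁻¹ ≤ 16 / 81 := by
    rw [inv_le_comm₀ (by positivity) (by norm_num)]
    calc ((16 / 81 : ℝ))⁻¹ = (3 / 2) ^ 4 := by norm_num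
      _ ≤ y ^ 4 := by gcongr
  rw [h5, neg_div_neg_eq, mul_assoc (2 * Real.pi)]
  refine mul_le_mul_of_nonneg_left ?_ (by positivity)
  rw [mul_comm]
  refine mul_le_mul_of_nonneg_right ?_ (by positivity)
  rw [div_le_iff₀ (by linarith)]
  linarith

lemma integral_add_sub_add_const_mul {f₁ f₂ f₃ f₄ : ℝ → ℂ} (h₁ : Integrable f₁) (h₂ : Integrable f₂)
    (h₃ : Integrable f₃) (h₄ : Integrable f₄) (c : ℂ) :
    ∫ t, (f₁ t + f₂ t - f₃ t + c * f₄ t) =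
      (∫ t, f₁ t) + (∫ t, f₂ t) - (∫ t, f₃ t) + c * ∫ t, f₄ t := by
  have h12 : Integrable (fun t => f₁ t + f₂ t) := h₁.add h₂
  have h123 : Integrable (fun t => f₁ t + f₂ t - f₃ t) := h12.sub h₃
  rw [integral_add h123 (h₄.const_mul c), integral_sub h12 h₃, integral_add h₁ h₂,
    integral_const_mul]

/-- Smoothed count of prime powers in `(y, (1 + δ) y]`, minus its expected value. -/
noncomputable def smoothError (δ ε y : ℝ) : ℝ :=
  y ^ (1 / 2 : ℝ) * (δ * (1 + ε / 2)) -
    ∑' n : ℕ, Λ n * (n : ℝ) ^ (-(1 / 2) : ℝ) * windowFun δ ε (n / y)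

lemma explicit_formula {δ ε : ℝ} (hδ : 0 < δ) (hε : 0 < ε) (hQ2 : (1 + ε) * (1 + δ) ≤ 2)
    {y σ : ℝ} (hy : 3 / 2 ≤ y) (hσ : 2 ≤ σ) :
    ‖(∫ t : ℝ, hpFun (σ + t * Complex.I) *
      (windowMellin δ ε (σ + t * Complex.I) * (y : ℂ) ^ (σ + t * Complex.I))) -
      2 * Real.pi * (smoothError δ ε y : ℝ)‖ ≤ 2 * Real.pi * (2 * ((1 + ε) * (1 + δ) - 1)) := by
  have hy0 : 0 < y := by linarith
  obtain ⟨hMi, hM⟩ := integral_mangoldtSeries_mul hδ hε hy0 hσ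
  obtain ⟨hLi, hL⟩ := norm_integral_log_mul_le hδ hε hy hσ
  have hP1 := integral_inv_add_mul hδ hε hy0 hσ (μ := 1 / 2) (by norm_num)
  have hP2 := integral_inv_add_mul hδ hε hy0 hσ (μ := -1 / 2) (by norm_num)
  rw [setIntegral_windowFun_half hδ hε (by linarith)] at hP2
  have hb1 := abs_setIntegral_windowFun_le hδ hε (y := y) (μ := 1 / 2) (by linarith) (by norm_num)
  have hGi : Integrable (fun t : ℝ => windowMellin δ ε (σ + t * Complex.I) * (y : ℂ) ^ (σ + t * Complex.I)) :=
    integrable_windowMellin_cpow hδ hε hy0 (by linarith)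
  have hPi : ∀ μ : ℝ, -1 / 2 ≤ μ → Integrable (fun t : ℝ => 1 / (σ + t * Complex.I + μ : ℂ) *
      (windowMellin δ ε (σ + t * Complex.I) * (y : ℂ) ^ (σ + t * Complex.I))) := by
    intro μ hμ
    refine (hGi.norm).mono' ((Measurable.aestronglyMeasurable (f := fun t : ℝ =>
      1 / (σ + t * Complex.I + μ : ℂ)) (by fun_prop)).mul hGi.aestronglyMeasurable)
      (Eventually.of_forall fun t => ?_)
    rw [norm_mul]
    refine mul_le_of_le_one_left (norm_nonneg _) ?_
    rw [norm_div, norm_one]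
    have : σ + μ ≤ ‖(σ + t * Complex.I + μ : ℂ)‖ := by
      refine le_trans (le_of_eq ?_) (Complex.re_le_norm _)
      simp
    rw [div_le_one (by linarith)]
    linarith
  set Q := (1 + ε) * (1 + δ) with hQ
  have hQ1 : 0 ≤ Q - 1 := by nlinarith
  set I1 : ℝ := ∫ v in Ioi (1 : ℝ), windowFun δ ε (v / y) * v ^ (-(1 / 2 : ℝ) - 1) with hI1
  set IL : ℂ := ∫ t : ℝ, Complex.log (4 + (σ + t * Complex.I)) *
      (windowMellin δ ε (σ + t * Complex.I) * (y : ℂ) ^ (σ + t * Complex.I)) with hIL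
  have hdecomp : ∀ t : ℝ, hpFun (σ + t * Complex.I) *
      (windowMellin δ ε (σ + t * Complex.I) * (y : ℂ) ^ (σ + t * Complex.I)) =
      1 / (σ + t * Complex.I + (1 / 2 : ℝ) : ℂ) *
      (windowMellin δ ε (σ + t * Complex.I) * (y : ℂ) ^ (σ + t * Complex.I)) +
      1 / (σ + t * Complex.I + (-1 / 2 : ℝ) : ℂ) *
      (windowMellin δ ε (σ + t * Complex.I) * (y : ℂ) ^ (σ + t * Complex.I)) -
      mangoldtSeries (1 / 2 + (σ + t * Complex.I)) *
      (windowMellin δ ε (σ + t * Complex.I) * (y : ℂ) ^ (σ + t * Complex.I)) +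
      1 / 2 * (Complex.log (4 + (σ + t * Complex.I)) *
      (windowMellin δ ε (σ + t * Complex.I) * (y : ℂ) ^ (σ + t * Complex.I))) := by
    intro t
    rw [hpFun_eq (by simp; linarith)]
    push_cast
    rw [show ((-1 : ℂ) / 2) = -(1 / 2) by ring, ← sub_eq_add_neg]
    ring
  have hval : ∫ t : ℝ, hpFun (σ + t * Complex.I) *
      (windowMellin δ ε (σ + t * Complex.I) * (y : ℂ) ^ (σ + t * Complex.I)) =
      2 * Real.pi * I1 + 2 * Real.pi * (smoothError δ ε y : ℝ) + 1 / 2 * IL := by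
    simp_rw [hdecomp]
    rw [integral_add_sub_add_const_mul (hPi (1 / 2) (by norm_num)) (hPi (-1 / 2) (by norm_num)) hMi hLi,
      hP1, hP2, hM, smoothError]
    push_cast
    ring
  rw [hval, show 2 * (Real.pi : ℂ) * I1 + 2 * Real.pi * (smoothError δ ε y : ℝ) + 1 / 2 * IL -
    2 * Real.pi * (smoothError δ ε y : ℝ) = 2 * Real.pi * I1 + 1 / 2 * IL by ring]
  have hy1 : y ^ (-(1 / 2) : ℝ) ≤ 1 :=
    Real.rpow_le_one_of_one_le_of_nonpos (by linarith) (by norm_num)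
  have hsq : Q ^ (1 / 2 : ℝ) ≤ 3 / 2 := by
    rw [← Real.sqrt_eq_rpow, Real.sqrt_le_left (by norm_num)]
    linarith
  have hsq0 : 0 ≤ Q ^ (1 / 2 : ℝ) := Real.rpow_nonneg (by linarith) _
  have hb2 : |I1| ≤ 3 / 2 * (Q - 1) := by
    refine hb1.trans ?_
    calc _ ≤ 1 * (Q ^ (1 / 2 : ℝ) * (Q - 1)) := by gcongr
      _ ≤ _ := by rw [one_mul]; gcongr
  have hL2 : ‖IL‖ ≤ 2 * Real.pi * (8 / 9 * (Q - 1)) := by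
    refine hL.trans (mul_le_mul_of_nonneg_left ?_ (by positivity))
    nlinarith
  have hn1 : ‖2 * (Real.pi : ℂ) * I1‖ = 2 * Real.pi * |I1| := by
    rw [norm_mul, norm_mul, Complex.norm_real, Complex.norm_real, Real.norm_of_nonneg Real.pi_pos.le,
      Complex.norm_ofNat, Real.norm_eq_abs]
  have hn2 : ‖(1 / 2 : ℂ) * IL‖ = 1 / 2 * ‖IL‖ := by
    rw [norm_mul]; norm_num
  refine (norm_add_le _ _).trans ?_
  rw [hn1, hn2]
  have h3 : 2 * Real.pi * |I1| ≤ 2 * Real.pi * (3 / 2 * (Q - 1)) :=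
    mul_le_mul_of_nonneg_left hb2 (by positivity)
  nlinarith [mul_nonneg Real.pi_pos.le hQ1]

lemma differentiable_windowMellin {δ ε : ℝ} (hδ : 0 < δ) (hε : 0 < ε) :
    Differentiable ℂ (windowMellin δ ε) := fun s => (windowMellin_convergent hδ hε s).2

lemma differentiable_ofReal_cpow {y : ℝ} (hy : 0 < y) : Differentiable ℂ (fun z : ℂ => (y : ℂ) ^ z) :=
  fun _ => differentiableAt_id.const_cpow (Or.inl (by exact_mod_cast hy.ne'))

lemma rpow_half_mul_rpow_neg_two {a : ℝ} (ha : 0 < a) :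
    a ^ (1 / 2 : ℝ) * a ^ (-2 : ℝ) = a ^ (-(3 / 2) : ℝ) := by
  rw [← Real.rpow_add ha]; norm_num

lemma shift_bound (hRH : RiemannHypothesis) {δ ε h b y : ℝ} (hδ : 0 < δ) (hε : 0 < ε) (hh : 0 < h)
    (hy : 1 ≤ y) : ∃ C, ∀ z : ℂ, h ≤ z.re → z.re ≤ b →
      ‖hpFun z * (windowMellin δ ε z * (y : ℂ) ^ z)‖ ≤ C * (1 + ‖z‖) ^ (-(3 / 2) : ℝ) := by
  obtain ⟨C₁, hC₁, h₁⟩ := norm_hpFun_le hRH hh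
  obtain ⟨C₂, hC₂, h₂⟩ := norm_windowMellin_le_of_re_nonneg hδ hε b
  refine ⟨C₁ * C₂ * y ^ b, fun z hz hzb => ?_⟩
  have hpos : 0 < 1 + ‖z‖ := by positivity
  rw [norm_mul, norm_mul, Complex.norm_cpow_eq_rpow_re_of_pos (by linarith)]
  have h3 : y ^ z.re ≤ y ^ b := Real.rpow_le_rpow_of_exponent_le hy hzb
  calc _ ≤ C₁ * (1 + ‖z‖) ^ (1 / 2 : ℝ) * (C₂ * (1 + ‖z‖) ^ (-2 : ℝ) * y ^ b) := by
        gcongr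
        · exact h₁ z hz
        · exact h₂ z (by linarith) hzb
    _ = C₁ * C₂ * y ^ b * ((1 + ‖z‖) ^ (1 / 2 : ℝ) * (1 + ‖z‖) ^ (-2 : ℝ)) := by ring
    _ = _ := by rw [rpow_half_mul_rpow_neg_two hpos]

lemma integral_shift (hRH : RiemannHypothesis) {δ ε h b y : ℝ} (hδ : 0 < δ) (hε : 0 < ε) (hh : 0 < h)
    (hhb : h ≤ b) (hy : 1 ≤ y) :
    Integrable (fun t : ℝ => hpFun (h + t * Complex.I) *
      (windowMellin δ ε (h + t * Complex.I) * (y : ℂ) ^ (h + t * Complex.I))) ∧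
    ∫ t : ℝ, hpFun (h + t * Complex.I) *
      (windowMellin δ ε (h + t * Complex.I) * (y : ℂ) ^ (h + t * Complex.I)) =
    ∫ t : ℝ, hpFun (b + t * Complex.I) *
      (windowMellin δ ε (b + t * Complex.I) * (y : ℂ) ^ (b + t * Complex.I)) := by
  have hd : ∀ z : ℂ, h ≤ z.re →
      DifferentiableAt ℂ (fun z => hpFun z * (windowMellin δ ε z * (y : ℂ) ^ z)) z := fun z hz =>
    (differentiableAt_hpFun hRH (by linarith)).mul
      ((differentiable_windowMellin hδ hε z).mul (differentiable_ofReal_cpow (by linarith) z))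
  obtain ⟨C, hC⟩ := shift_bound hRH (b := b) hδ hε hh hy
  exact ⟨integrable_vertical le_rfl hd (fun z hz => hC z hz.ge (hz.le.trans hhb)),
    integral_vertical_eq hhb hd hC⟩

lemma differentiableAt_reflect (hRH : RiemannHypothesis) {δ ε h y : ℝ} (hδ : 0 < δ) (hε : 0 < ε)
    (hy : 0 < y) {z : ℂ} (hz : 0 < z.re) : DifferentiableAt ℂ
      (fun z : ℂ => hpFun z * (windowMellin δ ε (2 * h - z) * (y : ℂ) ^ (2 * h - z))) z := by
  have h1 : DifferentiableAt ℂ (fun z : ℂ => 2 * (h : ℂ) - z) z := by fun_prop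
  have h2 : DifferentiableAt ℂ (fun z : ℂ => windowMellin δ ε (2 * h - z)) z :=
    (differentiable_windowMellin hδ hε (2 * h - z)).comp z h1
  have h3 : DifferentiableAt ℂ (fun z : ℂ => (y : ℂ) ^ (2 * h - z)) z :=
    (differentiable_ofReal_cpow hy (2 * h - z)).comp z h1
  exact (differentiableAt_hpFun hRH hz).mul (h2.mul h3)

lemma reflect_bound (hRH : RiemannHypothesis) {δ ε h y : ℝ} (hδ : 0 < δ) (hε : 0 < ε) (hh : 0 < h)
    (hy : 1 ≤ y) : ∃ C, ∀ z : ℂ, h ≤ z.re →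
      ‖hpFun z * (windowMellin δ ε (2 * h - z) * (y : ℂ) ^ (2 * h - z))‖ ≤
        C * (1 + ‖z‖) ^ (-(3 / 2) : ℝ) := by
  obtain ⟨C₁, hC₁, h₁⟩ := norm_hpFun_le hRH hh
  obtain ⟨C₂, hC₂, h₂⟩ := norm_windowMellin_le hδ hε h
  refine exists_decay_bound (R := 4 * h + 8) (C := C₁ * (C₂ * 16) * y ^ (2 * h)) ?_ ?_
  · intro z hz
    have hz' : h ≤ z.re := hz
    exact (differentiableAt_reflect hRH hδ hε (by linarith) (by linarith)).continuousAt.continuousWithinAt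
  · intro z hz hzR
    have hpos : 0 < 1 + ‖z‖ := by positivity
    have key : ∀ c : ℝ, 0 ≤ c → c ≤ 2 → (1 + ‖z‖) / 4 ≤ ‖2 * (h : ℂ) - z + c‖ := by
      intro c hc hc2
      have h1 : ‖z‖ ≤ ‖2 * (h : ℂ) - z + c‖ + ‖((2 * h + c : ℝ) : ℂ)‖ := by
        calc ‖z‖ = ‖-(2 * (h : ℂ) - z + c) + ((2 * h + c : ℝ) : ℂ)‖ := by
              congr 1; push_cast; ring
          _ ≤ _ := by rw [← norm_neg (2 * (h : ℂ) - z + c)]; exact norm_add_le _ _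
      rw [Complex.norm_real, Real.norm_of_nonneg (by positivity)] at h1
      linarith
    have k1 := key (1 / 2) (by norm_num) (by norm_num)
    have k2 := key (3 / 2) (by norm_num) (by norm_num)
    push_cast at k1 k2
    have m1 : 0 < (1 + ‖z‖) / 4 := by positivity
    have hw := h₂ (2 * h - z) (norm_pos_iff.1 (m1.trans_le k1)) (norm_pos_iff.1 (m1.trans_le k2))
      (by simp; linarith)
    have hw2 : ‖windowMellin δ ε (2 * h - z)‖ ≤ C₂ * 16 * (1 + ‖z‖) ^ (-2 : ℝ) := by
      refine hw.trans ?_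
      calc _ ≤ C₂ / ((1 + ‖z‖) / 4 * ((1 + ‖z‖) / 4)) := by gcongr
        _ = _ := by
          rw [Real.rpow_neg hpos.le, show (2 : ℝ) = (2 : ℕ) by norm_num, Real.rpow_natCast]
          field_simp
          norm_num
    rw [norm_mul, norm_mul, Complex.norm_cpow_eq_rpow_re_of_pos (by linarith)]
    have h3 : y ^ (2 * h - z : ℂ).re ≤ y ^ (2 * h) :=
      Real.rpow_le_rpow_of_exponent_le hy (by simp; linarith)
    calc _ ≤ C₁ * (1 + ‖z‖) ^ (1 / 2 : ℝ) * (C₂ * 16 * (1 + ‖z‖) ^ (-2 : ℝ) * y ^ (2 * h)) := by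
          gcongr
          exact h₁ z hz
      _ = C₁ * (C₂ * 16) * y ^ (2 * h) * ((1 + ‖z‖) ^ (1 / 2 : ℝ) * (1 + ‖z‖) ^ (-2 : ℝ)) := by ring
      _ = _ := by rw [rpow_half_mul_rpow_neg_two hpos]

lemma integral_conj_hpFun_mul (hRH : RiemannHypothesis) {δ ε h y : ℝ} (hδ : 0 < δ) (hε : 0 < ε)
    (hh : 0 < h) (hy : 1 ≤ y) :
    Integrable (fun t : ℝ => (starRingEnd ℂ) (hpFun (h + t * Complex.I)) *
      (windowMellin δ ε (h + t * Complex.I) * (y : ℂ) ^ (h + t * Complex.I))) ∧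
    ∫ t : ℝ, (starRingEnd ℂ) (hpFun (h + t * Complex.I)) *
      (windowMellin δ ε (h + t * Complex.I) * (y : ℂ) ^ (h + t * Complex.I)) = 0 := by
  set Φ : ℂ → ℂ := fun z => hpFun z * (windowMellin δ ε (2 * h - z) * (y : ℂ) ^ (2 * h - z)) with hΦ
  have hd : ∀ z : ℂ, h ≤ z.re → DifferentiableAt ℂ Φ z := fun z hz =>
    differentiableAt_reflect hRH hδ hε (by linarith) (by linarith)
  obtain ⟨C, hC⟩ := reflect_bound hRH (δ := δ) (ε := ε) hδ hε hh hy
  have h1 := integrable_vertical (b := h) le_rfl hd (fun z hz => hC z hz.ge)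
  have h2 := integral_vertical_eq_zero hh hd hC
  have e : ∀ t : ℝ, (starRingEnd ℂ) (hpFun (h + t * Complex.I)) *
      (windowMellin δ ε (h + t * Complex.I) * (y : ℂ) ^ (h + t * Complex.I)) =
      Φ (h + (-t : ℝ) * Complex.I) := by
    intro t
    simp only [hΦ]
    rw [← hpFun_conj (by simpa using hh)]
    have e1 : (starRingEnd ℂ) (h + t * Complex.I : ℂ) = h + (-t : ℝ) * Complex.I := by
      simp
    have e2 : (2 * h - (h + (-t : ℝ) * Complex.I) : ℂ) = h + t * Complex.I := by
      push_cast; ring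
    rw [e1, e2]
  simp_rw [e]
  exact ⟨h1.comp_neg, by rw [integral_neg_eq_self (fun t : ℝ => Φ (h + t * Complex.I)), h2]⟩

/-- The (Poisson-type) density `Re P(h + it) / π`. -/
noncomputable def hpDensity (h t : ℝ) : ℝ := (hpFun (h + t * Complex.I)).re / Real.pi

lemma integral_windowMellin_mul_hpDensity (hRH : RiemannHypothesis) {δ ε h y : ℝ} (hδ : 0 < δ)
    (hε : 0 < ε) (hh : 0 < h) (hh2 : h ≤ 2) (hy : 1 ≤ y) :
    2 * Real.pi * ((y : ℂ) ^ (h : ℂ) * ∫ t : ℝ, windowMellin δ ε (h + t * Complex.I) * hpDensity h t *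
      (y : ℂ) ^ (t * Complex.I)) =
    ∫ t : ℝ, hpFun ((2 : ℝ) + t * Complex.I) * (windowMellin δ ε ((2 : ℝ) + t * Complex.I) *
      (y : ℂ) ^ ((2 : ℝ) + t * Complex.I)) := by
  obtain ⟨i1, e1⟩ := integral_shift hRH (b := 2) hδ hε hh hh2 hy
  obtain ⟨i2, e2⟩ := integral_conj_hpFun_mul hRH hδ hε hh hy
  have hy0 : (y : ℂ) ≠ 0 := by exact_mod_cast (by linarith : y ≠ 0)
  rw [← e1, ← add_zero (∫ t : ℝ, hpFun (h + t * Complex.I) * _), ← e2, ← integral_add i1 i2,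
    ← integral_const_mul, ← integral_const_mul]
  refine integral_congr_ae (Eventually.of_forall fun t => ?_)
  simp only
  rw [← add_mul, Complex.add_conj, hpDensity, Complex.cpow_add _ _ hy0]
  have := Real.pi_ne_zero
  push_cast
  field_simp

lemma abs_smoothError_le (hRH : RiemannHypothesis) {δ ε h y : ℝ} (hδ : 0 < δ)
    (hε : 0 < ε) (hQ2 : (1 + ε) * (1 + δ) ≤ 2) (hh : 0 < h) (hh2 : h ≤ 2) (hy : 3 / 2 ≤ y) :
    |smoothError δ ε y| ≤ y ^ h * ‖∫ t : ℝ, windowMellin δ ε (h + t * Complex.I) * hpDensity h t *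
      (y : ℂ) ^ (t * Complex.I)‖ + 2 * ((1 + ε) * (1 + δ) - 1) := by
  have h1 := explicit_formula hδ hε hQ2 hy le_rfl
  rw [← integral_windowMellin_mul_hpDensity hRH hδ hε hh hh2 (by linarith), ← mul_sub, norm_mul,
    norm_mul, Complex.norm_real, Real.norm_of_nonneg Real.pi_pos.le, Complex.norm_ofNat] at h1
  have h2 := le_of_mul_le_mul_left h1 (by positivity)
  set g := ∫ t : ℝ, windowMellin δ ε (h + t * Complex.I) * hpDensity h t *
      (y : ℂ) ^ (t * Complex.I)
  have h3 : ‖((smoothError δ ε y : ℝ) : ℂ)‖ ≤ ‖(y : ℂ) ^ (h : ℂ) * g‖ +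
      ‖(y : ℂ) ^ (h : ℂ) * g - (smoothError δ ε y : ℝ)‖ := by
    rw [← norm_neg ((y : ℂ) ^ (h : ℂ) * g - _)]
    refine le_trans (le_of_eq ?_) (norm_add_le _ _)
    congr 1; ring
  rw [Complex.norm_real, Real.norm_eq_abs, norm_mul, Complex.norm_cpow_eq_rpow_re_of_pos (by linarith),
    Complex.ofReal_re] at h3
  linarith

lemma continuous_vertical {Φ : ℂ → ℂ} {h : ℝ} (hd : ∀ z : ℂ, z.re = h → DifferentiableAt ℂ Φ z) :
    Continuous (fun t : ℝ => Φ (h + t * Complex.I)) := by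
  refine continuous_iff_continuousAt.2 fun t => ?_
  have h1 : ContinuousAt (fun t : ℝ => (h + t * Complex.I : ℂ)) t := by fun_prop
  exact ContinuousAt.comp (f := fun t : ℝ => (h + t * Complex.I : ℂ)) (x := t) (g := Φ)
    (hd _ (by simp)).continuousAt h1

lemma continuous_hpDensity (hRH : RiemannHypothesis) {h : ℝ} (hh : 0 < h) :
    Continuous (hpDensity h) := by
  have := continuous_vertical (Φ := hpFun) (h := h) (fun z hz => differentiableAt_hpFun hRH (by linarith))
  exact (Complex.continuous_re.comp this).div_const _

lemma hpDensity_nonneg (hRH : RiemannHypothesis) {h : ℝ} (hh : 0 < h) (t : ℝ) : 0 ≤ hpDensity h t :=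
  div_nonneg (hpFun_re_nonneg hRH (by simpa using hh)) Real.pi_pos.le

lemma poisson_hpDensity (hRH : RiemannHypothesis) {h a : ℝ} (hh : 0 < h) (ha : 0 < a) (τ : ℝ) :
    Integrable (fun t : ℝ => hpDensity h t * (a / (a ^ 2 + (t - τ) ^ 2))) ∧
      ∫ t : ℝ, hpDensity h t * (a / (a ^ 2 + (t - τ) ^ 2)) =
        (hpFun ((h + a : ℝ) + τ * Complex.I)).re := by
  obtain ⟨h1, h2⟩ := poisson_hpFun hRH hh ha τ
  have e : ∀ t : ℝ, hpDensity h t * (a / (a ^ 2 + (t - τ) ^ 2)) =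
      Real.pi⁻¹ * ((hpFun (h + t * Complex.I)).re * (a / (a ^ 2 + (t - τ) ^ 2))) := by
    intro t; rw [hpDensity]; ring
  simp_rw [e]
  refine ⟨h1.const_mul _, ?_⟩
  rw [integral_const_mul, h2, inv_mul_cancel_left₀ Real.pi_ne_zero]

lemma mean_square_le (hRH : RiemannHypothesis) {δ ε h x : ℝ} (hδ : 0 < δ) (hε : 0 < ε) (hh : 0 < h)
    (hx : 0 < x) :
    Integrable (fun t : ℝ => ‖windowMellin δ ε (h + t * Complex.I)‖ ^ 2 * hpDensity h t *
        (2 * (hpFun ((h + 2 : ℝ) + t * Complex.I)).re)) ∧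
    IntegrableOn (fun y : ℝ => schurWeight x y * ‖∫ t : ℝ, windowMellin δ ε (h + t * Complex.I) *
      hpDensity h t * (y : ℂ) ^ (t * Complex.I)‖ ^ 2) (Ioi 0) ∧
    ∫ y in Ioi (0 : ℝ), schurWeight x y * ‖∫ t : ℝ, windowMellin δ ε (h + t * Complex.I) *
      hpDensity h t * (y : ℂ) ^ (t * Complex.I)‖ ^ 2 ≤
      x ^ 2 * ∫ t : ℝ, ‖windowMellin δ ε (h + t * Complex.I)‖ ^ 2 * hpDensity h t *
        (2 * (hpFun ((h + 2 : ℝ) + t * Complex.I)).re) := by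
  set m : ℝ → ℂ := fun t => windowMellin δ ε (h + t * Complex.I) with hm
  set B : ℝ → ℝ := fun t => 2 * (hpFun ((h + 2 : ℝ) + t * Complex.I)).re with hB
  have hmc : Continuous m := continuous_vertical fun z _ => differentiable_windowMellin hδ hε z
  have hpc := continuous_hpDensity hRH hh
  have hBc : Continuous B := continuous_const.mul (Complex.continuous_re.comp
    (continuous_vertical (Φ := hpFun) (h := h + 2) (fun z hz => differentiableAt_hpFun hRH (by linarith))))
  obtain ⟨C₁, hC₁, h₁⟩ := norm_hpFun_le hRH hh
  obtain ⟨C₂, hC₂, h₂⟩ := norm_windowMellin_le_of_re_nonneg hδ hε h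
  have hm2 : ∀ t, ‖m t‖ ≤ C₂ * (1 + ‖(h + t * Complex.I : ℂ)‖) ^ (-2 : ℝ) := fun t =>
    h₂ _ (by simpa using hh.le) (by simp)
  have hp2 : ∀ t, hpDensity h t ≤ C₁ * (1 + ‖(h + t * Complex.I : ℂ)‖) ^ (1 / 2 : ℝ) := fun t => by
    have b := h₁ (h + t * Complex.I) (by simp)
    rw [hpDensity, div_le_iff₀ Real.pi_pos]
    have b2 := (Complex.re_le_norm (hpFun (h + t * Complex.I))).trans b
    refine b2.trans (le_mul_of_one_le_right ((norm_nonneg _).trans b) ?_)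
    linarith [Real.pi_gt_three]
  have hB2 : ∀ t, B t ≤ 2 * C₁ * 3 * (1 + ‖(h + t * Complex.I : ℂ)‖) ^ (1 / 2 : ℝ) := fun t => by
    have b := h₁ ((h + 2 : ℝ) + t * Complex.I) (by simp)
    have b2 := (Complex.re_le_norm (hpFun ((h + 2 : ℝ) + t * Complex.I))).trans b
    have e : (((h + 2 : ℝ) + t * Complex.I : ℂ)) = (h + t * Complex.I) + 2 := by push_cast; ring
    have n1 : ‖(((h + 2 : ℝ) + t * Complex.I : ℂ))‖ ≤ ‖(h + t * Complex.I : ℂ)‖ + 2 := by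
      rw [e]; refine (norm_add_le _ _).trans ?_; simp
    have n2 : (1 + ‖(((h + 2 : ℝ) + t * Complex.I : ℂ))‖) ^ (1 / 2 : ℝ) ≤
        3 * (1 + ‖(h + t * Complex.I : ℂ)‖) ^ (1 / 2 : ℝ) := by
      calc _ ≤ (9 * (1 + ‖(h + t * Complex.I : ℂ)‖)) ^ (1 / 2 : ℝ) := by
            refine Real.rpow_le_rpow (by positivity) ?_ (by norm_num)
            linarith [norm_nonneg (h + t * Complex.I : ℂ)]
        _ = _ := by
          rw [Real.mul_rpow (by norm_num) (by positivity), ← Real.sqrt_eq_rpow 9,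
            show (9 : ℝ) = 3 ^ 2 by norm_num, Real.sqrt_sq (by norm_num)]
    simp only [hB]
    nlinarith
  have hp0 := hpDensity_nonneg hRH hh
  have hB0 : ∀ t, 0 ≤ B t := fun t => mul_nonneg (by norm_num)
    (hpFun_re_nonneg hRH (by simp; linarith))
  have hq : Integrable (fun t => m t * hpDensity h t) := by
    refine ((integrable_one_add_norm_vertical (σ := h) (3 / 2) (by norm_num)).const_mul (C₂ * C₁)).mono'
      (hmc.mul (Complex.continuous_ofReal.comp hpc)).aestronglyMeasurable
      (Eventually.of_forall fun t => ?_)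
    rw [norm_mul, Complex.norm_real, Real.norm_of_nonneg (hp0 t),
      ← rpow_half_mul_rpow_neg_two (by positivity)]
    calc _ ≤ C₂ * (1 + ‖(h + t * Complex.I : ℂ)‖) ^ (-2 : ℝ) *
          (C₁ * (1 + ‖(h + t * Complex.I : ℂ)‖) ^ (1 / 2 : ℝ)) := by
          gcongr
          · exact hp0 t
          · exact hm2 t
          · exact hp2 t
      _ = _ := by ring
  have hmB : Integrable (fun t => ‖m t‖ ^ 2 * hpDensity h t * B t) := by
    refine ((integrable_one_add_norm_vertical (σ := h) 3 (by norm_num)).const_mul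
      (C₂ ^ 2 * C₁ * (2 * C₁ * 3))).mono'
      (((hmc.norm.pow 2).mul hpc).mul hBc).aestronglyMeasurable (Eventually.of_forall fun t => ?_)
    have hpos : 0 < 1 + ‖(h + t * Complex.I : ℂ)‖ := by positivity
    rw [Real.norm_of_nonneg (mul_nonneg (mul_nonneg (by positivity) (hp0 t)) (hB0 t))]
    have e1 : ((1 + ‖(h + t * Complex.I : ℂ)‖) ^ (-2 : ℝ)) ^ 2 *
        ((1 + ‖(h + t * Complex.I : ℂ)‖) ^ (1 / 2 : ℝ)) ^ 2 =
        (1 + ‖(h + t * Complex.I : ℂ)‖) ^ (-3 : ℝ) := by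
      rw [← mul_pow, ← Real.rpow_add hpos, ← Real.rpow_natCast, ← Real.rpow_mul hpos.le]
      norm_num
    calc _ ≤ (C₂ * (1 + ‖(h + t * Complex.I : ℂ)‖) ^ (-2 : ℝ)) ^ 2 *
          (C₁ * (1 + ‖(h + t * Complex.I : ℂ)‖) ^ (1 / 2 : ℝ)) *
          (2 * C₁ * 3 * (1 + ‖(h + t * Complex.I : ℂ)‖) ^ (1 / 2 : ℝ)) := by
          gcongr
          · exact hB0 t
          · exact hp0 t
          · exact hm2 t
          · exact hp2 t
          · exact hB2 t
      _ = C₂ ^ 2 * C₁ * (2 * C₁ * 3) * (((1 + ‖(h + t * Complex.I : ℂ)‖) ^ (-2 : ℝ)) ^ 2 *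
        ((1 + ‖(h + t * Complex.I : ℂ)‖) ^ (1 / 2 : ℝ)) ^ 2) := by ring
      _ = _ := by rw [e1]
  have hker : ∀ t u : ℝ, hpDensity h u * (4 / (4 + (u - t) ^ 2)) =
      2 * (hpDensity h u * (2 / (2 ^ 2 + (u - t) ^ 2))) := by
    intro t u; norm_num; ring
  obtain ⟨g1, g2⟩ := integral_schurWeight_le hx hq
  refine ⟨hmB, g1, g2.trans ?_⟩
  refine mul_le_mul_of_nonneg_left ?_ (by positivity)
  refine integral_prod_kernel_le hmc hpc hp0 (fun t => ?_) (fun t => ?_) hmB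
  · simp_rw [hker]; exact (poisson_hpDensity hRH hh two_pos t).1.const_mul 2
  · simp_rw [hker]; rw [integral_const_mul, (poisson_hpDensity hRH hh two_pos t).2]

lemma sin_sq_mul_one_add_sq_le (v : ℝ) : Real.sin v ^ 2 * (1 + v ^ 2) ≤ 1.9 * v ^ 2 := by
  rcases le_or_gt (10 / 9) (v ^ 2) with h | h
  · nlinarith [Real.sin_sq_le_one v, sq_nonneg v, Real.sin_sq_le_one v]
  have hv : |v| ≤ Real.pi := by
    refine le_trans (b := 2) (abs_le.2 (abs_le_of_sq_le_sq' (by linarith) (by norm_num))) ?_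
    linarith [Real.pi_gt_three]
  have h1 := Real.cos_le_one_sub_mul_cos_sq hv
  have h2 : Real.sin v = 2 * Real.sin (v / 2) * Real.cos (v / 2) := by
    rw [← Real.sin_two_mul]; ring_nf
  have h3 : Real.sin (v / 2) ^ 2 ≤ (v / 2) ^ 2 := Real.sin_sq_le_sq
  have h4 : Real.cos (v / 2) ^ 2 = 1 / 2 + Real.cos v / 2 := by
    rw [Real.cos_sq]; ring_nf
  have h5 : 2 / Real.pi ^ 2 ≥ 1 / 5 := by
    rw [ge_iff_le, div_le_div_iff₀ (by norm_num) (by positivity)]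
    nlinarith [Real.pi_lt_d2, Real.pi_pos]
  have h6 : Real.cos (v / 2) ^ 2 ≤ 1 - v ^ 2 / 10 := by
    rw [h4]; nlinarith [sq_nonneg v]
  have h7 : Real.sin v ^ 2 ≤ v ^ 2 * (1 - v ^ 2 / 10) := by
    rw [h2, mul_pow, mul_pow]
    calc _ ≤ 2 ^ 2 * (v / 2) ^ 2 * (1 - v ^ 2 / 10) := by gcongr
      _ = _ := by ring
  have h8 : (1 - v ^ 2 / 10) * (1 + v ^ 2) ≤ 1.9 := by nlinarith [sq_nonneg v]
  calc _ ≤ v ^ 2 * (1 - v ^ 2 / 10) * (1 + v ^ 2) := by gcongr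
    _ = v ^ 2 * ((1 - v ^ 2 / 10) * (1 + v ^ 2)) := by ring
    _ ≤ v ^ 2 * 1.9 := by gcongr
    _ = _ := by ring

lemma norm_exp_sub_one_sq (a θ : ℝ) : ‖Complex.exp (a + θ * Complex.I) - 1‖ ^ 2 =
    (Real.exp a - 1) ^ 2 + 4 * Real.exp a * Real.sin (θ / 2) ^ 2 := by
  have h1 : Real.cos θ = 1 - 2 * Real.sin (θ / 2) ^ 2 := by
    have := Real.cos_sq' (θ / 2)
    have h2 := Real.cos_two_mul (θ / 2)
    rw [mul_div_cancel₀ θ two_ne_zero] at h2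
    linarith
  rw [Complex.sq_norm, Complex.normSq_apply, Complex.sub_re, Complex.sub_im, Complex.exp_re,
    Complex.exp_im]
  simp only [Complex.add_re, Complex.ofReal_re, Complex.mul_re, Complex.I_re, mul_zero,
    Complex.ofReal_im, Complex.I_im, mul_one, sub_self, add_zero, Complex.add_im, Complex.mul_im,
    zero_add, Complex.one_re, Complex.one_im, sub_zero]
  have h3 := Real.sin_sq_add_cos_sq θ
  linear_combination (Real.exp a) ^ 2 * h3 - 2 * Real.exp a * h1

lemma norm_cpow_sub_one_sq_le {δ σ t : ℝ} (hδ : 0 < δ) (hδ1 : δ ≤ 1 / 1000) (hσ : 0 ≤ σ) (hσ1 : σ ≤ 1) :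
    ‖((1 + δ : ℝ) : ℂ) ^ (σ + t * Complex.I) - 1‖ ^ 2 * ((2 / Real.log (1 + δ)) ^ 2 + t ^ 2) ≤
      7.64 * (σ ^ 2 + t ^ 2) := by
  set η := Real.log (1 + δ) with hη
  have hη0 : 0 < η := Real.log_pos (by linarith)
  have hη1 : η ≤ 1 / 1000 := by
    have := Real.log_le_sub_one_of_pos (by linarith : 0 < 1 + δ); linarith
  have e1 : ((1 + δ : ℝ) : ℂ) ^ (σ + t * Complex.I) =
      Complex.exp ((η * σ : ℝ) + (η * t : ℝ) * Complex.I) := by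
    rw [Complex.cpow_def_of_ne_zero (by exact_mod_cast (by linarith : (1 + δ) ≠ 0)),
      ← Complex.ofReal_log (by linarith)]
    congr 1; push_cast; ring
  rw [e1, norm_exp_sub_one_sq]
  set a := η * σ with ha
  have ha0 : 0 ≤ a := by positivity
  have ha1 : a ≤ 1 / 1000 := by nlinarith
  have h1 := abs_le.1 (Real.abs_exp_sub_one_sub_id_le (x := a) (by rw [abs_of_nonneg ha0]; linarith))
  have h2 : Real.exp a - 1 ≤ 1.01 * a := by nlinarith
  have h3 : 0 ≤ Real.exp a - 1 := by linarith [Real.add_one_le_exp a]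
  have h4 := sin_sq_mul_one_add_sq_le (η * t / 2)
  have h5 : (Real.exp a - 1) ^ 2 ≤ (1.01 * a) ^ 2 := by gcongr
  set v := η * t / 2 with hv
  have hb : (2 / η) ^ 2 + t ^ 2 = (2 / η) ^ 2 * (1 + v ^ 2) := by rw [hv]; field_simp
  have hbv : (2 / η) ^ 2 * v ^ 2 = t ^ 2 := by rw [hv]; field_simp
  have hba : (2 / η) ^ 2 * a ^ 2 = 4 * σ ^ 2 := by rw [ha]; field_simp; ring
  have p1 : (Real.exp a - 1) ^ 2 * ((2 / η) ^ 2 + t ^ 2) ≤ 4.1 * σ ^ 2 + 0.001 * t ^ 2 := by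
    calc _ ≤ (1.01 * a) ^ 2 * ((2 / η) ^ 2 + t ^ 2) := by gcongr
      _ = 1.01 ^ 2 * ((2 / η) ^ 2 * a ^ 2) + (1.01 * a) ^ 2 * t ^ 2 := by ring
      _ ≤ 4.1 * σ ^ 2 + 0.001 * t ^ 2 := by
        rw [hba]
        have : (1.01 * a) ^ 2 ≤ 0.001 := by nlinarith
        nlinarith [sq_nonneg σ, sq_nonneg t]
  have p2 : 4 * Real.exp a * Real.sin v ^ 2 * ((2 / η) ^ 2 + t ^ 2) ≤ 7.62 * t ^ 2 := by
    rw [hb]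
    calc _ = 4 * Real.exp a * (2 / η) ^ 2 * (Real.sin v ^ 2 * (1 + v ^ 2)) := by ring
      _ ≤ 4 * Real.exp a * (2 / η) ^ 2 * (1.9 * v ^ 2) := by gcongr
      _ = 7.6 * Real.exp a * ((2 / η) ^ 2 * v ^ 2) := by ring
      _ ≤ 7.62 * t ^ 2 := by
        rw [hbv]
        have : 7.6 * Real.exp a ≤ 7.62 := by linarith
        gcongr
  rw [add_mul]
  nlinarith [sq_nonneg σ, sq_nonneg t]

lemma norm_cpow_sub_one_div_le {ε : ℝ} (hε : 0 < ε) {w : ℂ} (hw0 : 0 ≤ w.re) (hw1 : w.re ≤ 1) :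
    ‖(((1 + ε : ℝ) : ℂ) ^ (w + 1) - 1) / (ε * (w + 1))‖ ≤ 1 + ε := by
  have h1 : ∫ u in (1 : ℝ)..(1 + ε), (u : ℂ) ^ w = (((1 + ε : ℝ) : ℂ) ^ (w + 1) - 1) / (w + 1) := by
    rw [integral_cpow (Or.inl (by linarith)), Complex.ofReal_one, Complex.one_cpow]
  rw [mul_comm (ε : ℂ), ← div_div, ← h1, norm_div, Complex.norm_real, Real.norm_of_nonneg hε.le,
    div_le_iff₀ hε]
  have h2 := intervalIntegral.norm_integral_le_of_norm_le_const (a := 1) (b := 1 + ε)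
    (f := fun u : ℝ => (u : ℂ) ^ w) (C := 1 + ε) (fun u hu => ?_)
  · rwa [add_sub_cancel_left, abs_of_pos hε] at h2
  · rw [uIoc_of_le (by linarith)] at hu
    rw [Complex.norm_cpow_eq_rpow_re_of_pos (by linarith [hu.1])]
    calc u ^ w.re ≤ u ^ (1 : ℝ) := Real.rpow_le_rpow_of_exponent_le hu.1.le hw1
      _ = u := Real.rpow_one u
      _ ≤ _ := hu.2

lemma norm_windowMellin_sq_le {δ ε h : ℝ} (hδ : 0 < δ) (hδ1 : δ ≤ 1 / 1000) (hε : 0 < ε) (hh : 0 < h)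
    (hh1 : h ≤ 1 / 2) (t : ℝ) : ‖windowMellin δ ε (h + t * Complex.I)‖ ^ 2 ≤
      (1 + ε) ^ 2 * 7.64 / ((2 / Real.log (1 + δ)) ^ 2 + t ^ 2) := by
  have hη0 : 0 < Real.log (1 + δ) := Real.log_pos (by linarith)
  set w : ℂ := (h + 1 / 2 : ℝ) + t * Complex.I with hw
  have hwre : w.re = h + 1 / 2 := by simp [hw]
  have e1 : (h + t * Complex.I : ℂ) + 1 / 2 = w := by rw [hw]; push_cast; ring
  have e2 : (h + t * Complex.I : ℂ) + 3 / 2 = w + 1 := by rw [hw]; push_cast; ring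
  have hw0 : w ≠ 0 := fun h0 => by rw [h0] at hwre; simp at hwre; linarith
  have hw1 : w + 1 ≠ 0 := fun h0 => by
    have := congrArg Complex.re h0; rw [Complex.add_re, hwre] at this; simp at this; linarith
  rw [windowMellin_eq hδ hε (by rwa [e1]) (by rwa [e2]), e1, e2, norm_mul, mul_pow, norm_div, div_pow]
  have b1 := norm_cpow_sub_one_div_le hε (w := w) (by rw [hwre]; linarith) (by rw [hwre]; linarith)
  have b2 := norm_cpow_sub_one_sq_le (t := t) hδ hδ1 (σ := h + 1 / 2) (by linarith) (by linarith)
  have hwn : ‖w‖ ^ 2 = (h + 1 / 2) ^ 2 + t ^ 2 := by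
    rw [Complex.sq_norm, Complex.normSq_apply, hwre]
    simp [hw]; ring
  have hwp : 0 < ‖w‖ := norm_pos_iff.2 hw0
  rw [← hwn, ← hw] at b2
  have b3 : ‖((1 + δ : ℝ) : ℂ) ^ w - 1‖ ^ 2 / ‖w‖ ^ 2 ≤ 7.64 / ((2 / Real.log (1 + δ)) ^ 2 + t ^ 2) := by
    rw [div_le_div_iff₀ (by positivity) (by positivity)]
    exact b2
  calc _ ≤ 7.64 / ((2 / Real.log (1 + δ)) ^ 2 + t ^ 2) * (1 + ε) ^ 2 := by gcongr
    _ = _ := by ring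

lemma hpFun_ofReal_add_re_le {h a : ℝ} (hh : 0 < h) (hh1 : h ≤ 1 / 2) (ha : 1000 ≤ a) :
    (hpFun ((h + a : ℝ) : ℂ)).re ≤ Real.log a / 2 + 0.005 := by
  refine (hpFun_ofReal_re_le (by linarith)).trans ?_
  have h1 : Real.log (4 + (h + a)) ≤ Real.log a + 4.5 / 1000 := by
    have e : 4 + (h + a) = a * (1 + (4 + h) / a) := by field_simp; ring
    rw [e, Real.log_mul (by positivity) (by positivity)]
    have h2 := Real.log_le_sub_one_of_pos (x := 1 + (4 + h) / a) (by positivity)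
    have h3 : (4 + h) / a ≤ 4.5 / 1000 := by gcongr; linarith
    linarith
  have h4 : 1 / (h + a + 1 / 2) ≤ 1 / 1000 := by gcongr; linarith
  have h5 : 1 / (h + a - 1 / 2) ≤ 1 / 900 := by gcongr; linarith
  linarith

lemma poisson_hpDensity_zero (hRH : RiemannHypothesis) {h a : ℝ} (hh : 0 < h) (ha : 0 < a) :
    Integrable (fun t : ℝ => hpDensity h t * (a / (a ^ 2 + t ^ 2))) ∧
      ∫ t : ℝ, hpDensity h t * (a / (a ^ 2 + t ^ 2)) = (hpFun ((h + a : ℝ) : ℂ)).re := by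
  have := poisson_hpDensity hRH hh ha 0
  simpa using this

lemma sq_mul_integral_kernel {b : ℝ} (hb : 0 < b) (t : ℝ) :
    t ^ 2 * ∫ u in Ioc (0 : ℝ) 1, 2 * u / (b ^ 2 + u ^ 2 * t ^ 2) = Real.log (1 + t ^ 2 / b ^ 2) := by
  rw [← integral_const_mul, ← intervalIntegral.integral_of_le zero_le_one]
  have hpos : ∀ u : ℝ, 0 < b ^ 2 + u ^ 2 * t ^ 2 := fun u => by positivity
  have hd : ∀ u ∈ uIcc (0 : ℝ) 1, HasDerivAt (fun u : ℝ => Real.log (b ^ 2 + u ^ 2 * t ^ 2))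
      (t ^ 2 * (2 * u / (b ^ 2 + u ^ 2 * t ^ 2))) u := by
    intro u _
    have h1 : HasDerivAt (fun u : ℝ => b ^ 2 + u ^ 2 * t ^ 2) (2 * u * t ^ 2) u := by
      simpa using (((hasDerivAt_id u).pow 2).mul_const (t ^ 2)).const_add (b ^ 2)
    refine (h1.log (hpos u).ne').congr_deriv ?_
    ring
  rw [intervalIntegral.integral_eq_sub_of_hasDerivAt hd]
  · rw [← Real.log_div (hpos 1).ne' (hpos 0).ne']
    congr 1
    field_simp
    ring
  · refine Continuous.intervalIntegrable ?_ _ _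
    exact continuous_const.mul (Continuous.div (by fun_prop) (by fun_prop) fun u => (hpos u).ne')

lemma log_div_le_integral_kernel {b : ℝ} (hb : 0 < b) (t : ℝ) :
    Real.log (1 + t ^ 2 / b ^ 2) / (b ^ 2 + t ^ 2) ≤
      ∫ u in Ioc (0 : ℝ) 1, 2 * u / (b ^ 2 + u ^ 2 * t ^ 2) := by
  rw [div_le_iff₀ (by positivity), ← sq_mul_integral_kernel hb, mul_comm]
  refine mul_le_mul_of_nonneg_left (by nlinarith) (setIntegral_nonneg measurableSet_Ioc fun u hu => ?_)
  have := hu.1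
  positivity

lemma integral_log_mul_hpDensity_le (hRH : RiemannHypothesis) {h b : ℝ} (hh : 0 < h)
    (hh1 : h ≤ 1 / 2) (hb : 1000 ≤ b) :
    Integrable (fun t : ℝ => hpDensity h t * (Real.log (1 + t ^ 2 / b ^ 2) / (b ^ 2 + t ^ 2))) ∧
    ∫ t : ℝ, hpDensity h t * (Real.log (1 + t ^ 2 / b ^ 2) / (b ^ 2 + t ^ 2)) ≤
      1 / b * (Real.log b + 1.01) := by
  have hb0 : 0 < b := by linarith
  have hpc := continuous_hpDensity hRH hh
  have hp0 := hpDensity_nonneg hRH hh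
  set F : ℝ → ℝ → ℝ := fun u t => hpDensity h t * (2 * u / (b ^ 2 + u ^ 2 * t ^ 2)) with hF
  have hFc : Continuous (Function.uncurry F) := by
    refine (hpc.comp continuous_snd).mul (Continuous.div (by fun_prop) (by fun_prop) fun z => ?_)
    positivity
  have hF0 : ∀ u ∈ Ioc (0 : ℝ) 1, ∀ t, 0 ≤ F u t := fun u hu t =>
    mul_nonneg (hp0 t) (by have := hu.1; positivity)
  have hFe : ∀ u ∈ Ioc (0 : ℝ) 1, ∀ t, F u t =
      2 / b * (hpDensity h t * ((b / u) / ((b / u) ^ 2 + t ^ 2))) := by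
    intro u hu t
    have hu0 := hu.1
    simp only [hF]
    field_simp
  have hFi : ∀ u ∈ Ioc (0 : ℝ) 1, Integrable (F u) := fun u hu => by
    rw [funext (hFe u hu)]
    exact (poisson_hpDensity_zero hRH hh (div_pos hb0 hu.1)).1.const_mul _
  have hFv : ∀ u ∈ Ioc (0 : ℝ) 1, ∫ t, F u t ≤ 1 / b * (Real.log b - Real.log u + 0.01) := fun u hu => by
    simp_rw [hFe u hu]
    rw [integral_const_mul, (poisson_hpDensity_zero hRH hh (div_pos hb0 hu.1)).2,
      ← Real.log_div hb0.ne' hu.1.ne']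
    have : b ≤ b / u := le_div_self hb0.le hu.1 hu.2
    have := hpFun_ofReal_add_re_le hh hh1 (a := b / u) (by linarith)
    calc _ ≤ 2 / b * (Real.log (b / u) / 2 + 0.005) := by gcongr
      _ = _ := by ring
  have hgi : Integrable (fun u : ℝ => 1 / b * (Real.log b - Real.log u + 0.01))
      (volume.restrict (Ioc (0 : ℝ) 1)) := by
    have h1 : IntervalIntegrable Real.log volume 0 1 := intervalIntegral.intervalIntegrable_log'
    have h2 : Integrable Real.log (volume.restrict (Ioc (0 : ℝ) 1)) :=
      (intervalIntegrable_iff_integrableOn_Ioc_of_le zero_le_one).1 h1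
    exact (((integrable_const _).sub h2).add (integrable_const _)).const_mul _
  have hgv : ∫ u in Ioc (0 : ℝ) 1, 1 / b * (Real.log b - Real.log u + 0.01) =
      1 / b * (Real.log b + 1.01) := by
    rw [← intervalIntegral.integral_of_le zero_le_one, intervalIntegral.integral_const_mul,
      intervalIntegral.integral_add (by simp [intervalIntegral.intervalIntegrable_log'])
        (by simp), intervalIntegral.integral_sub (by simp) intervalIntegral.intervalIntegrable_log',
      integral_log]
    simp
    left; norm_num; ring
  have hmeas : AEStronglyMeasurable (Function.uncurry F)
      ((volume.restrict (Ioc (0 : ℝ) 1)).prod volume) := hFc.aestronglyMeasurable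
  have hmem : ∀ᵐ u ∂(volume.restrict (Ioc (0 : ℝ) 1)), u ∈ Ioc (0 : ℝ) 1 :=
    ae_restrict_mem measurableSet_Ioc
  have hint : Integrable (Function.uncurry F) ((volume.restrict (Ioc (0 : ℝ) 1)).prod volume) := by
    refine (integrable_prod_iff hmeas).2 ⟨?_, ?_⟩
    · filter_upwards [hmem] with u hu using hFi u hu
    · refine hgi.mono' hmeas.norm.integral_prod_right' ?_
      filter_upwards [hmem] with u hu
      rw [Real.norm_of_nonneg (integral_nonneg fun t => norm_nonneg _)]
      refine le_trans (le_of_eq ?_) (hFv u hu)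
      exact integral_congr_ae (Eventually.of_forall fun t => Real.norm_of_nonneg (hF0 u hu t))
  have hsw := integral_integral_swap hint
  have hpt : ∀ t, hpDensity h t * (Real.log (1 + t ^ 2 / b ^ 2) / (b ^ 2 + t ^ 2)) ≤
      ∫ u in Ioc (0 : ℝ) 1, F u t := fun t => by
    simp only [hF]
    rw [integral_const_mul]
    exact mul_le_mul_of_nonneg_left (log_div_le_integral_kernel hb0 t) (hp0 t)
  have hi2 : Integrable (fun t => ∫ u in Ioc (0 : ℝ) 1, F u t) := hint.integral_prod_right
  have hi1 : Integrable (fun t : ℝ => hpDensity h t * (Real.log (1 + t ^ 2 / b ^ 2) / (b ^ 2 + t ^ 2))) := by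
    refine hi2.mono' ?_ (Eventually.of_forall fun t => ?_)
    · refine (hpc.mul (Continuous.div (Continuous.log (by fun_prop) fun t => ?_) (by fun_prop)
        fun t => ?_)).aestronglyMeasurable <;> positivity
    · rw [Real.norm_of_nonneg]
      · exact hpt t
      · have : 0 ≤ Real.log (1 + t ^ 2 / b ^ 2) := Real.log_nonneg (by
          have : 0 ≤ t ^ 2 / b ^ 2 := by positivity
          linarith)
        exact mul_nonneg (hp0 t) (by positivity)
  refine ⟨hi1, ?_⟩
  calc _ ≤ ∫ t, ∫ u in Ioc (0 : ℝ) 1, F u t := integral_mono hi1 hi2 hpt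
    _ = ∫ u in Ioc (0 : ℝ) 1, ∫ t, F u t := hsw.symm
    _ ≤ ∫ u in Ioc (0 : ℝ) 1, 1 / b * (Real.log b - Real.log u + 0.01) := by
      refine integral_mono_ae hint.integral_prod_left hgi ?_
      filter_upwards [hmem] with u hu using hFv u hu
    _ = _ := hgv

lemma two_mul_hpFun_re_le {h b : ℝ} (hh : 0 < h) (hh1 : h ≤ 1 / 2) (hb : 1000 ≤ b) (t : ℝ) :
    2 * (hpFun ((h + 2 : ℝ) + t * Complex.I)).re ≤
      (Real.log b + 3.424) + 1 / 2 * Real.log (1 + t ^ 2 / b ^ 2) := by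
  have h1 := hpFun_re_le (s := (h + 2 : ℝ) + t * Complex.I) (by simp; linarith)
  set z : ℂ := 4 + ((h + 2 : ℝ) + t * Complex.I) with hz
  have hzre : z.re = 6 + h := by simp [hz]; ring
  have hzim : z.im = t := by simp [hz]
  have hz0 : 0 < ‖z‖ := lt_of_lt_of_le (by rw [hzre]; linarith) (Complex.re_le_norm z)
  have h2 : ‖z‖ ^ 2 ≤ b ^ 2 * (1 + t ^ 2 / b ^ 2) := by
    rw [Complex.sq_norm, Complex.normSq_apply, hzre, hzim]
    have : b ^ 2 * (1 + t ^ 2 / b ^ 2) = b ^ 2 + t ^ 2 := by field_simp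
    rw [this]; nlinarith
  have h3 := Real.log_le_log (by positivity) h2
  rw [Real.log_mul (by positivity) (by positivity), Real.log_pow, Real.log_pow] at h3
  push_cast at h3
  linarith

lemma integral_windowMellin_sq_mul_le (hRH : RiemannHypothesis) {δ ε h : ℝ} (hδ : 0 < δ)
    (hδ1 : δ ≤ 1 / 1000) (hε : 0 < ε) (hh : 0 < h) (hh1 : h ≤ 1 / 2) :
    ∫ t : ℝ, ‖windowMellin δ ε (h + t * Complex.I)‖ ^ 2 * hpDensity h t *
        (2 * (hpFun ((h + 2 : ℝ) + t * Complex.I)).re) ≤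
      (1 + ε) ^ 2 * (1.91 * Real.log (1 + δ) * ((Real.log (2 / Real.log (1 + δ)) + 3.424) *
        (Real.log (2 / Real.log (1 + δ)) + 0.01) + (Real.log (2 / Real.log (1 + δ)) + 1.01))) := by
  have hη0 : 0 < Real.log (1 + δ) := Real.log_pos (by linarith)
  have hη1 : Real.log (1 + δ) ≤ 1 / 1000 := by
    have := Real.log_le_sub_one_of_pos (by linarith : 0 < 1 + δ); linarith
  have hm := norm_windowMellin_sq_le hδ hδ1 hε hh hh1
  set b := 2 / Real.log (1 + δ) with hb
  have hηb : Real.log (1 + δ) = 2 / b := by rw [hb]; field_simp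
  have hb1 : 1000 ≤ b := by rw [hb, le_div_iff₀ hη0]; linarith
  have hb0 : 0 < b := by linarith
  rw [hηb]
  have hp0 := hpDensity_nonneg hRH hh
  obtain ⟨i1, -, -⟩ := mean_square_le hRH hδ hε hh one_pos
  obtain ⟨i2, v2⟩ := integral_log_mul_hpDensity_le hRH hh hh1 hb1
  obtain ⟨i3, v3⟩ := poisson_hpDensity_zero hRH hh hb0
  have hlogb : 0 ≤ Real.log b := Real.log_nonneg (by linarith)
  have hpt : ∀ t : ℝ, ‖windowMellin δ ε (h + t * Complex.I)‖ ^ 2 * hpDensity h t *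
        (2 * (hpFun ((h + 2 : ℝ) + t * Complex.I)).re) ≤
      (1 + ε) ^ 2 * 7.64 * ((Real.log b + 3.424) / b) * (hpDensity h t * (b / (b ^ 2 + t ^ 2))) +
      (1 + ε) ^ 2 * 3.82 * (hpDensity h t * (Real.log (1 + t ^ 2 / b ^ 2) / (b ^ 2 + t ^ 2))) := by
    intro t
    have h0 : 0 ≤ (hpFun ((h + 2 : ℝ) + t * Complex.I)).re := hpFun_re_nonneg hRH (by simp; linarith)
    have hb2 : 0 < b ^ 2 + t ^ 2 := by positivity
    calc _ ≤ (1 + ε) ^ 2 * 7.64 / (b ^ 2 + t ^ 2) * hpDensity h t *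
          ((Real.log b + 3.424) + 1 / 2 * Real.log (1 + t ^ 2 / b ^ 2)) := by
          have := hp0 t
          refine mul_le_mul ?_ (two_mul_hpFun_re_le hh hh1 hb1 t) (by positivity) (by positivity)
          exact mul_le_mul_of_nonneg_right (hm t) this
      _ = _ := by field_simp; ring
  have hs : Integrable (fun t : ℝ => (1 + ε) ^ 2 * 7.64 * ((Real.log b + 3.424) / b) *
      (hpDensity h t * (b / (b ^ 2 + t ^ 2))) + (1 + ε) ^ 2 * 3.82 * (hpDensity h t *
      (Real.log (1 + t ^ 2 / b ^ 2) / (b ^ 2 + t ^ 2)))) :=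
    (i3.const_mul _).add (i2.const_mul _)
  refine (integral_mono i1 hs hpt).trans ?_
  rw [integral_add (i3.const_mul _) (i2.const_mul _), integral_const_mul, integral_const_mul, v3]
  have r := hpFun_ofReal_add_re_le hh hh1 hb1
  calc _ ≤ (1 + ε) ^ 2 * 7.64 * ((Real.log b + 3.424) / b) * (Real.log b / 2 + 0.005) +
        (1 + ε) ^ 2 * 3.82 * (1 / b * (Real.log b + 1.01)) := by gcongr
    _ = _ := by field_simp; ring

lemma smoothError_eq_sum {δ ε x y : ℝ} (hδ : 0 < δ) (hδ1 : δ ≤ 1) (hε : 0 < ε) (hε1 : ε ≤ 1)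
    (hy : 1 ≤ y) (hyx : y ≤ x) :
    smoothError δ ε y = y ^ (1 / 2 : ℝ) * (δ * (1 + ε / 2)) - ∑ n ∈ Finset.range ⌈4 * x⌉₊,
      Λ n * (n : ℝ) ^ (-(1 / 2) : ℝ) * windowFun δ ε (n / y) := by
  rw [smoothError, tsum_eq_sum]
  intro n hn
  have h1 : 4 * x ≤ n := by
    rw [Finset.mem_range, not_lt] at hn
    exact Nat.ceil_le.1 hn
  rw [windowFun_of_ge hδ hε, mul_zero]
  rw [le_div_iff₀ (by linarith)]
  have h2 : (1 + ε) * (1 + δ) ≤ 4 := by nlinarith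
  nlinarith

lemma continuousOn_smoothError {δ ε x : ℝ} (hδ : 0 < δ) (hδ1 : δ ≤ 1) (hε : 0 < ε) (hε1 : ε ≤ 1) :
    ContinuousOn (smoothError δ ε) (Icc 1 x) := by
  refine ContinuousOn.congr ?_ fun y hy => smoothError_eq_sum hδ hδ1 hε hε1 hy.1 hy.2
  refine ContinuousOn.sub ?_ (continuousOn_finsetSum _ fun n _ => ?_)
  · exact ((Real.continuous_rpow_const (by norm_num)).mul continuous_const).continuousOn
  · refine continuousOn_const.mul ((continuous_windowFun δ ε).comp_continuousOn ?_)
    exact continuousOn_const.div continuousOn_id fun y hy => by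
      have := hy.1
      exact (zero_lt_one.trans_le this).ne'

lemma exists_abs_smoothError_le {δ x : ℝ} (hδ : 0 < δ) (hδ1 : δ ≤ 1) :
    ∃ C : ℝ, ∀ ε, 0 < ε → ε ≤ 1 → ∀ y ∈ Icc 1 x, |smoothError δ ε y| ≤ C := by
  refine ⟨x ^ (1 / 2 : ℝ) * (1 * (1 + 1 / 2)) + ∑ n ∈ Finset.range ⌈4 * x⌉₊,
      Λ n * (n : ℝ) ^ (-(1 / 2) : ℝ) * 4 ^ (1 / 2 : ℝ), fun ε hε hε1 y hy => ?_⟩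
  have hy0 : 0 ≤ y := by linarith [hy.1]
  have hx0 : 0 ≤ x := hy0.trans hy.2
  rw [smoothError_eq_sum hδ hδ1 hε hε1 hy.1 hy.2]
  refine (abs_sub _ _).trans (add_le_add ?_ ((Finset.abs_sum_le_sum_abs _ _).trans
    (Finset.sum_le_sum fun n _ => ?_)))
  · rw [abs_of_nonneg (by positivity)]
    have := hy.2
    gcongr
  · have h0 : 0 ≤ Λ n * (n : ℝ) ^ (-(1 / 2) : ℝ) := mul_nonneg vonMangoldt_nonneg (by positivity)
    rw [abs_mul, abs_of_nonneg h0]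
    refine mul_le_mul_of_nonneg_left ((abs_windowFun_le hδ hε (by positivity)).trans ?_) h0
    gcongr
    nlinarith

/-- The error term in the prime number theorem on the short interval `(y, (1 + δ) y]`. -/
noncomputable def shortError (δ y : ℝ) : ℝ :=
  chebyshevPsi ((1 + δ) * y) - chebyshevPsi y - δ * y

lemma monotone_chebyshevPsi : Monotone chebyshevPsi := fun _ _ h =>
  Finset.sum_le_sum_of_subset_of_nonneg (Finset.Iic_subset_Iic.2 (Nat.floor_mono h))
    fun _ _ _ => vonMangoldt_nonneg

lemma chebyshevPsi_eq_sum_range {z : ℝ} {N : ℕ} (hz : 0 ≤ z) (hN : z < N) :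
    chebyshevPsi z = ∑ n ∈ Finset.range N, if (n : ℝ) ≤ z then Λ n else 0 := by
  rw [← Finset.sum_filter, chebyshevPsi]
  congr 1
  ext n
  simp only [Finset.mem_Iic, Finset.mem_filter, Finset.mem_range, Nat.le_floor_iff hz]
  refine ⟨fun h => ⟨?_, h⟩, fun h => h.2⟩
  exact_mod_cast h.trans_lt hN

lemma measurable_shortError (δ : ℝ) : Measurable (shortError δ) := by
  have h := monotone_chebyshevPsi.measurable
  exact ((h.comp (measurable_const.mul measurable_id)).sub h).sub
    (measurable_const.mul measurable_id)

lemma integrableOn_shortError_sq {δ : ℝ} (hδ : 0 < δ) (a b : ℝ) (ha : 0 ≤ a) :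
    IntegrableOn (fun y => shortError δ y ^ 2) (Ioc a b) := by
  have h0 : ∀ z, 0 ≤ chebyshevPsi z := fun z => Finset.sum_nonneg fun _ _ => vonMangoldt_nonneg
  refine Measure.integrableOn_of_bounded (M := (chebyshevPsi ((1 + δ) * b) + δ * b) ^ 2)
    (by simp) ((measurable_shortError δ).pow_const 2).aestronglyMeasurable ?_
  filter_upwards [ae_restrict_mem measurableSet_Ioc] with y hy
  have hy0 : 0 < y := ha.trans_lt hy.1
  rw [Real.norm_eq_abs, abs_of_nonneg (sq_nonneg _)]
  refine sq_le_sq' ?_ ?_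
  · have h1 := h0 ((1 + δ) * b)
    have h2 := monotone_chebyshevPsi (show y ≤ (1 + δ) * y by nlinarith)
    have h3 : δ * y ≤ δ * b := by gcongr; exact hy.2
    unfold shortError; linarith
  · have h1 := h0 y
    have h2 := monotone_chebyshevPsi (show (1 + δ) * y ≤ (1 + δ) * b by
      have := hy.2
      gcongr)
    have h3 : 0 ≤ δ * b := by nlinarith [hy.2]
    have h4 : 0 ≤ δ * y := by positivity
    unfold shortError; linarith

lemma tendsto_smoothError {δ y : ℝ} (hδ : 0 < δ) (hδ1 : δ ≤ 1) (hy : 1 ≤ y) :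
    Tendsto (fun n : ℕ => smoothError δ (1 / ((n : ℝ) + 1)) y) atTop
      (𝓝 (-(y ^ (-(1 / 2) : ℝ) * shortError δ y))) := by
  have hy0 : 0 < y := by linarith
  have hlim : -(y ^ (-(1 / 2) : ℝ) * shortError δ y) = y ^ (1 / 2 : ℝ) * (δ * (1 + 0 / 2)) -
      ∑ n ∈ Finset.range ⌈4 * y⌉₊, Λ n * (n : ℝ) ^ (-(1 / 2) : ℝ) *
        (if 1 < n / y ∧ n / y ≤ 1 + δ then (n / y : ℝ) ^ (1 / 2 : ℝ) else 0) := by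
    have hN : 4 * y ≤ (⌈4 * y⌉₊ : ℝ) := Nat.le_ceil _
    have e1 : y ^ (1 / 2 : ℝ) = y ^ (-(1 / 2) : ℝ) * y := by
      nth_rewrite 3 [← Real.rpow_one y]
      rw [← Real.rpow_add hy0]; norm_num
    have e2 : ∀ n ∈ Finset.range ⌈4 * y⌉₊, Λ n * (n : ℝ) ^ (-(1 / 2) : ℝ) *
        (if 1 < n / y ∧ n / y ≤ 1 + δ then (n / y : ℝ) ^ (1 / 2 : ℝ) else 0) =
        y ^ (-(1 / 2) : ℝ) * ((if (n : ℝ) ≤ (1 + δ) * y then Λ n else 0) -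
          if (n : ℝ) ≤ y then Λ n else 0) := fun n _ => by
      simp only [one_lt_div hy0, div_le_iff₀ hy0]
      by_cases h1 : (n : ℝ) ≤ y
      · have h2 : (n : ℝ) ≤ (1 + δ) * y := by nlinarith
        simp [h1, h2, h1.not_gt]
      · by_cases h2 : (n : ℝ) ≤ (1 + δ) * y
        · have hn : (0 : ℝ) < n := by linarith
          rw [if_pos ⟨not_le.1 h1, h2⟩, if_pos h2, if_neg h1, Real.div_rpow hn.le hy0.le,
            Real.rpow_neg hn.le, Real.rpow_neg hy0.le]
          have := (Real.rpow_pos_of_pos hn (1 / 2)).ne'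
          field_simp
          ring
        · simp [h1, h2]
    rw [Finset.sum_congr rfl e2, ← Finset.mul_sum, Finset.sum_sub_distrib,
      ← chebyshevPsi_eq_sum_range (by positivity) (by nlinarith),
      ← chebyshevPsi_eq_sum_range hy0.le (by linarith), e1, shortError]
    ring
  rw [hlim]
  have hε : Tendsto (fun n : ℕ => 1 / ((n : ℝ) + 1)) atTop (𝓝 0) := tendsto_one_div_add_atTop_nhds_zero_nat
  have key : Tendsto (fun n : ℕ => y ^ (1 / 2 : ℝ) * (δ * (1 + 1 / ((n : ℝ) + 1) / 2)) -
      ∑ k ∈ Finset.range ⌈4 * y⌉₊, Λ k * (k : ℝ) ^ (-(1 / 2) : ℝ) *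
        windowFun δ (1 / ((n : ℝ) + 1)) (k / y)) atTop (𝓝 (y ^ (1 / 2 : ℝ) * (δ * (1 + 0 / 2)) -
      ∑ n ∈ Finset.range ⌈4 * y⌉₊, Λ n * (n : ℝ) ^ (-(1 / 2) : ℝ) *
        (if 1 < n / y ∧ n / y ≤ 1 + δ then (n / y : ℝ) ^ (1 / 2 : ℝ) else 0))) := by
    refine Tendsto.sub (Tendsto.const_mul _ (Tendsto.const_mul _ ((hε.div_const 2).const_add 1)))
      (tendsto_finsetSum _ fun k _ => Tendsto.const_mul _ (tendsto_windowFun hδ))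
  refine key.congr fun n => ?_
  have h1 : (1 : ℝ) / ((n : ℝ) + 1) ≤ 1 := by
    rw [div_le_one (by positivity)]; linarith [Nat.cast_nonneg (α := ℝ) n]
  exact (smoothError_eq_sum hδ hδ1 (by positivity) h1 hy le_rfl).symm

/-- The constant in the mean-square bound, as a function of `η = log (1 + δ)`. -/
noncomputable def meanSquareConst (η : ℝ) : ℝ :=
  1.91 * η * ((Real.log (2 / η) + 3.424) * (Real.log (2 / η) + 0.01) + (Real.log (2 / η) + 1.01))

lemma integral_mul_smoothError_sq_le (hRH : RiemannHypothesis) {δ ε h x : ℝ} (hδ : 0 < δ)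
    (hδ1 : δ ≤ 1 / 1000) (hε : 0 < ε) (hε1 : ε ≤ 1 / 2) (hh : 0 < h) (hh1 : h ≤ 1 / 2)
    (hx : 3 / 2 ≤ x) :
    ∫ y in Ioc (3 / 2) x, y * smoothError δ ε y ^ 2 ≤
      1.01 * x ^ (2 * h) * (x ^ 2 * ((1 + ε) ^ 2 * meanSquareConst (Real.log (1 + δ)))) +
        404 * ((1 + ε) * (1 + δ) - 1) ^ 2 * x ^ 2 := by
  have hx0 : 0 < x := by linarith
  have hQ2 : (1 + ε) * (1 + δ) ≤ 2 := by nlinarith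
  obtain ⟨-, iW, hW⟩ := mean_square_le hRH hδ hε hh hx0
  have hR := integral_windowMellin_sq_mul_le hRH hδ hδ1 hε hh hh1
  set G : ℝ → ℝ := fun y => ‖∫ t : ℝ, windowMellin δ ε (h + t * Complex.I) * hpDensity h t *
    (y : ℂ) ^ (t * Complex.I)‖ with hG
  set q := (1 + ε) * (1 + δ) - 1 with hq
  have hsub : Ioc (3 / 2) x ⊆ Ioi 0 := fun y hy => lt_trans (by norm_num) hy.1
  have iW' : IntegrableOn (fun y => schurWeight x y * G y ^ 2) (Ioc (3 / 2) x) := iW.mono_set hsub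
  have iS : IntegrableOn (fun y => y * smoothError δ ε y ^ 2) (Ioc (3 / 2) x) := by
    have hc := continuousOn_smoothError (x := x) hδ (by linarith) hε (by linarith)
    have : ContinuousOn (fun y => y * smoothError δ ε y ^ 2) (Icc 1 x) :=
      continuousOn_id.mul (hc.pow 2)
    exact this.integrableOn_Icc.mono_set fun y hy => ⟨by linarith [hy.1], hy.2⟩
  have iM : IntegrableOn (fun y => 1.01 * x ^ (2 * h) * (schurWeight x y * G y ^ 2) +
      404 * q ^ 2 * x) (Ioc (3 / 2) x) :=
    (iW'.const_mul _).add (integrableOn_const (by simp))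
  have hpt : ∀ y ∈ Ioc (3 / 2) x, y * smoothError δ ε y ^ 2 ≤
      1.01 * x ^ (2 * h) * (schurWeight x y * G y ^ 2) + 404 * q ^ 2 * x := by
    intro y hy
    have hy0 : 0 < y := hsub hy
    have hS := abs_smoothError_le hRH hδ hε hQ2 hh (by linarith) hy.1.le
    have hS2 : smoothError δ ε y ^ 2 ≤ (y ^ h * G y + 2 * q) ^ 2 := by
      rw [← sq_abs]; gcongr
    have hyh : (y ^ h) ^ 2 ≤ x ^ (2 * h) := by
      rw [← Real.rpow_natCast, ← Real.rpow_mul hy0.le, mul_comm h]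
      exact Real.rpow_le_rpow hy0.le hy.2 (by positivity)
    have hs : schurWeight x y = y := by simp [schurWeight, hy.2]
    rw [hs]
    have h1 : (y ^ h * G y + 2 * q) ^ 2 ≤ 1.01 * (x ^ (2 * h) * G y ^ 2) + 404 * q ^ 2 := by
      have h2 : (y ^ h * G y) ^ 2 ≤ x ^ (2 * h) * G y ^ 2 := by
        rw [mul_pow]; gcongr
      nlinarith [sq_nonneg (y ^ h * G y - 100 * (2 * q))]
    calc _ ≤ y * (1.01 * (x ^ (2 * h) * G y ^ 2) + 404 * q ^ 2) := by
          gcongr; exact hS2.trans h1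
      _ = 1.01 * x ^ (2 * h) * (y * G y ^ 2) + 404 * q ^ 2 * y := by ring
      _ ≤ _ := by gcongr; exact hy.2
  have hnn : ∀ y ∈ Ioi (0 : ℝ), 0 ≤ schurWeight x y * G y ^ 2 := fun y hy =>
    mul_nonneg (schurWeight_nonneg hx0 hy) (sq_nonneg _)
  have hle : ∫ y in Ioc (3 / 2) x, schurWeight x y * G y ^ 2 ≤
      x ^ 2 * ((1 + ε) ^ 2 * meanSquareConst (Real.log (1 + δ))) := by
    refine (setIntegral_mono_set iW ?_ hsub.eventuallyLE).trans (hW.trans ?_)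
    · filter_upwards [ae_restrict_mem measurableSet_Ioi] with y hy using hnn y hy
    · exact mul_le_mul_of_nonneg_left hR (by positivity)
  refine (setIntegral_mono_on iS iM measurableSet_Ioc hpt).trans ?_
  rw [integral_add (iW'.const_mul _) (integrableOn_const (by simp)), integral_const_mul,
    setIntegral_const, Real.volume_real_Ioc_of_le hx, smul_eq_mul]
  refine add_le_add (mul_le_mul_of_nonneg_left hle (by positivity)) ?_
  have : 0 ≤ 404 * q ^ 2 * x := by positivity
  nlinarith

lemma integral_shortError_sq_le (hRH : RiemannHypothesis) {δ x : ℝ} (hδ : 0 < δ)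
    (hδ1 : δ ≤ 1 / 1000) (hx : 3 / 2 ≤ x) :
    ∫ y in Ioc (3 / 2) x, shortError δ y ^ 2 ≤
      1.01 * (x ^ 2 * meanSquareConst (Real.log (1 + δ))) + 404 * δ ^ 2 * x ^ 2 := by
  have hx0 : 0 < x := by linarith
  have hε : Tendsto (fun n : ℕ => 1 / ((n : ℝ) + 1)) atTop (𝓝 0) := tendsto_one_div_add_atTop_nhds_zero_nat
  obtain ⟨C, hC⟩ := exists_abs_smoothError_le (x := x) hδ (by linarith)
  have hε1 : ∀ n : ℕ, (1 : ℝ) / ((n : ℝ) + 1) ≤ 1 := fun n => by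
    rw [div_le_one (by positivity)]; linarith [Nat.cast_nonneg (α := ℝ) n]
  have hL : Tendsto (fun n : ℕ => ∫ y in Ioc (3 / 2) x, y * smoothError δ (1 / ((n : ℝ) + 1)) y ^ 2)
      atTop (𝓝 (∫ y in Ioc (3 / 2) x, shortError δ y ^ 2)) := by
    refine tendsto_integral_of_dominated_convergence (fun _ => x * C ^ 2) (fun n => ?_)
      (integrableOn_const (by simp)) (fun n => ?_) ?_
    · have hc := continuousOn_smoothError (x := x) hδ (by linarith)
        (show (0 : ℝ) < 1 / ((n : ℝ) + 1) by positivity) (hε1 n)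
      have hc' : ContinuousOn (fun y => y * smoothError δ (1 / ((n : ℝ) + 1)) y ^ 2) (Ioc (3 / 2) x) :=
        (continuousOn_id.mul (hc.pow 2)).mono fun y hy => ⟨by linarith [hy.1], hy.2⟩
      exact hc'.aestronglyMeasurable measurableSet_Ioc
    · filter_upwards [ae_restrict_mem measurableSet_Ioc] with y hy
      have hy0 : 0 < y := by linarith [hy.1]
      have h1 := hC _ (show (0 : ℝ) < 1 / ((n : ℝ) + 1) by positivity) (hε1 n) y
        ⟨by linarith [hy.1], hy.2⟩
      rw [Real.norm_eq_abs, abs_of_nonneg (by positivity), ← sq_abs]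
      have := hy.2
      gcongr
    · filter_upwards [ae_restrict_mem measurableSet_Ioc] with y hy
      have hy0 : 0 < y := by linarith [hy.1]
      have h1 := ((tendsto_smoothError hδ (by linarith) (by linarith [hy.1] : 1 ≤ y)).pow 2).const_mul y
      convert h1 using 2
      have : y * (y ^ (-(1 / 2) : ℝ)) ^ 2 = 1 := by
        rw [← Real.rpow_natCast, ← Real.rpow_mul hy0.le]
        norm_num [Real.rpow_neg_one, hy0.ne']
      linear_combination (-(shortError δ y ^ 2)) * this
  have hx2 : Tendsto (fun n : ℕ => x ^ (2 * (1 / ((n : ℝ) + 1)))) atTop (𝓝 (x ^ (2 * (0 : ℝ)))) :=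
    tendsto_const_nhds.rpow (hε.const_mul 2) (Or.inl hx0.ne')
  have hB : Tendsto (fun n : ℕ => 1.01 * x ^ (2 * (1 / ((n : ℝ) + 1))) * (x ^ 2 *
      ((1 + 1 / ((n : ℝ) + 1)) ^ 2 * meanSquareConst (Real.log (1 + δ)))) +
        404 * ((1 + 1 / ((n : ℝ) + 1)) * (1 + δ) - 1) ^ 2 * x ^ 2) atTop
      (𝓝 (1.01 * x ^ (2 * (0 : ℝ)) * (x ^ 2 * ((1 + 0) ^ 2 * meanSquareConst (Real.log (1 + δ)))) +
        404 * ((1 + 0) * (1 + δ) - 1) ^ 2 * x ^ 2)) :=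
    ((hx2.const_mul _).mul ((((hε.const_add 1).pow 2).mul_const _).const_mul _)).add
      ((((((hε.const_add 1).mul_const _).sub_const 1).pow 2).const_mul _).mul_const _)
  have hfin := le_of_tendsto_of_tendsto hL hB (by
    filter_upwards [eventually_ge_atTop 1] with n hn
    have hn' : (1 : ℝ) ≤ n := by exact_mod_cast hn
    have h2 : (1 : ℝ) / ((n : ℝ) + 1) ≤ 1 / 2 := by gcongr; linarith
    exact integral_mul_smoothError_sq_le hRH hδ hδ1 (by positivity) h2 (by positivity) h2 hx)
  refine hfin.trans (le_of_eq ?_)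
  rw [mul_zero, Real.rpow_zero]
  ring

lemma lt_log_of_le {a : ℝ} (ha : 2 * (10 : ℝ) ^ 13 ≤ a) : 30.6 < Real.log a := by
  rw [Real.lt_log_iff_exp_lt (lt_of_lt_of_le (by norm_num) ha)]
  refine lt_of_lt_of_le (lt_of_pow_lt_pow_left₀ 5 (by positivity) ?_) ha
  rw [← Real.exp_nat_mul]
  have h : Real.exp ((5 : ℕ) * 30.6) = Real.exp 1 ^ 153 := by
    rw [← Real.exp_nat_mul]; norm_num
  rw [h]
  calc Real.exp 1 ^ 153 < 2.7182818286 ^ 153 := by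
        gcongr; exact Real.exp_one_lt_d9
    _ ≤ _ := by norm_num

lemma log_two_div_log_one_add_le {δ : ℝ} (hδ : 0 < δ) (hδ1 : δ ≤ (10 : ℝ) ^ (-13 : ℤ)) :
    Real.log (2 / Real.log (1 + δ)) ≤ Real.log (2.0001 / δ) := by
  have h0 : 0 < Real.log (1 + δ) := Real.log_pos (by linarith)
  have h1 : 1 - (1 + δ)⁻¹ ≤ Real.log (1 + δ) := Real.one_sub_inv_le_log_of_pos (by linarith)
  have h2 : 1 - (1 + δ)⁻¹ = δ / (1 + δ) := by field_simp; ring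
  rw [h2, div_le_iff₀ (by linarith)] at h1
  norm_num at hδ1
  refine Real.log_le_log (by positivity) ?_
  rw [div_le_div_iff₀ h0 hδ]
  nlinarith

lemma meanSquareConst_le {δ : ℝ} (hδ : 0 < δ) (hδ1 : δ ≤ (10 : ℝ) ^ (-13 : ℤ)) :
    1.01 * meanSquareConst (Real.log (1 + δ)) + 405 * δ ^ 2 ≤
      2.2258 * δ * Real.log (2.0001 / δ) ^ 2 := by
  have h0 : 0 < Real.log (1 + δ) := Real.log_pos (by linarith)
  have h1 : Real.log (1 + δ) ≤ δ := by
    have := Real.log_le_sub_one_of_pos (by linarith : 0 < 1 + δ); linarith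
  have hb := log_two_div_log_one_add_le hδ hδ1
  norm_num at hδ1
  have hL : 30.6 < Real.log (2.0001 / δ) := lt_log_of_le (by
    rw [le_div_iff₀ hδ]; nlinarith)
  have hb0 : 0 ≤ Real.log (2 / Real.log (1 + δ)) := Real.log_nonneg (by
    rw [le_div_iff₀ h0]; linarith)
  unfold meanSquareConst
  set L := Real.log (2.0001 / δ)
  set B := Real.log (2 / Real.log (1 + δ))
  calc _ ≤ 1.01 * (1.91 * δ * ((L + 3.424) * (L + 0.01) + (L + 1.01))) + 405 * (δ * (1 / 10 ^ 13)) := by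
        rw [sq]
        gcongr
        norm_num; linarith
    _ = δ * (1.9291 * ((L + 3.424) * (L + 0.01) + (L + 1.01)) + 405 / 10 ^ 13) := by ring
    _ ≤ δ * (2.2258 * L ^ 2) := by
        gcongr
        nlinarith
    _ = _ := by ring

lemma integral_shortError_sq_initial_le {δ : ℝ} (hδ : 0 < δ) (hδ1 : δ ≤ 1 / 4) :
    ∫ y in Ioc (1 : ℝ) (3 / 2), shortError δ y ^ 2 ≤ 2 * δ ^ 2 := by
  have h0 : ∀ z : ℝ, z < 2 → chebyshevPsi z = 0 := fun z hz => by
    refine Finset.sum_eq_zero fun n hn => ?_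
    have h1 : n < 2 := (Finset.mem_Iic.1 hn).trans_lt
      ((Nat.floor_lt' (by norm_num)).2 (by exact_mod_cast hz))
    interval_cases n <;> simp
  have hE : EqOn (fun y => shortError δ y ^ 2) (fun y => (δ * y) ^ 2) (Ioc (1 : ℝ) (3 / 2)) := by
    intro y hy
    have h1 := h0 y (by linarith [hy.2])
    have h2 := h0 ((1 + δ) * y) (by nlinarith [hy.1, hy.2])
    simp [shortError, h1, h2]
  have hi := integrableOn_shortError_sq hδ 1 (3 / 2) zero_le_one
  have := setIntegral_mono_on hi
    (integrableOn_const (C := (δ * (3 / 2)) ^ 2) (by simp)) measurableSet_Ioc fun y hy => by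
      refine (hE hy).trans_le ?_
      have := hy.1
      have := hy.2
      dsimp only
      gcongr
  refine this.trans ?_
  rw [setIntegral_const, Real.volume_real_Ioc_of_le (by norm_num), smul_eq_mul]
  nlinarith [sq_nonneg δ]

end JpsiBound

/-- Assuming RH, for `x ≥ 10^13` and `δ ∈ (0, 10^{-13}]` we have
`J_ψ(x,δ) = ∫₁^x (ψ((1+δ)y) − ψ(y) − δy)² dy ≤ 2.2258 δ (log(2.0001/δ))² x²`. -/
theorem Jpsi_explicit_bound (hRH : RiemannHypothesis) (x δ : ℝ)
    (hx : (10 : ℝ) ^ (13 : ℕ) ≤ x) (hδ0 : 0 < δ) (hδ1 : δ ≤ (10 : ℝ) ^ (-13 : ℤ)) :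
    ∫ y in (1 : ℝ)..x, (chebyshevPsi ((1 + δ) * y) - chebyshevPsi y - δ * y) ^ 2 ≤
      2.2258 * δ * Real.log (2.0001 / δ) ^ 2 * x ^ 2 := by
  have hδ2 : δ ≤ 1 / 1000 := hδ1.trans (by norm_num)
  have hx1 : 3 / 2 ≤ x := le_trans (by norm_num) hx
  have i := fun a b => JpsiBound.integrableOn_shortError_sq hδ0 a b
  have h1 : IntervalIntegrable (fun y => JpsiBound.shortError δ y ^ 2) MeasureTheory.volume 1 (3 / 2) :=
    (intervalIntegrable_iff_integrableOn_Ioc_of_le (by norm_num)).2 (i _ _ zero_le_one)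
  have h2 : IntervalIntegrable (fun y => JpsiBound.shortError δ y ^ 2) MeasureTheory.volume (3 / 2) x :=
    (intervalIntegrable_iff_integrableOn_Ioc_of_le hx1).2 (i _ _ (by norm_num))
  change ∫ y in (1 : ℝ)..x, JpsiBound.shortError δ y ^ 2 ≤ _
  rw [← intervalIntegral.integral_add_adjacent_intervals h1 h2,
    intervalIntegral.integral_of_le (by norm_num), intervalIntegral.integral_of_le hx1]
  have h3 := JpsiBound.integral_shortError_sq_initial_le hδ0 (by linarith)
  have h4 := JpsiBound.integral_shortError_sq_le hRH hδ0 hδ2 hx1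
  have h5 := mul_le_mul_of_nonneg_right (JpsiBound.meanSquareConst_le hδ0 hδ1) (sq_nonneg x)
  have h6 : 2 * δ ^ 2 ≤ δ ^ 2 * x ^ 2 := by
    rw [mul_comm 2]
    exact mul_le_mul_of_nonneg_left (by nlinarith) (sq_nonneg δ)
  linarith
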